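/- Assume the Riemann Hypothesis and let 0 < B₁ < B₂ < 1 and c > 0. Suppose there are constants D and X₀ such that |V(X, δ) − (1/2)·δ·X²·(log(1/δ) + 1 − γ₀ − log 2π)| ≤ D·δ^{1+c}·X² for all X ≥ X₀ and all δ with X^{−B₂} ≤ δ ≤ X^{−B₁}. Then for any fixed A₁, A₂ with 1/B₂ < A₁ ≤ A₂ < 1/B₁ and every ε > 0, there exist constants C > 0 and T₀ ≥ 2 such that for all T ≥ T₀ and all X with T^{A₁} ≤ X ≤ T^{A₂}: |F(X,T) − (T/π)(log(T/2π) − 1)| ≤ C·(T^{3/(3+c)+ε} + T^{1+ε}(T/X^{B₂})² + T^{1+ε}(T/X^{B₁})^{−1/4}). -/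

import Mathlib

open Real MeasureTheory
open scoped Classical

/-- The Chebyshev function `ψ(x) = ∑_{n ≤ x} Λ(n)`. -/
noncomputable def chebyshevPsi (x : ℝ) : ℝ :=
  ∑ n ∈ Finset.range (⌊x⌋₊ + 1), ArithmeticFunction.vonMangoldt n

/-- The variance `V(X,δ) = ∫_1^X (ψ(x+δx) - ψ(x) - δx)² dx`. -/
noncomputable def zetaVarDelta (X δ : ℝ) : ℝ :=
  ∫ x in (1:ℝ)..X, (chebyshevPsi (x + δ * x) - chebyshevPsi x - δ * x) ^ 2

/-- The multiplicity of `1/2 + iγ` as a zero of the Riemann zeta function, defined via the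
order of vanishing of `riemannZeta` at that point. -/
noncomputable def zetaZeroMult (γ : ℝ) : ℕ :=
  if h : AnalyticAt ℂ riemannZeta (1 / 2 + (γ : ℂ) * Complex.I) then (analyticOrderAt riemannZeta (1 / 2 + (γ : ℂ) * Complex.I)).toNat else 0

/-- Montgomery's pair correlation function
`F(X,T) = ∑_{-T ≤ γ, γ' ≤ T} X^{i(γ-γ')} w(γ-γ')` with `w(u) = 4/(4+u²)`, where `γ, γ'`
run over ordinates of nontrivial zeros of zeta counted with multiplicity. -/
noncomputable def zetaPairCorr (X T : ℝ) : ℂ :=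
  ∑' γ : {γ : ℝ // riemannZeta (1 / 2 + (γ : ℂ) * Complex.I) = 0 ∧ |γ| ≤ T},
    ∑' γ' : {γ : ℝ // riemannZeta (1 / 2 + (γ : ℂ) * Complex.I) = 0 ∧ |γ| ≤ T},
      ((zetaZeroMult γ.1 * zetaZeroMult γ'.1 : ℕ) : ℂ) *
        (X : ℂ) ^ (Complex.I * ((γ.1 - γ'.1 : ℝ) : ℂ)) *
        (((4 / (4 + (γ.1 - γ'.1) ^ 2) : ℝ)) : ℂ)

set_option linter.unusedVariables false
set_option linter.unusedSectionVars false
set_option linter.unusedSimpArgs false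

namespace B1
open Filter Topology Metric

/-! ### Entire functions of order less than two -/

lemma entire_order_ne_top {f : ℂ → ℂ} (hf : Differentiable ℂ f) {z₀ : ℂ} (h0 : f z₀ ≠ 0) (ρ : ℂ) :
    analyticOrderAt f ρ ≠ ⊤ := by
  intro h
  rw [analyticOrderAt_eq_top] at h
  have := AnalyticOnNhd.eqOn_zero_of_preconnected_of_eventuallyEq_zero
    (f := f) (U := Set.univ) (fun z _ => hf.analyticAt z) isPreconnected_univ
    (Set.mem_univ ρ) h
  exact h0 (this (Set.mem_univ z₀))

lemma entire_factor_one {f : ℂ → ℂ} (hf : Differentiable ℂ f) {z₀ : ℂ} (h0 : f z₀ ≠ 0) (ρ : ℂ) :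
    ∃ g : ℂ → ℂ, Differentiable ℂ g ∧ g ρ ≠ 0 ∧
      ∀ z, f z = (z - ρ) ^ (analyticOrderNatAt f ρ) * g z := by
  obtain ⟨g₀, hg₀, hg₀ρ, hev⟩ := ((hf.analyticAt ρ).analyticOrderNatAt_eq_iff
    (entire_order_ne_top hf h0 ρ)).1 rfl
  set n := analyticOrderNatAt f ρ
  let g : ℂ → ℂ := fun z => if z = ρ then g₀ ρ else f z / (z - ρ) ^ n
  have hgev : g =ᶠ[𝓝 ρ] g₀ := by
    filter_upwards [hev] with z hz
    by_cases h : z = ρ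
    · simp [g, h]
    · have : z - ρ ≠ 0 := sub_ne_zero.2 h
      simp only [g, h, if_false, hz, smul_eq_mul]
      field_simp
  refine ⟨g, ?_, by simpa [g] using hg₀ρ, ?_⟩
  · intro z
    by_cases h : z = ρ
    · rw [h]
      exact hg₀.differentiableAt.congr_of_eventuallyEq hgev
    · have hne : z - ρ ≠ 0 := sub_ne_zero.2 h
      have : g =ᶠ[𝓝 z] fun z => f z / (z - ρ) ^ n := by
        filter_upwards [isOpen_ne.mem_nhds h] with w hw
        have hw' : w ≠ ρ := hw
        simp [g, hw']
      refine DifferentiableAt.congr_of_eventuallyEq ?_ this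
      exact (hf z).div (by fun_prop) (pow_ne_zero _ hne)
  · intro z
    by_cases h : z = ρ
    · have := hev.self_of_nhds
      rw [h]; simpa [g] using this
    · have hne : z - ρ ≠ 0 := sub_ne_zero.2 h
      simp only [g, h, if_false]
      field_simp

lemma entire_factor {f : ℂ → ℂ} (hf : Differentiable ℂ f) {z₀ : ℂ} (h0 : f z₀ ≠ 0)
    (F : Finset ℂ) :
    ∃ g : ℂ → ℂ, Differentiable ℂ g ∧ (∀ ρ ∈ F, g ρ ≠ 0) ∧
      ∀ z, f z = (∏ ρ ∈ F, (z - ρ) ^ (analyticOrderNatAt f ρ)) * g z := by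
  induction F using Finset.induction_on with
  | empty => exact ⟨f, hf, by simp, by simp⟩
  | insert a F ha ih =>
    obtain ⟨g, hg, hgF, hfg⟩ := ih
    have hg0 : g z₀ ≠ 0 := by
      intro h; apply h0; rw [hfg, h, mul_zero]
    obtain ⟨g₂, hg₂, hg₂a, hgg⟩ := entire_factor_one hg hg0 a
    have hord : analyticOrderNatAt g a = analyticOrderNatAt f a := by
      have hfe : f = (fun z => ∏ ρ ∈ F, (z - ρ) ^ (analyticOrderNatAt f ρ)) * g := by
        ext z; exact hfg z
      have hp : AnalyticAt ℂ (fun z : ℂ => ∏ ρ ∈ F, (z - ρ) ^ (analyticOrderNatAt f ρ)) a := by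
        have : Differentiable ℂ (fun z : ℂ => ∏ ρ ∈ F, (z - ρ) ^ (analyticOrderNatAt f ρ)) := by
          fun_prop
        exact this.analyticAt a
      have hpa : analyticOrderAt (fun z : ℂ => ∏ ρ ∈ F, (z - ρ) ^ (analyticOrderNatAt f ρ)) a = 0 := by
        rw [hp.analyticOrderAt_eq_zero]
        refine Finset.prod_ne_zero_iff.2 fun ρ hρ => pow_ne_zero _ (sub_ne_zero.2 ?_)
        rintro rfl; exact ha hρ
      have := analyticOrderAt_mul hp (hg.analyticAt a)
      rw [← hfe, hpa, zero_add] at this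
      simp [analyticOrderNatAt, this]
    refine ⟨g₂, hg₂, ?_, ?_⟩
    · intro ρ hρ
      rcases Finset.mem_insert.1 hρ with rfl | hρ
      · exact hg₂a
      · intro h; apply hgF ρ hρ; rw [hgg, h, mul_zero]
    · intro z
      rw [Finset.prod_insert ha, hfg z, hgg z, hord]; ring

lemma norm_blaschke {R : ℝ} {ρ z : ℂ} (hz : ‖z‖ = R) :
    ‖(R:ℂ) ^ 2 - (starRingEnd ℂ) ρ * z‖ = R * ‖z - ρ‖ := by
  have h1 : (R:ℂ)^2 = (starRingEnd ℂ) z * z := by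
    rw [← Complex.normSq_eq_conj_mul_self, Complex.normSq_eq_norm_sq, hz]; push_cast; ring
  rw [h1, ← sub_mul, ← map_sub, norm_mul, hz, Complex.norm_conj, mul_comm]

lemma blaschke_ne {R : ℝ} (hR : 0 < R) {ρ z : ℂ} (hρ : ‖ρ‖ ≤ R) (hz : ‖z‖ < R) :
    (R:ℂ) ^ 2 - (starRingEnd ℂ) ρ * z ≠ 0 := by
  intro h
  have h1 : (R:ℂ)^2 = (starRingEnd ℂ) ρ * z := sub_eq_zero.1 h
  have h2 : R^2 = ‖ρ‖ * ‖z‖ := by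
    have := congrArg norm h1
    simpa [abs_of_pos hR] using this
  nlinarith [norm_nonneg ρ, norm_nonneg z]

lemma disc_aux {f : ℂ → ℂ} (hf : Differentiable ℂ f) (h0 : f 0 ≠ 0) {R A : ℝ} (hR : 0 < R)
    (hA : 0 < A) (F : Finset ℂ) (hF : ∀ ρ, ρ ∈ F ↔ ‖ρ‖ ≤ R ∧ f ρ = 0)
    (hb : ∀ z, ‖z‖ = R → ‖f z‖ ≤ Real.exp A * ‖f 0‖) :
    (∏ ρ ∈ F, (R / ‖ρ‖) ^ (analyticOrderNatAt f ρ) ≤ Real.exp A) ∧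
    ∀ s s₁ : ℂ, ‖s‖ ≤ R / 4 → ‖s₁‖ ≤ R / 4 → f s ≠ 0 → f s₁ ≠ 0 →
      ‖logDeriv f s - logDeriv f s₁
        - ∑ ρ ∈ F, (analyticOrderNatAt f ρ : ℂ) * (1 / (s - ρ) - 1 / (s₁ - ρ))
        - ∑ ρ ∈ F, (analyticOrderNatAt f ρ : ℂ) *
          ((starRingEnd ℂ) ρ / ((R:ℂ)^2 - (starRingEnd ℂ) ρ * s)
            - (starRingEnd ℂ) ρ / ((R:ℂ)^2 - (starRingEnd ℂ) ρ * s₁))‖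
        ≤ 128 * A / R ^ 2 * ‖s - s₁‖ := by
  obtain ⟨g, hg, hgF, hfg⟩ := entire_factor hf h0 F
  set m := fun ρ => analyticOrderNatAt f ρ with hm
  let b : ℂ → ℂ := fun z => ∏ ρ ∈ F, (((R:ℂ) ^ 2 - (starRingEnd ℂ) ρ * z) / R) ^ (m ρ)
  let h : ℂ → ℂ := fun z => g z * b z
  have hbd : Differentiable ℂ b := by
    intro z
    simp only [b]
    fun_prop
  have hhd : Differentiable ℂ h := hg.mul hbd
  have hRc : (R:ℂ) ≠ 0 := by exact_mod_cast hR.ne'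
  -- on the sphere
  have hsph : ∀ z, ‖z‖ = R → ‖h z‖ = ‖f z‖ := by
    intro z hz
    simp only [h, b]
    rw [hfg z, norm_mul, norm_mul, norm_prod, norm_prod, mul_comm]
    congr 1
    refine Finset.prod_congr rfl fun ρ _ => ?_
    rw [norm_pow, norm_pow, norm_div, norm_blaschke hz, Complex.norm_real, Real.norm_eq_abs,
      abs_of_pos hR]
    congr 1
    field_simp
  have hball : ∀ z, ‖z‖ ≤ R → ‖h z‖ ≤ Real.exp A * ‖f 0‖ := by
    intro z hz
    refine Complex.norm_le_of_forall_mem_frontier_norm_le (U := ball (0:ℂ) R) isBounded_ball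
      hhd.diffContOnCl ?_ ?_
    · intro w hw
      rw [frontier_ball _ hR.ne', mem_sphere_zero_iff_norm] at hw
      rw [hsph w hw]; exact hb w hw
    · rw [closure_ball _ hR.ne', mem_closedBall_zero_iff]; exact hz
  have hρ0 : ∀ ρ ∈ F, 0 < ‖ρ‖ := by
    intro ρ hρ
    rw [norm_pos_iff]; rintro rfl
    exact h0 ((hF 0).1 hρ).2
  have hh0 : ‖h 0‖ = (∏ ρ ∈ F, (R / ‖ρ‖) ^ (m ρ)) * ‖f 0‖ := by
    simp only [h, b]
    rw [hfg 0, norm_mul, norm_mul, norm_prod, norm_prod, mul_comm, ← mul_assoc, ← Finset.prod_mul_distrib]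
    congr 1
    refine Finset.prod_congr rfl fun ρ hρ => ?_
    have := hρ0 ρ hρ
    rw [norm_pow, norm_pow, ← mul_pow]
    simp [abs_of_pos hR]
    congr 1
    field_simp
  have hf0 : 0 < ‖f 0‖ := norm_pos_iff.2 h0
  have hfirst : ∏ ρ ∈ F, (R / ‖ρ‖) ^ (m ρ) ≤ Real.exp A := by
    have := hball 0 (by simpa using hR.le)
    rw [hh0] at this
    exact le_of_mul_le_mul_right this hf0
  refine ⟨hfirst, ?_⟩
  have hprod1 : 1 ≤ ∏ ρ ∈ F, (R / ‖ρ‖) ^ (m ρ) := by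
    refine Finset.one_le_prod fun ρ hρ => one_le_pow₀ ?_
    rw [one_le_div (hρ0 ρ hρ)]
    exact ((hF ρ).1 hρ).1
  have hh0f : ‖f 0‖ ≤ ‖h 0‖ := by rw [hh0]; nlinarith
  have hh0p : 0 < ‖h 0‖ := hf0.trans_le hh0f
  have hbne : ∀ z, ‖z‖ < R → b z ≠ 0 := by
    intro z hz
    refine Finset.prod_ne_zero_iff.2 fun ρ hρ => pow_ne_zero _ (div_ne_zero ?_ hRc)
    exact blaschke_ne hR ((hF ρ).1 hρ).1 hz
  have hgne : ∀ z, ‖z‖ ≤ R → g z ≠ 0 := by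
    intro z hz hgz
    by_cases hzF : z ∈ F
    · exact hgF z hzF hgz
    · apply hzF
      rw [hF]; exact ⟨hz, by rw [hfg, hgz, mul_zero]⟩
  have hhne : ∀ z, ‖z‖ < R → h z ≠ 0 := fun z hz => mul_ne_zero (hgne z hz.le) (hbne z hz)
  -- logarithm
  have hld : DifferentiableOn ℂ (logDeriv h) (ball 0 R) := by
    intro z hz
    have hz' : ‖z‖ < R := by simpa using hz
    have h1 : DifferentiableAt ℂ (deriv h) z :=
      (hhd.analyticAt z).deriv.differentiableAt
    exact (h1.div (hhd z) (hhne z hz')).differentiableWithinAt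
  obtain ⟨L₀, hL₀⟩ := hld.isExactOn_ball
  let L : ℂ → ℂ := fun z => L₀ z - L₀ 0
  have hL : ∀ z ∈ ball (0:ℂ) R, HasDerivAt L (logDeriv h z) z := fun z hz =>
    (hL₀ z hz).sub_const _
  have hLexp : ∀ z ∈ ball (0:ℂ) R, h z = h 0 * Complex.exp (L z) := by
    intro z hz
    have hconst : ∀ w ∈ ball (0:ℂ) R, HasDerivAt (fun z => h z * Complex.exp (-L z)) 0 w := by
      intro w hw
      have hw' : ‖w‖ < R := by simpa using hw
      have h2 := (hhd w).hasDerivAt.mul ((hL w hw).neg.cexp)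
      refine h2.congr_deriv ?_
      rw [logDeriv_apply]
      have := hhne w hw'
      field_simp
      simp
    have := (convex_ball (0:ℂ) R).is_const_of_fderivWithin_eq_zero (𝕜 := ℂ)
      (f := fun z => h z * Complex.exp (-L z))
      (fun w hw => (hconst w hw).differentiableAt.differentiableWithinAt) ?_ hz (mem_ball_self hR)
    · simp only [L, sub_self, neg_zero, Complex.exp_zero, mul_one] at this
      rw [← this, mul_assoc, ← Complex.exp_add]; simp [L]
    · intro w hw
      rw [fderivWithin_of_isOpen isOpen_ball hw]
      ext
      simp [(hconst w hw).hasFDerivAt.fderiv]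
  have hLre : Set.MapsTo L (ball 0 R) {z | z.re ≤ A} := by
    intro z hz
    have hz' : ‖z‖ < R := by simpa using hz
    have h3 := hball z hz'.le
    rw [hLexp z hz, norm_mul, Complex.norm_exp] at h3
    have h4 : ‖h 0‖ * Real.exp (L z).re ≤ ‖h 0‖ * Real.exp A :=
      h3.trans (by rw [mul_comm]; gcongr)
    have h5 := le_of_mul_le_mul_left h4 hh0p
    simpa using h5
  have hLdiff : DifferentiableOn ℂ L (ball 0 R) := fun z hz =>
    (hL z hz).differentiableAt.differentiableWithinAt
  have hLbd : ∀ z, ‖z‖ ≤ R / 2 → ‖L z‖ ≤ 2 * A := by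
    intro z hz
    have := Complex.borelCaratheodory_zero hA hLdiff hLre hR
      (z := z) (by simp; linarith) (by simp [L])
    refine this.trans ?_
    rw [div_le_iff₀ (by linarith)]
    nlinarith
  have hderivL : ∀ z ∈ ball (0:ℂ) R, deriv L z = logDeriv h z := fun z hz => (hL z hz).deriv
  have hℓ : ∀ z, ‖z‖ ≤ 3 * R / 8 → ‖logDeriv h z‖ ≤ 16 * A / R := by
    intro z hz
    rw [← hderivL z (by simp; linarith)]
    have hsub : closedBall z (R/8) ⊆ ball 0 R := by
      intro w hw
      have : ‖w - z‖ ≤ R/8 := by simpa [dist_eq_norm] using hw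
      have h6 : ‖w‖ ≤ ‖w - z‖ + ‖z‖ := by simpa using norm_add_le (w - z) z
      simp; linarith
    have := Complex.norm_deriv_le_of_forall_mem_sphere_norm_le (c := z) (R := R/8) (C := 2 * A)
      (f := L) (by linarith)
      ((hLdiff.mono hsub).diffContOnCl_ball subset_rfl) ?_
    · refine this.trans (le_of_eq ?_); field_simp; norm_num
    · intro w hw
      apply hLbd
      have : ‖w - z‖ = R/8 := by simpa [dist_eq_norm] using hw
      have h6 : ‖w‖ ≤ ‖w - z‖ + ‖z‖ := by simpa using norm_add_le (w - z) z
      linarith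
  have hℓ' : ∀ z, ‖z‖ ≤ R / 4 → ‖deriv (logDeriv h) z‖ ≤ 128 * A / R ^ 2 := by
    intro z hz
    have hsub : closedBall z (R/8) ⊆ ball 0 R := by
      intro w hw
      have : ‖w - z‖ ≤ R/8 := by simpa [dist_eq_norm] using hw
      have h6 : ‖w‖ ≤ ‖w - z‖ + ‖z‖ := by simpa using norm_add_le (w - z) z
      simp; linarith
    have := Complex.norm_deriv_le_of_forall_mem_sphere_norm_le (c := z) (R := R/8) (C := 16 * A / R)
      (f := logDeriv h) (by linarith)
      ((hld.mono hsub).diffContOnCl_ball subset_rfl) ?_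
    · refine this.trans (le_of_eq ?_); field_simp; norm_num
    · intro w hw
      apply hℓ
      have : ‖w - z‖ = R/8 := by simpa [dist_eq_norm] using hw
      have h6 : ‖w‖ ≤ ‖w - z‖ + ‖z‖ := by simpa using norm_add_le (w - z) z
      linarith
  intro s s₁ hs hs₁ hfs hfs₁
  have hmv := Convex.norm_image_sub_le_of_norm_deriv_le (𝕜 := ℂ) (f := logDeriv h)
    (s := closedBall 0 (R/4)) (x := s₁) (y := s) (C := 128 * A / R ^ 2)
    (fun w hw => (hld.differentiableAt (isOpen_ball.mem_nhds (by
      simp at hw ⊢; linarith))))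
    (fun w hw => hℓ' w (by simpa using hw)) (convex_closedBall _ _) (by simpa using hs₁)
    (by simpa using hs)
  have hform : ∀ z, ‖z‖ ≤ R / 4 → f z ≠ 0 → logDeriv h z = logDeriv f z
      - ∑ ρ ∈ F, (m ρ : ℂ) * (1 / (z - ρ))
      - ∑ ρ ∈ F, (m ρ : ℂ) * ((starRingEnd ℂ) ρ / ((R:ℂ)^2 - (starRingEnd ℂ) ρ * z)) := by
    intro z hz hfz
    have hzR : ‖z‖ < R := by linarith
    have hzρ : ∀ ρ ∈ F, z - ρ ≠ 0 := by
      intro ρ hρ h7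
      rw [sub_eq_zero] at h7
      exact hfz (h7 ▸ ((hF ρ).1 hρ).2)
    have e1 : logDeriv f z = ∑ ρ ∈ F, (m ρ : ℂ) * (1 / (z - ρ)) + logDeriv g z := by
      have : f = fun z => (∏ ρ ∈ F, (z - ρ) ^ (m ρ)) * g z := by ext z; exact hfg z
      rw [this, logDeriv_mul z (Finset.prod_ne_zero_iff.2 fun ρ hρ => pow_ne_zero _ (hzρ ρ hρ))
        (hgne z hzR.le) (by fun_prop) (hg z)]
      rw [logDeriv_prod (f := fun ρ z => (z - ρ) ^ (m ρ)) (fun ρ hρ => pow_ne_zero _ (hzρ ρ hρ)) (fun ρ hρ => by fun_prop)]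
      congr 1
      refine Finset.sum_congr rfl fun ρ hρ => ?_
      rw [logDeriv_fun_pow (by fun_prop)]
      simp [logDeriv_apply]
    have e2 : logDeriv h z = logDeriv g z - ∑ ρ ∈ F, (m ρ : ℂ) * ((starRingEnd ℂ) ρ / ((R:ℂ)^2 - (starRingEnd ℂ) ρ * z)) := by
      simp only [h]
      rw [logDeriv_mul z (hgne z hzR.le) (hbne z hzR) (hg z) (hbd z)]
      simp only [b]
      rw [logDeriv_prod (f := fun ρ z => (((R:ℂ) ^ 2 - (starRingEnd ℂ) ρ * z) / R) ^ (m ρ)) (fun ρ hρ => pow_ne_zero _ (div_ne_zero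
        (blaschke_ne hR ((hF ρ).1 hρ).1 hzR) hRc)) (fun ρ hρ => by fun_prop)]
      rw [sub_eq_add_neg, ← Finset.sum_neg_distrib]
      congr 1
      refine Finset.sum_congr rfl fun ρ hρ => ?_
      rw [logDeriv_fun_pow (by fun_prop)]
      have hne := blaschke_ne hR ((hF ρ).1 hρ).1 hzR
      have hd : HasDerivAt (fun z : ℂ => ((R:ℂ) ^ 2 - (starRingEnd ℂ) ρ * z) / R)
          ((-((starRingEnd ℂ) ρ)) / R) z := by
        have := (((hasDerivAt_id z).const_mul ((starRingEnd ℂ) ρ)).const_sub ((R:ℂ)^2)).div_const (R:ℂ)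
        simpa using this
      rw [logDeriv_apply, hd.deriv]
      field_simp
    rw [e1, e2]; ring
  rw [hform s hs hfs, hform s₁ hs₁ hfs₁] at hmv
  refine le_trans (le_of_eq ?_) hmv
  congr 1
  simp only [mul_sub, Finset.sum_sub_distrib]
  ring

end B1

namespace B1
open Filter Topology Metric

/-- multiplicity -/
noncomputable def mu (f : ℂ → ℂ) (ρ : ℂ) : ℕ := analyticOrderNatAt f ρ

lemma mu_ne_zero_iff {f : ℂ → ℂ} (hf : Differentiable ℂ f) {z₀ : ℂ} (h0 : f z₀ ≠ 0) (ρ : ℂ) :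
    mu f ρ ≠ 0 ↔ f ρ = 0 := by
  have h1 := entire_order_ne_top hf h0 ρ
  have h2 := (hf.analyticAt ρ).analyticOrderAt_ne_zero
  rw [← h2, mu, analyticOrderNatAt, ne_eq, ENat.toNat_eq_zero]
  tauto

lemma zeros_finite {f : ℂ → ℂ} (hf : Differentiable ℂ f) {z₀ : ℂ} (h0 : f z₀ ≠ 0) (R : ℝ) :
    {ρ : ℂ | ‖ρ‖ ≤ R ∧ f ρ = 0}.Finite := by
  by_contra hinf
  have hinf' : {ρ : ℂ | ‖ρ‖ ≤ R ∧ f ρ = 0}.Infinite := hinf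
  obtain ⟨x, hx, hacc⟩ := hinf'.exists_accPt_of_subset_isCompact
    (isCompact_closedBall (0:ℂ) R) (fun ρ hρ => by simpa using hρ.1)
  have hfr : ∃ᶠ z in 𝓝[≠] x, f z = 0 := by
    rw [accPt_iff_frequently_nhdsNE] at hacc
    exact hacc.mono fun z hz => hz.2
  have := AnalyticOnNhd.eqOn_zero_of_preconnected_of_frequently_eq_zero
    (f := f) (U := Set.univ) (fun z _ => hf.analyticAt z) isPreconnected_univ
    (Set.mem_univ x) hfr
  exact h0 (this (Set.mem_univ z₀))

/-- zeros in a disc -/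
noncomputable def zs {f : ℂ → ℂ} (hf : Differentiable ℂ f) (h0 : f 0 ≠ 0) (R : ℝ) : Finset ℂ :=
  (zeros_finite hf h0 R).toFinset

lemma mem_zs {f : ℂ → ℂ} (hf : Differentiable ℂ f) (h0 : f 0 ≠ 0) (R : ℝ) (ρ : ℂ) :
    ρ ∈ zs hf h0 R ↔ ‖ρ‖ ≤ R ∧ f ρ = 0 := by simp [zs]

lemma growth_exp {f : ℂ → ℂ} (h0 : f 0 ≠ 0) {l C : ℝ} (hl : 1 < l)
    (hg : ∀ z, ‖f z‖ ≤ Real.exp (C * (1 + ‖z‖) ^ l)) :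
    ∃ K : ℝ, 0 < K ∧ ∀ R : ℝ, 1 ≤ R → ∀ z, ‖z‖ = R → ‖f z‖ ≤ Real.exp (K * R ^ l) * ‖f 0‖ := by
  have hf0 : 0 < ‖f 0‖ := norm_pos_iff.2 h0
  refine ⟨|C| * 2 ^ l + |Real.log ‖f 0‖| + 1, by positivity, fun R hR z hz => ?_⟩
  refine (hg z).trans ?_
  rw [hz]
  nth_rewrite 2 [← Real.exp_log hf0]
  rw [← Real.exp_add]
  apply Real.exp_le_exp.2
  have h1 : (1 + R) ^ l ≤ (2:ℝ)^l * R ^ l := by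
    rw [← Real.mul_rpow (by norm_num) (by linarith)]
    exact Real.rpow_le_rpow (by linarith) (by linarith) (by linarith)
  have h2 : 1 ≤ R ^ l := Real.one_le_rpow hR (by linarith)
  have h3 : C * (1+R)^l ≤ |C| * (2^l * R^l) := by
    have : 0 ≤ (1+R)^l := by positivity
    calc C * (1+R)^l ≤ |C| * (1+R)^l := by gcongr; exact le_abs_self C
      _ ≤ _ := by gcongr
  have h4 := neg_abs_le (Real.log ‖f 0‖)
  have h5 := abs_nonneg (Real.log ‖f 0‖)
  nlinarith

lemma count_bound {f : ℂ → ℂ} (hf : Differentiable ℂ f) (h0 : f 0 ≠ 0) {l C : ℝ} (hl : 1 < l)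
    (hg : ∀ z, ‖f z‖ ≤ Real.exp (C * (1 + ‖z‖) ^ l)) :
    ∃ K : ℝ, 0 < K ∧ ∀ R : ℝ, 1 ≤ R → ∑ ρ ∈ zs hf h0 R, (mu f ρ : ℝ) ≤ K * R ^ l := by
  obtain ⟨K, hK, hKb⟩ := growth_exp h0 hl hg
  refine ⟨K * 2 ^ l / Real.log 2, by positivity, fun R hR => ?_⟩
  have h1 := (disc_aux hf h0 (R := 2 * R) (A := K * (2*R)^l) (by linarith) (by positivity)
    (zs hf h0 (2*R)) (mem_zs hf h0 _) (hKb (2*R) (by linarith))).1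
  have hpos : ∀ ρ ∈ zs hf h0 (2*R), 0 < ‖ρ‖ := by
    intro ρ hρ
    rw [norm_pos_iff]; rintro rfl
    exact h0 ((mem_zs hf h0 _ _).1 hρ).2
  have hsub : zs hf h0 R ⊆ zs hf h0 (2*R) := by
    intro ρ hρ
    rw [mem_zs] at hρ ⊢
    exact ⟨by linarith [hρ.1], hρ.2⟩
  have h2 : ∏ ρ ∈ zs hf h0 R, (2:ℝ) ^ (mu f ρ) ≤ Real.exp (K * (2*R)^l) := by
    refine le_trans ?_ h1
    calc ∏ ρ ∈ zs hf h0 R, (2:ℝ) ^ (mu f ρ)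
        ≤ ∏ ρ ∈ zs hf h0 R, ((2 * R) / ‖ρ‖) ^ (mu f ρ) := by
          refine Finset.prod_le_prod (fun _ _ => by positivity) fun ρ hρ => ?_
          have := hpos ρ (hsub hρ)
          have h3 := ((mem_zs hf h0 _ _).1 hρ).1
          refine pow_le_pow_left₀ (by norm_num) ?_ _
          rw [le_div_iff₀ this]; linarith
      _ ≤ _ := by
          refine Finset.prod_le_prod_of_subset_of_one_le hsub (fun _ _ => by positivity) ?_
          intro ρ hρ _
          refine one_le_pow₀ ?_
          rw [one_le_div (hpos ρ hρ)]
          exact ((mem_zs hf h0 _ _).1 hρ).1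
  rw [Finset.prod_pow_eq_pow_sum] at h2
  have h3 := Real.log_le_log (by positivity) h2
  rw [Real.log_exp, Real.log_pow] at h3
  push_cast at h3
  rw [Real.mul_rpow (by norm_num) (by linarith)] at h3
  rw [div_mul_eq_mul_div, le_div_iff₀ (Real.log_pos (by norm_num))]
  linarith

lemma summable_zeros {f : ℂ → ℂ} (hf : Differentiable ℂ f) (h0 : f 0 ≠ 0) {l C : ℝ} (hl : 1 < l)
    (hg : ∀ z, ‖f z‖ ≤ Real.exp (C * (1 + ‖z‖) ^ l)) {l' : ℝ} (hl' : l < l') :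
    Summable (fun ρ : ℂ => (mu f ρ : ℝ) * (1 + ‖ρ‖) ^ (-l')) := by
  obtain ⟨K, hK, hKb⟩ := count_bound hf h0 hl hg
  have hr : (2:ℝ) ^ (l - l') < 1 := Real.rpow_lt_one_of_one_lt_of_neg (by norm_num) (by linarith)
  have hr0 : 0 ≤ (2:ℝ) ^ (l - l') := by positivity
  refine summable_of_sum_le (c := 2 ^ l' * (K * (1 - (2:ℝ) ^ (l - l'))⁻¹)) (fun ρ => by positivity) ?_
  intro G
  have hk : ∀ ρ : ℂ, ∃ k : ℕ, 1 + ‖ρ‖ ≤ 2 ^ k ∧ (2:ℝ) ^ k ≤ 2 * (1 + ‖ρ‖) := by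
    intro ρ
    obtain ⟨n, hn1, hn2⟩ := exists_nat_pow_near (y := (2:ℝ)) (x := 1 + ‖ρ‖) (by linarith [norm_nonneg ρ]) (by norm_num)
    exact ⟨n+1, hn2.le, by rw [pow_succ]; linarith⟩
  choose k hk1 hk2 using hk
  have hle : ∀ ρ, (mu f ρ : ℝ) * (1 + ‖ρ‖) ^ (-l') ≤
      2 ^ l' * ((mu f ρ : ℝ) * ((2:ℝ) ^ (k ρ)) ^ (-l')) := by
    intro ρ
    have : (1 + ‖ρ‖) ^ (-l') ≤ 2 ^ l' * ((2:ℝ) ^ (k ρ)) ^ (-l') := by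
      have h1 : (0:ℝ) < 1 + ‖ρ‖ := by positivity
      have h2 : (2 * (1 + ‖ρ‖)) ^ (-l') ≤ ((2:ℝ)^(k ρ)) ^ (-l') :=
        Real.rpow_le_rpow_of_nonpos (by positivity) (hk2 ρ) (by linarith)
      rw [Real.mul_rpow (by norm_num) h1.le] at h2
      calc (1 + ‖ρ‖) ^ (-l') = 2 ^ l' * (2 ^ (-l') * (1 + ‖ρ‖) ^ (-l')) := by
            rw [← mul_assoc, ← Real.rpow_add (by norm_num)]; simp
        _ ≤ _ := by gcongr
    calc _ ≤ (mu f ρ : ℝ) * (2 ^ l' * ((2:ℝ) ^ (k ρ)) ^ (-l')) := by gcongr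
      _ = _ := by ring
  refine (Finset.sum_le_sum fun ρ _ => hle ρ).trans ?_
  rw [← Finset.mul_sum]
  gcongr
  set N := G.sup k + 1
  calc ∑ ρ ∈ G, (mu f ρ : ℝ) * ((2:ℝ) ^ (k ρ)) ^ (-l')
      = ∑ ρ ∈ G, ∑ j ∈ Finset.range N, if j = k ρ then (mu f ρ : ℝ) * ((2:ℝ) ^ j) ^ (-l') else 0 := by
        refine Finset.sum_congr rfl fun ρ hρ => ?_
        rw [Finset.sum_ite_eq', if_pos]
        rw [Finset.mem_range]
        have := Finset.le_sup (f := k) hρ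
        omega
    _ = ∑ j ∈ Finset.range N, ∑ ρ ∈ G, if j = k ρ then (mu f ρ : ℝ) * ((2:ℝ) ^ j) ^ (-l') else 0 :=
        Finset.sum_comm
    _ ≤ ∑ j ∈ Finset.range N, K * ((2:ℝ) ^ (l - l')) ^ j := by
        refine Finset.sum_le_sum fun j _ => ?_
        have h1 : ∑ ρ ∈ G, (if j = k ρ then (mu f ρ : ℝ) * ((2:ℝ) ^ j) ^ (-l') else 0)
            ≤ ∑ ρ ∈ zs hf h0 (2^j), (mu f ρ : ℝ) * ((2:ℝ) ^ j) ^ (-l') := by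
          rw [← Finset.sum_filter]
          have h5 : ∑ ρ ∈ (G.filter fun ρ => j = k ρ) ∩ zs hf h0 (2^j), (mu f ρ : ℝ) * ((2:ℝ) ^ j) ^ (-l')
              = ∑ ρ ∈ G.filter (fun ρ => j = k ρ), (mu f ρ : ℝ) * ((2:ℝ) ^ j) ^ (-l') := by
            refine Finset.sum_subset Finset.inter_subset_left ?_
            intro ρ hρ hne
            by_contra h6
            apply hne
            refine Finset.mem_inter.2 ⟨hρ, ?_⟩
            rw [mem_zs]
            have h2 := (Finset.mem_filter.1 hρ).2
            refine ⟨by rw [h2]; linarith [hk1 ρ], ?_⟩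
            rw [← mu_ne_zero_iff hf h0]
            intro h3; apply h6; simp [h3]
          rw [← h5]
          exact Finset.sum_le_sum_of_subset_of_nonneg Finset.inter_subset_right
              (fun _ _ _ => by positivity)
        refine h1.trans ?_
        rw [← Finset.sum_mul]
        have h2 := hKb (2^j) (one_le_pow₀ (by norm_num))
        calc _ ≤ K * ((2:ℝ)^j)^l * ((2:ℝ)^j)^(-l') := by gcongr
          _ = _ := by
            rw [mul_assoc, ← Real.rpow_add (by positivity), ← Real.rpow_natCast, ← Real.rpow_natCast,
              ← Real.rpow_mul (by norm_num), ← Real.rpow_mul (by norm_num)]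
            congr 2; ring
    _ ≤ _ := by
        rw [← Finset.mul_sum]
        gcongr
        rw [← tsum_geometric_of_lt_one hr0 hr]
        exact (summable_geometric_of_lt_one hr0 hr).sum_le_tsum _ (fun _ _ => by positivity)

end B1

namespace B1
open Filter Topology Metric

lemma pf_summable {f : ℂ → ℂ} (hf : Differentiable ℂ f) (h0 : f 0 ≠ 0)
    (hsum : Summable (fun ρ : ℂ => (mu f ρ : ℝ) * (1 + ‖ρ‖) ^ (-(2:ℝ)))) (s s₁ : ℂ) :
    Summable (fun ρ => (mu f ρ : ℂ) * (1 / (s - ρ) - 1 / (s₁ - ρ))) := by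
  set M := 2 * (‖s‖ + ‖s₁‖ + 1) with hM
  refine Summable.of_norm_bounded_eventually (g := fun ρ => (16 * ‖s₁ - s‖) * ((mu f ρ : ℝ) * (1 + ‖ρ‖) ^ (-(2:ℝ))))
    (hsum.mul_left _) ?_
  have : {ρ : ℂ | ‖ρ‖ ≤ M ∧ f ρ = 0}.Finite := zeros_finite hf h0 M
  filter_upwards [this.compl_mem_cofinite] with ρ hρ
  by_cases hmu : mu f ρ = 0
  · simp [hmu]
  have hρ0 : f ρ = 0 := (mu_ne_zero_iff hf h0 ρ).1 hmu
  have hρM : M < ‖ρ‖ := by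
    by_contra h
    exact hρ ⟨not_lt.1 h, hρ0⟩
  have hns := norm_nonneg s
  have hns1 := norm_nonneg s₁
  have b1 : (1 + ‖ρ‖) / 4 ≤ ‖s - ρ‖ := by
    have := norm_sub_norm_le ρ s
    rw [norm_sub_rev] at this; linarith
  have b2 : (1 + ‖ρ‖) / 4 ≤ ‖s₁ - ρ‖ := by
    have := norm_sub_norm_le ρ s₁
    rw [norm_sub_rev] at this; linarith
  have p0 : 0 < (1 + ‖ρ‖) / 4 := by positivity
  have n1 : s - ρ ≠ 0 := norm_pos_iff.1 (p0.trans_le b1)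
  have n2 : s₁ - ρ ≠ 0 := norm_pos_iff.1 (p0.trans_le b2)
  have e : 1 / (s - ρ) - 1 / (s₁ - ρ) = (s₁ - s) / ((s - ρ) * (s₁ - ρ)) := by
    field_simp; ring
  rw [e, norm_mul, norm_div, norm_mul, Complex.norm_natCast]
  have : ‖s₁ - s‖ / (‖s - ρ‖ * ‖s₁ - ρ‖) ≤ ‖s₁ - s‖ / ((1 + ‖ρ‖) / 4 * ((1 + ‖ρ‖) / 4)) := by
    gcongr
  calc _ ≤ (mu f ρ : ℝ) * (‖s₁ - s‖ / ((1 + ‖ρ‖) / 4 * ((1 + ‖ρ‖) / 4))) := by gcongr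
    _ = _ := by
      rw [Real.rpow_neg (by positivity)]
      norm_cast
      field_simp
      try ring

lemma pf {f : ℂ → ℂ} (hf : Differentiable ℂ f) (h0 : f 0 ≠ 0) {l C : ℝ} (hl : 1 < l) (hl2 : l < 2)
    (hg : ∀ z, ‖f z‖ ≤ Real.exp (C * (1 + ‖z‖) ^ l)) (s s₁ : ℂ) (hs : f s ≠ 0) (hs₁ : f s₁ ≠ 0) :
    HasSum (fun ρ => (mu f ρ : ℂ) * (1 / (s - ρ) - 1 / (s₁ - ρ))) (logDeriv f s - logDeriv f s₁) := by
  have hsm := pf_summable hf h0 (summable_zeros hf h0 hl hg hl2) s s₁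
  set t := fun ρ => (mu f ρ : ℂ) * (1 / (s - ρ) - 1 / (s₁ - ρ)) with ht
  have hzsum : ∀ n : ℕ, ∑' ρ, (if ‖ρ‖ ≤ (n:ℝ) then t ρ else 0) = ∑ ρ ∈ zs hf h0 n, t ρ := by
    intro n
    rw [tsum_eq_sum (s := zs hf h0 n)]
    · refine Finset.sum_congr rfl fun ρ hρ => ?_
      rw [if_pos ((mem_zs hf h0 _ _).1 hρ).1]
    · intro ρ hρ
      split_ifs with h
      · by_cases hmu : mu f ρ = 0
        · simp [ht, hmu]
        · exact absurd ((mem_zs hf h0 _ _).2 ⟨h, (mu_ne_zero_iff hf h0 ρ).1 hmu⟩) hρ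
      · rfl
  have hlim1 : Tendsto (fun n : ℕ => ∑ ρ ∈ zs hf h0 n, t ρ) atTop (𝓝 (∑' ρ, t ρ)) := by
    simp_rw [← hzsum]
    refine tendsto_tsum_of_dominated_convergence (bound := fun ρ => ‖t ρ‖) hsm.norm ?_ ?_
    · intro ρ
      refine tendsto_const_nhds.congr' ?_
      filter_upwards [eventually_ge_atTop (⌈‖ρ‖⌉₊)] with n hn
      rw [if_pos (Nat.ceil_le.1 hn)]
    · refine Eventually.of_forall fun n ρ => ?_
      split_ifs <;> simp
  obtain ⟨K, hK, hKb⟩ := growth_exp h0 hl hg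
  obtain ⟨N, hN, hNb⟩ := count_bound hf h0 hl hg
  have hlim2 : Tendsto (fun n : ℕ => ∑ ρ ∈ zs hf h0 n, t ρ) atTop (𝓝 (logDeriv f s - logDeriv f s₁)) := by
    rw [tendsto_iff_norm_sub_tendsto_zero]
    refine squeeze_zero' (g := fun n : ℕ => (128 * K * ‖s - s₁‖ + 4 * N * ‖s - s₁‖) * (n:ℝ) ^ (l - 2))
      (Eventually.of_forall fun _ => norm_nonneg _) ?_ ?_
    · filter_upwards [eventually_ge_atTop (max 1 (max ⌈4 * ‖s‖⌉₊ ⌈4 * ‖s₁‖⌉₊))] with n hn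
      have hn1 : (1:ℝ) ≤ n := by exact_mod_cast (le_max_left _ _).trans hn
      have hns : ‖s‖ ≤ n / 4 := by
        have := Nat.ceil_le.1 (((le_max_left _ _).trans (le_max_right _ _)).trans hn)
        linarith
      have hns1 : ‖s₁‖ ≤ n / 4 := by
        have := Nat.ceil_le.1 (((le_max_right _ _).trans (le_max_right _ _)).trans hn)
        linarith
      have hnp : (0:ℝ) < n := by linarith
      have hd := (disc_aux hf h0 (R := n) (A := K * (n:ℝ)^l) hnp (by positivity) (zs hf h0 n)
        (mem_zs hf h0 _) (hKb n hn1)).2 s s₁ hns hns1 hs hs₁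
      have hbl : ‖∑ ρ ∈ zs hf h0 n, (analyticOrderNatAt f ρ : ℂ) *
          ((starRingEnd ℂ) ρ / (((n:ℝ):ℂ)^2 - (starRingEnd ℂ) ρ * s)
            - (starRingEnd ℂ) ρ / (((n:ℝ):ℂ)^2 - (starRingEnd ℂ) ρ * s₁))‖ ≤
            4 * N * ‖s - s₁‖ * (n:ℝ) ^ (l - 2) := by
        refine (norm_sum_le _ _).trans ?_
        have hterm : ∀ ρ ∈ zs hf h0 n, ‖(analyticOrderNatAt f ρ : ℂ) *
          ((starRingEnd ℂ) ρ / (((n:ℝ):ℂ)^2 - (starRingEnd ℂ) ρ * s)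
            - (starRingEnd ℂ) ρ / (((n:ℝ):ℂ)^2 - (starRingEnd ℂ) ρ * s₁))‖ ≤
            (mu f ρ : ℝ) * (4 * ‖s - s₁‖ * (n:ℝ)^(-(2:ℝ))) := by
          intro ρ hρ
          have hρn := ((mem_zs hf h0 _ _).1 hρ).1
          have hlow : ∀ w : ℂ, ‖w‖ ≤ n / 4 → (n:ℝ)^2 / 2 ≤ ‖((n:ℝ):ℂ)^2 - (starRingEnd ℂ) ρ * w‖ := by
            intro w hw
            have h1 := norm_sub_norm_le (((n:ℝ):ℂ)^2) ((starRingEnd ℂ) ρ * w)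
            rw [norm_mul, Complex.norm_conj, norm_pow, Complex.norm_real, Real.norm_eq_abs, abs_of_pos hnp] at h1
            have h2 : ‖ρ‖ * ‖w‖ ≤ n * (n / 4) := by gcongr
            nlinarith
          have l1 := hlow s hns
          have l2 := hlow s₁ hns1
          have p0 : 0 < (n:ℝ)^2 / 2 := by positivity
          have n1 := norm_pos_iff.1 (p0.trans_le l1)
          have n2 := norm_pos_iff.1 (p0.trans_le l2)
          rw [div_sub_div _ _ n1 n2]
          have e : (starRingEnd ℂ) ρ * (((n:ℝ):ℂ)^2 - (starRingEnd ℂ) ρ * s₁) -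
            (((n:ℝ):ℂ)^2 - (starRingEnd ℂ) ρ * s) * (starRingEnd ℂ) ρ =
              (starRingEnd ℂ) ρ * (starRingEnd ℂ) ρ * (s - s₁) := by ring
          rw [e, norm_mul, norm_div, norm_mul, norm_mul, norm_mul, Complex.norm_conj, Complex.norm_natCast]
          have : ‖ρ‖ * ‖ρ‖ * ‖s - s₁‖ / (‖((n:ℝ):ℂ)^2 - (starRingEnd ℂ) ρ * s‖ * ‖((n:ℝ):ℂ)^2 - (starRingEnd ℂ) ρ * s₁‖)
              ≤ n * n * ‖s - s₁‖ / ((n:ℝ)^2 / 2 * ((n:ℝ)^2 / 2)) := by gcongr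
          calc _ ≤ (mu f ρ : ℝ) * (n * n * ‖s - s₁‖ / ((n:ℝ)^2 / 2 * ((n:ℝ)^2 / 2))) := by
                unfold mu; gcongr
            _ = _ := by
              rw [Real.rpow_neg hnp.le]
              norm_cast
              field_simp
              try ring
        refine (Finset.sum_le_sum hterm).trans ?_
        rw [← Finset.sum_mul]
        calc _ ≤ N * (n:ℝ)^l * (4 * ‖s - s₁‖ * (n:ℝ)^(-(2:ℝ))) := by
              gcongr; exact hNb n hn1
          _ = 4 * N * ‖s - s₁‖ * ((n:ℝ)^l * (n:ℝ)^(-(2:ℝ))) := by ring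
          _ = _ := by rw [← Real.rpow_add hnp]; rfl
      have hA : 128 * (K * (n:ℝ)^l) / (n:ℝ)^2 * ‖s - s₁‖ = 128 * K * ‖s - s₁‖ * (n:ℝ)^(l-2) := by
        rw [Real.rpow_sub hnp]
        norm_cast
        field_simp
      rw [hA] at hd
      rw [add_mul]
      refine le_trans ?_ (add_le_add hd hbl)
      rw [norm_sub_rev]
      refine le_trans (le_of_eq ?_) (norm_add_le _ _)
      congr 1
      simp only [ht, mu]
      ring
    · have : Tendsto (fun n : ℕ => (n:ℝ) ^ (-(2 - l))) atTop (𝓝 0) :=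
        (tendsto_rpow_neg_atTop (by linarith)).comp tendsto_natCast_atTop_atTop
      have := this.const_mul (128 * K * ‖s - s₁‖ + 4 * N * ‖s - s₁‖)
      simpa using this
  rw [← tendsto_nhds_unique hlim1 hlim2]
  exact hsm.hasSum

end B1

namespace B1
open Filter Topology Metric

/-! ### Growth of zeta -/

/-- entire function `(s-1)ζ(s)` -/
noncomputable abbrev Zf : ℂ → ℂ := riemannZeta₁

lemma Zf_diff : Differentiable ℂ Zf := differentiable_riemannZeta₁

lemma Zf_eq {s : ℂ} (hs : s ≠ 1) : Zf s = (s - 1) * riemannZeta s := by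
  rw [riemannZeta_eq_inv_sub_mul hs]
  have : s - 1 ≠ 0 := sub_ne_zero.2 hs
  field_simp

lemma Zf_zero : Zf 0 ≠ 0 := by
  rw [Zf_eq (by norm_num), riemannZeta_zero]; norm_num

/-- fractional part cut off -/
noncomputable def frc (x : ℝ) : ℂ := if 1 < x then ((Int.fract x : ℝ) : ℂ) else 0

lemma frc_norm (x : ℝ) : ‖frc x‖ ≤ 1 := by
  unfold frc
  split_ifs
  · rw [Complex.norm_real, Real.norm_eq_abs, abs_of_nonneg (Int.fract_nonneg x)]
    exact (Int.fract_lt_one x).le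
  · simp

lemma frc_meas : Measurable frc := by
  unfold frc
  refine Measurable.ite measurableSet_Ioi ?_ measurable_const
  exact Complex.measurable_ofReal.comp measurable_fract

lemma frc_mellin_diff {s : ℂ} (hs : 0 < s.re) : DifferentiableAt ℂ (fun s => mellin frc (-s)) s := by
  have h : DifferentiableAt ℂ (mellin frc) (-s) := by
    refine mellin_differentiableAt_of_isBigO_rpow (a := 0) (b := -s.re - 1) ?_ ?_ (by simpa using hs) ?_
      (by simp)
    · refine LocallyIntegrable.locallyIntegrableOn ?_ _
      refine (locallyIntegrable_const (1:ℝ)).mono frc_meas.aestronglyMeasurable ?_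
      exact Eventually.of_forall fun x => by simpa using frc_norm x
    · refine Asymptotics.IsBigO.of_bound 1 (Eventually.of_forall fun x => ?_)
      simpa using frc_norm x
    · refine Asymptotics.IsBigO.of_bound 1 ?_
      filter_upwards [mem_nhdsWithin_of_mem_nhds (Iio_mem_nhds (zero_lt_one))] with x hx
      have : ¬ (1 < x) := not_lt.2 (le_of_lt hx)
      simp only [frc, this, if_false, norm_zero]
      positivity
  exact h.comp s differentiableAt_id.neg

lemma frc_mellin {s : ℂ} : mellin frc (-s) = ∫ t in Set.Ioi (1:ℝ), ((Int.fract t : ℝ) : ℂ) * t ^ (-(s+1)) := by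
  unfold mellin
  rw [← integral_indicator measurableSet_Ioi, ← integral_indicator measurableSet_Ioi]
  congr 1
  ext t
  by_cases h : 1 < t
  · have h0 : 0 < t := by linarith
    simp only [Set.indicator, Set.mem_Ioi, h, h0, if_true, frc, smul_eq_mul]
    rw [mul_comm]; congr 2; ring
  · simp [Set.indicator, h, frc]

lemma frc_mellin_norm {s : ℂ} (hs : 1/2 ≤ s.re) : ‖mellin frc (-s)‖ ≤ 2 := by
  rw [frc_mellin]
  have hi : ∫ t in Set.Ioi (1:ℝ), t ^ (-(3/2) : ℝ) = 2 := by
    rw [integral_Ioi_rpow_of_lt (by norm_num) (by norm_num)]; norm_num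
  rw [← hi]
  refine norm_integral_le_of_norm_le (integrableOn_Ioi_rpow_of_lt (by norm_num) (by norm_num)) ?_
  refine (ae_restrict_iff' measurableSet_Ioi).2 (Eventually.of_forall fun t ht => ?_)
  have ht1 : 1 < t := ht
  rw [norm_mul, Complex.norm_cpow_eq_rpow_re_of_pos (by linarith), Complex.norm_real, Real.norm_eq_abs,
    abs_of_nonneg (Int.fract_nonneg t)]
  calc Int.fract t * t ^ (-(s+1)).re ≤ 1 * t ^ (-(3/2) : ℝ) := by
        gcongr
        · exact (Int.fract_lt_one t).le
        · exact ht1.le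
        · simp; linarith
    _ = _ := one_mul _

lemma zeta_int {s : ℂ} (hs : 1 < s.re) : Zf s = s - s * (s - 1) * mellin frc (-s) := by
  have hs1 : s ≠ 1 := by rintro rfl; simp at hs
  have hs1' : s - 1 ≠ 0 := sub_ne_zero.2 hs1
  have hO : (fun n : ℕ ↦ ∑ k ∈ Finset.Icc 1 n, (1 : ℕ → ℂ) k) =O[atTop] fun n ↦ (n : ℝ) ^ (1:ℝ) := by
    refine Asymptotics.IsBigO.of_bound 1 (Eventually.of_forall fun n => ?_)
    simp
  have h1 := LSeries_eq_mul_integral (1 : ℕ → ℂ) (r := 1) zero_le_one hs (LSeriesSummable_one_iff.2 hs) hO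
  rw [LSeries_one_eq_riemannZeta hs] at h1
  rw [Zf_eq hs1, h1, frc_mellin]
  have i1 : IntegrableOn (fun t : ℝ => ((Int.fract t : ℝ) : ℂ) * (t:ℂ) ^ (-(s+1))) (Set.Ioi 1) := by
    have := (integrableOn_Ioi_cpow_of_lt (a := -(s+1)) (c := 1) (by simp; linarith) one_pos)
    refine Integrable.mono this ?_ ?_
    · exact ((Complex.measurable_ofReal.comp measurable_fract).aestronglyMeasurable).mul this.aestronglyMeasurable
    · refine Eventually.of_forall fun t => ?_
      rw [norm_mul, Complex.norm_real, Real.norm_eq_abs, abs_of_nonneg (Int.fract_nonneg t)]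
      exact mul_le_of_le_one_left (norm_nonneg _) (Int.fract_lt_one t).le
  have i2 := (integrableOn_Ioi_cpow_of_lt (a := -s) (c := 1) (by simpa using hs) one_pos)
  have e1 : ∫ t in Set.Ioi (1 : ℝ), (∑ k ∈ Finset.Icc 1 ⌊t⌋₊, (1 : ℕ → ℂ) k) * (t:ℂ) ^ (-(s + 1))
     = (∫ t in Set.Ioi (1:ℝ), (t:ℂ) ^ (-s)) - ∫ t in Set.Ioi (1:ℝ), ((Int.fract t : ℝ) : ℂ) * (t:ℂ) ^ (-(s+1)) := by
    rw [← integral_sub i2 i1]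
    refine setIntegral_congr_fun measurableSet_Ioi fun t ht => ?_
    have ht1 : 1 < t := ht
    have ht0 : (t:ℂ) ≠ 0 := by exact_mod_cast (by linarith : t ≠ 0)
    have e3 : (t:ℂ) ^ (-s) = t * (t:ℂ) ^ (-(s+1)) := by
      rw [show -s = 1 + (-(s+1)) by ring, Complex.cpow_add _ _ ht0, Complex.cpow_one]
    simp only [Pi.one_apply, Finset.sum_const, Nat.card_Icc, nsmul_eq_mul, mul_one]
    rw [e3, ← sub_mul]
    congr 1
    have : Int.fract t = t - ⌊t⌋₊ := by
      rw [natCast_floor_eq_intCast_floor (by linarith : 0 ≤ t)]; rfl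
    rw [this]; push_cast; simp
  rw [e1, integral_Ioi_cpow_of_lt (by simpa using hs) one_pos]
  have : -s + 1 ≠ 0 := by rw [neg_add_eq_sub]; intro h; apply hs1; linear_combination -h
  simp only [Complex.ofReal_one, Complex.one_cpow]
  field_simp
  ring

lemma Zf_half {s : ℂ} (hs : 1/2 ≤ s.re) : Zf s = s - s * (s - 1) * mellin frc (-s) := by
  have hU : IsOpen {s : ℂ | 0 < s.re} := isOpen_lt continuous_const Complex.continuous_re
  have hpc : IsPreconnected {s : ℂ | 0 < s.re} := (convex_halfSpace_re_gt 0).isPreconnected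
  have hd2 : DifferentiableOn ℂ (fun s => s - s * (s - 1) * mellin frc (-s)) {s : ℂ | 0 < s.re} := by
    intro z hz
    have := frc_mellin_diff hz
    refine DifferentiableAt.differentiableWithinAt ?_
    exact differentiableAt_id.sub (((differentiableAt_id).mul (differentiableAt_id.sub_const 1)).mul this)
  have := AnalyticOnNhd.eqOn_of_preconnected_of_eventuallyEq (f := Zf)
    (g := fun s => s - s * (s - 1) * mellin frc (-s)) (U := {s : ℂ | 0 < s.re})
    (Zf_diff.differentiableOn.analyticOnNhd hU) (hd2.analyticOnNhd hU) hpc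
    (z₀ := 2) (by simp) ?_
  · exact this (show 0 < s.re by linarith)
  · have h2 : {s : ℂ | 1 < s.re} ∈ 𝓝 (2:ℂ) :=
      (isOpen_lt continuous_const Complex.continuous_re).mem_nhds (by simp)
    filter_upwards [h2] with z hz using zeta_int hz

lemma Zf_half_norm {s : ℂ} (hs : 1/2 ≤ s.re) : ‖Zf s‖ ≤ 3 * (1 + ‖s‖) ^ 2 := by
  rw [Zf_half hs]
  refine (norm_sub_le _ _).trans ?_
  rw [norm_mul, norm_mul]
  have h1 := frc_mellin_norm hs
  have h2 : ‖s - 1‖ ≤ ‖s‖ + 1 := by simpa using norm_sub_le s 1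
  have h3 := norm_nonneg s
  have : ‖s‖ * ‖s-1‖ * ‖mellin frc (-s)‖ ≤ ‖s‖ * (‖s‖ + 1) * 2 := by gcongr
  nlinarith

lemma gamma_bound : ∃ M : ℝ, 0 < M ∧ ∀ x : ℝ, 1/2 ≤ x → Real.Gamma x ≤ M * (1 + x) ^ x := by
  have hc : ContinuousOn Real.Gamma (Set.Icc (1/2) (3/2)) := by
    intro x hx
    refine (Real.differentiableAt_Gamma fun m => ?_).continuousAt.continuousWithinAt
    have : (0:ℝ) ≤ m := Nat.cast_nonneg m
    have := hx.1
    intro h; linarith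
  obtain ⟨M, hM⟩ := (isCompact_Icc.image_of_continuousOn hc).bddAbove
  refine ⟨|M| + 1, by positivity, ?_⟩
  have base : ∀ x ∈ Set.Icc (1/2:ℝ) (3/2), Real.Gamma x ≤ (|M|+1) * (1+x)^x := by
    intro x hx
    have h1 : Real.Gamma x ≤ M := hM ⟨x, hx, rfl⟩
    have h2 : 1 ≤ (1+x)^x := Real.one_le_rpow (by linarith [hx.1]) (by linarith [hx.1])
    have := le_abs_self M
    nlinarith [abs_nonneg M]
  have ind : ∀ n : ℕ, ∀ x : ℝ, 1/2 ≤ x → x ≤ 3/2 + n → Real.Gamma x ≤ (|M|+1) * (1+x)^x := by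
    intro n
    induction n with
    | zero => intro x h1 h2; exact base x ⟨h1, by simpa using h2⟩
    | succ n ih =>
      intro x h1 h2
      by_cases h : x ≤ 3/2
      · exact base x ⟨h1, h⟩
      · push Not at h
        push_cast at h2
        have h3 := ih (x-1) (by linarith) (by linarith)
        have h4 : Real.Gamma x = (x-1) * Real.Gamma (x-1) := by
          rw [← Real.Gamma_add_one (by linarith)]; ring_nf
        rw [h4]
        have e : (1 + x) ^ x = (1+x) * (1+x)^(x-1) := by
          rw [Real.rpow_sub_one (by linarith)]; field_simp
        rw [e]
        calc (x-1) * Real.Gamma (x-1) ≤ (x-1) * ((|M|+1) * (1 + (x-1))^(x-1)) := by gcongr; linarith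
          _ ≤ (1+x) * ((|M|+1) * (1 + x)^(x-1)) := by
            have : 0 < x := by linarith
            have e5 : 1 + (x - 1) = x := by ring
            rw [e5]
            gcongr <;> linarith
          _ = _ := by ring
  intro x hx
  exact ind ⌈x⌉₊ x hx (by linarith [Nat.le_ceil x])

lemma gamma_norm_le {s : ℂ} (hs : 0 < s.re) : ‖Complex.Gamma s‖ ≤ Real.Gamma s.re := by
  rw [Complex.Gamma_eq_integral hs, Real.Gamma_eq_integral hs, Complex.GammaIntegral]
  refine norm_integral_le_of_norm_le (Real.GammaIntegral_convergent hs) ?_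
  refine (ae_restrict_iff' measurableSet_Ioi).2 (Eventually.of_forall fun t ht => ?_)
  have ht1 : 0 < t := ht
  rw [norm_mul, Complex.norm_cpow_eq_rpow_re_of_pos ht1, Complex.norm_real, Real.norm_eq_abs,
    abs_of_pos (Real.exp_pos _)]
  simp

lemma cos_norm_le (z : ℂ) : ‖Complex.cos z‖ ≤ Real.exp ‖z‖ := by
  rw [Complex.cos, norm_div]
  have h1 := Complex.norm_exp_le_exp_norm (z * Complex.I)
  have h2 := Complex.norm_exp_le_exp_norm (-z * Complex.I)
  simp only [norm_mul, Complex.norm_I, mul_one, norm_neg] at h1 h2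
  have := norm_add_le (Complex.exp (z * Complex.I)) (Complex.exp (-z * Complex.I))
  simp only [Complex.norm_ofNat]
  linarith

lemma Zf_growth {l : ℝ} (hl : 1 < l) : ∃ C : ℝ, ∀ z, ‖Zf z‖ ≤ Real.exp (C * (1 + ‖z‖) ^ l) := by
  obtain ⟨M, hM, hG⟩ := gamma_bound
  obtain ⟨N, hN⟩ := ((isCompact_closedBall (0:ℂ) 1).image Zf_diff.continuous.norm).bddAbove
  refine ⟨|N| + |Real.log (6 * M)| + 9 + 2 ^ (l-1) / (l - 1), fun z => ?_⟩
  set y := 1 + ‖z‖ with hy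
  have hy1 : 1 ≤ y := by linarith [norm_nonneg z]
  have hyl : y ≤ y ^ l := by
    nth_rewrite 1 [← Real.rpow_one y]
    exact Real.rpow_le_rpow_of_exponent_le hy1 hl.le
  have hq : 0 ≤ (2:ℝ) ^ (l-1) / (l-1) := by
    have : 0 < l - 1 := by linarith
    positivity
  have habs1 := abs_nonneg N
  have habs2 := abs_nonneg (Real.log (6*M))
  by_cases hz : 1/2 ≤ z.re
  · refine (Zf_half_norm hz).trans ?_
    have h1 : y ≤ Real.exp y := by linarith [Real.add_one_le_exp y]
    have h2 : (3:ℝ) ≤ Real.exp 3 := by linarith [Real.add_one_le_exp (3:ℝ)]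
    calc 3 * y ^ 2 ≤ Real.exp 3 * (Real.exp y) ^ 2 := by gcongr
      _ = Real.exp (3 + 2 * y) := by rw [← Real.exp_nat_mul, ← Real.exp_add]; norm_num
      _ ≤ _ := by
        apply Real.exp_le_exp.2
        nlinarith
  by_cases hz1 : ‖z‖ ≤ 1
  · have h1 : ‖Zf z‖ ≤ N := hN ⟨z, by simpa using hz1, rfl⟩
    calc ‖Zf z‖ ≤ N := h1
      _ ≤ |N| := le_abs_self N
      _ ≤ |N| * y ^ l := by nlinarith
      _ ≤ Real.exp (|N| * y ^ l) := by linarith [Real.add_one_le_exp (|N| * y^l)]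
      _ ≤ _ := by
        apply Real.exp_le_exp.2
        gcongr; linarith
  push Not at hz hz1
  set w := 1 - z with hw
  have hwre : 1/2 < w.re := by simp [hw]; linarith
  have hz' : z = 1 - w := by simp [hw]
  have hwn : ‖w‖ ≤ y := by
    rw [hw, hy]; simpa using norm_sub_le 1 z
  have hw1 : w ≠ 1 := by
    intro h
    have : z = 0 := by rw [hz', h]; simp
    rw [this] at hz1; simp at hz1; linarith
  have hw0 : w ≠ 0 := by intro h; rw [h] at hwre; simp at hwre; linarith
  have hzne : z ≠ 1 := by rw [hz']; intro h; apply hw0; linear_combination -h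
  have hfe : riemannZeta z = 2 * (2 * π) ^ (-w) * Complex.Gamma w * Complex.cos (π * w / 2) * riemannZeta w := by
    rw [hz']
    refine riemannZeta_one_sub (fun n h => ?_) hw1
    rw [h] at hwre
    simp at hwre
    have : (0:ℝ) ≤ n := Nat.cast_nonneg n
    linarith
  have hzw : z - 1 = - w := by rw [hz']; ring
  have hw1' : w - 1 = -z := by rw [hz']; ring
  rw [Zf_eq hzne, hfe, hzw]
  have hζw : ‖riemannZeta w‖ ≤ 3 * (2 * y) ^ 2 := by
    have h1 := Zf_half_norm hwre.le
    rw [Zf_eq hw1, hw1', norm_mul, norm_neg] at h1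
    have h2 : ‖riemannZeta w‖ ≤ ‖z‖ * ‖riemannZeta w‖ := by
      nlinarith [norm_nonneg (riemannZeta w)]
    have h3 : (1 + ‖w‖)^2 ≤ (2 * y)^2 := by gcongr; linarith
    linarith
  have hpow : ‖((2:ℂ) * π) ^ (-w)‖ ≤ 1 := by
    have : ((2:ℂ) * π) = ((2 * π : ℝ) : ℂ) := by push_cast; ring
    rw [this, Complex.norm_cpow_eq_rpow_re_of_pos (by positivity)]
    apply Real.rpow_le_one_of_one_le_of_nonpos
    · linarith [Real.pi_gt_three]
    · simp; linarith
  have hcos : ‖Complex.cos (π * w / 2)‖ ≤ Real.exp (2 * y) := by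
    refine (cos_norm_le _).trans ?_
    apply Real.exp_le_exp.2
    rw [norm_div, norm_mul, Complex.norm_real, Real.norm_eq_abs, abs_of_pos Real.pi_pos]
    simp only [Complex.norm_ofNat]
    nlinarith [Real.pi_lt_four, Real.pi_pos, norm_nonneg w]
  have hlog : Real.log (2 * y) * y ≤ 2 ^ (l-1) / (l-1) * y ^ l := by
    have h1 := Real.log_le_rpow_div (x := 2 * y) (by linarith) (by linarith : 0 < l - 1)
    rw [Real.mul_rpow (by norm_num) (by linarith)] at h1
    calc Real.log (2 * y) * y ≤ (2 ^ (l-1) * y ^ (l-1) / (l-1)) * y := by gcongr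
      _ = 2 ^ (l-1) / (l-1) * (y ^ (l-1) * y) := by ring
      _ = _ := by
        have : y ^ (l-1) * y = y ^ l := by
          rw [Real.rpow_sub_one (by linarith)]; field_simp
        rw [this]
  have hgam : ‖Complex.Gamma w‖ ≤ M * Real.exp (2 ^ (l-1) / (l-1) * y ^ l) := by
    refine (gamma_norm_le (by linarith)).trans ((hG _ hwre.le).trans ?_)
    gcongr
    have hre : w.re ≤ y := (Complex.re_le_norm w).trans hwn
    calc (1 + w.re) ^ w.re ≤ (2 * y) ^ w.re := by gcongr; linarith
      _ ≤ (2 * y) ^ y := Real.rpow_le_rpow_of_exponent_le (by linarith) hre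
      _ = Real.exp (Real.log (2 * y) * y) := Real.rpow_def_of_pos (by linarith) _
      _ ≤ _ := Real.exp_le_exp.2 hlog
  have hy2 : 2 * y ≤ Real.exp (2 * y) := by linarith [Real.add_one_le_exp (2 * y)]
  have hy3 : y ≤ Real.exp y := by linarith [Real.add_one_le_exp y]
  rw [norm_mul, norm_mul, norm_mul, norm_mul, norm_mul, norm_neg, Complex.norm_ofNat]
  calc ‖w‖ * (2 * ‖((2:ℂ) * π) ^ (-w)‖ * ‖Complex.Gamma w‖ * ‖Complex.cos (π * w / 2)‖ * ‖riemannZeta w‖)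
      ≤ Real.exp y * (2 * 1 * (M * Real.exp (2 ^ (l-1) / (l-1) * y ^ l)) * Real.exp (2 * y) *
        (3 * (Real.exp (2 * y)) ^ 2)) := by
        gcongr
        · exact hwn.trans hy3
        · refine hζw.trans ?_; gcongr
    _ = (6 * M) * Real.exp (y + 2 ^ (l-1) / (l-1) * y ^ l + 6 * y) := by
        generalize 2 ^ (l-1) / (l-1) * y ^ l = Q
        have e7 : Real.exp (y + Q + 6 * y) = Real.exp y * Real.exp Q * Real.exp (2*y) * (Real.exp (2 * y))^2 := by
          rw [← Real.exp_nat_mul, ← Real.exp_add, ← Real.exp_add, ← Real.exp_add]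
          congr 1; push_cast; ring
        rw [e7]
        generalize Real.exp y = E1
        generalize Real.exp (2 * y) = E2
        ring
    _ = Real.exp (Real.log (6 * M) + (y + 2 ^ (l-1) / (l-1) * y ^ l + 6 * y)) := by
        rw [Real.exp_add (Real.log (6 * M)), Real.exp_log (by positivity)]
    _ ≤ _ := by
        apply Real.exp_le_exp.2
        have := le_abs_self (Real.log (6 * M))
        nlinarith

end B1

namespace B1
open Filter Topology Metric

/-! ### Density of zeros -/

/-- multiplicities of zeros of `(s-1)ζ(s)` -/
noncomputable def nz (ρ : ℂ) : ℝ := (mu Zf ρ : ℝ)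

lemma nz_nonneg (ρ : ℂ) : 0 ≤ nz ρ := Nat.cast_nonneg _

lemma zf_sum {l : ℝ} (hl : 1 < l) : Summable (fun ρ : ℂ => nz ρ * (1 + ‖ρ‖) ^ (-l)) := by
  obtain ⟨C, hC⟩ := Zf_growth (l := (1 + l) / 2) (by linarith)
  exact summable_zeros Zf_diff Zf_zero (by linarith) hC (by linarith)

lemma zf_pf (s s₁ : ℂ) (hs : Zf s ≠ 0) (hs₁ : Zf s₁ ≠ 0) :
    HasSum (fun ρ => (nz ρ : ℂ) * (1 / (s - ρ) - 1 / (s₁ - ρ))) (logDeriv Zf s - logDeriv Zf s₁) := by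
  obtain ⟨C, hC⟩ := Zf_growth (l := 3 / 2) (by norm_num)
  have := pf Zf_diff Zf_zero (by norm_num) (by norm_num) hC s s₁ hs hs₁
  simpa [nz] using this

lemma Zf_ne {s : ℂ} (hs : 1 < s.re) : Zf s ≠ 0 := by
  have h1 : s ≠ 1 := by rintro rfl; simp at hs
  rw [Zf_eq h1]
  exact mul_ne_zero (sub_ne_zero.2 h1) (riemannZeta_ne_zero_of_one_le_re hs.le)

lemma Zf_logDeriv {s : ℂ} (hs : 1 < s.re) :
    logDeriv Zf s = 1 / (s - 1) - LSeries (fun n => (ArithmeticFunction.vonMangoldt n : ℂ)) s := by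
  have h1 : s ≠ 1 := by rintro rfl; simp at hs
  have h2 : s - 1 ≠ 0 := sub_ne_zero.2 h1
  have h3 := riemannZeta_ne_zero_of_one_le_re hs.le
  have hev : Zf =ᶠ[𝓝 s] fun s => (s - 1) * riemannZeta s := by
    filter_upwards [isOpen_ne.mem_nhds h1] with z hz using Zf_eq hz
  have hd := differentiableAt_riemannZeta h1
  rw [ArithmeticFunction.LSeries_vonMangoldt_eq_deriv_riemannZeta_div hs, logDeriv_apply, hev.deriv_eq,
    Zf_eq h1]
  have : HasDerivAt (fun s => (s - 1) * riemannZeta s) (1 * riemannZeta s + (s - 1) * deriv riemannZeta s) s :=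
    ((hasDerivAt_id s).sub_const 1).mul hd.hasDerivAt
  rw [this.deriv]
  field_simp
  ring

/-- `Λ(n)n^{-3/2}` is summable -/
lemma lam_sum : Summable (fun n : ℕ => ArithmeticFunction.vonMangoldt n * (n:ℝ) ^ (-(3/2:ℝ))) := by
  have h := ArithmeticFunction.LSeriesSummable_vonMangoldt (s := (3/2 : ℂ)) (by norm_num)
  have := h.norm
  refine this.congr fun n => ?_
  rw [LSeries.norm_term_eq]
  split_ifs with h0
  · simp [h0]
  · rw [Complex.norm_real, Real.norm_eq_abs, abs_of_nonneg ArithmeticFunction.vonMangoldt_nonneg,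
      Real.rpow_neg (by positivity)]
    norm_num
    rfl

lemma logDeriv_bound : ∃ C : ℝ, 0 < C ∧ ∀ t : ℝ, ‖logDeriv Zf (3/2 + t * Complex.I)‖ ≤ C := by
  refine ⟨2 + ∑' n : ℕ, ArithmeticFunction.vonMangoldt n * (n:ℝ) ^ (-(3/2:ℝ)), ?_, fun t => ?_⟩
  · have : 0 ≤ ∑' n : ℕ, ArithmeticFunction.vonMangoldt n * (n:ℝ) ^ (-(3/2:ℝ)) :=
      tsum_nonneg fun n => mul_nonneg ArithmeticFunction.vonMangoldt_nonneg (by positivity)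
    linarith
  · have hre : (3/2 + t * Complex.I : ℂ).re = 3/2 := by simp
    rw [Zf_logDeriv (by rw [hre]; norm_num)]
    refine (norm_sub_le _ _).trans (add_le_add ?_ ?_)
    · rw [norm_div, norm_one, div_le_iff₀]
      · have := Complex.abs_re_le_norm (3/2 + t * Complex.I - 1 : ℂ)
        simp at this
        have h2 : |(3/2 - 1 : ℝ)| = 1/2 := by norm_num
        rw [h2] at this
        linarith
      · rw [norm_pos_iff]; intro h
        have := congrArg Complex.re h
        simp at this; norm_num at this
    · unfold LSeries
      refine tsum_of_norm_bounded lam_sum.hasSum fun n => ?_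
      rw [LSeries.norm_term_eq]
      split_ifs with h0
      · simp [h0]
      · rw [Complex.norm_real, Real.norm_eq_abs, abs_of_nonneg ArithmeticFunction.vonMangoldt_nonneg,
          Real.rpow_neg (by positivity), hre]
        rfl

lemma nz_cases (hRH : RiemannHypothesis) {ρ : ℂ} (h : nz ρ ≠ 0) :
    ρ.re = 1/2 ∨ ∃ x : ℝ, 2 ≤ x ∧ ρ = ((-x : ℝ) : ℂ) := by
  have h1 : Zf ρ = 0 := by
    rw [← mu_ne_zero_iff Zf_diff Zf_zero]
    simpa [nz] using h
  have hne : ρ ≠ 1 := by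
    rintro rfl
    rw [Zf, riemannZeta₁_one] at h1
    exact one_ne_zero h1
  rw [Zf_eq hne] at h1
  have h2 : riemannZeta ρ = 0 := (mul_eq_zero.1 h1).resolve_left (sub_ne_zero.2 hne)
  by_cases h3 : ∃ n : ℕ, ρ = -2 * (n + 1)
  · right
    obtain ⟨n, hn⟩ := h3
    refine ⟨2 * (n + 1), ?_, ?_⟩
    · have : (0:ℝ) ≤ n := Nat.cast_nonneg n
      linarith
    · rw [hn]; push_cast; ring
  · left; exact hRH ρ h2 h3 hne

/-- `ρ - 1/2 - it` -/
noncomputable def aa (t : ℝ) (ρ : ℂ) : ℂ := ρ - 1/2 - t * Complex.I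

lemma aa_crit {t : ℝ} {ρ : ℂ} (h : ρ.re = 1/2) : aa t ρ = ((ρ.im - t : ℝ) : ℂ) * Complex.I := by
  apply Complex.ext <;> simp [aa, h]

lemma one_sub_aa_crit {t : ℝ} {ρ : ℂ} (h : ρ.re = 1/2) :
    1 - aa t ρ ^ 2 = ((1 + (ρ.im - t)^2 : ℝ) : ℂ) := by
  rw [aa_crit h, mul_pow, Complex.I_sq]; push_cast; ring

lemma one_sub_aa_triv {t : ℝ} {ρ : ℂ} {x : ℝ} (hx : 2 ≤ x) (h : ρ = ((-x : ℝ) : ℂ)) :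
    (1 + ‖ρ‖) ^ 2 / 2 ≤ ‖1 - aa t ρ ^ 2‖ := by
  have h1 : (1 - aa t ρ ^ 2) = (1 - aa t ρ) * (1 + aa t ρ) := by ring
  have h2 : 1 + ‖ρ‖ = 1 + x := by
    rw [h, Complex.norm_real, Real.norm_eq_abs, abs_neg, abs_of_pos (by linarith)]
  have h3 : 1 + x ≤ ‖1 - aa t ρ‖ := by
    refine le_trans ?_ (Complex.re_le_norm _)
    simp [aa, h]; linarith
  have h4 : (1 + x)/2 ≤ ‖1 + aa t ρ‖ := by
    refine le_trans ?_ (Complex.abs_re_le_norm _)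
    rw [abs_of_nonpos] <;> simp [aa, h] <;> linarith
  rw [h1, h2, norm_mul]
  nlinarith [norm_nonneg (1 - aa t ρ)]

lemma norm_lower (t : ℝ) : ∃ c : ℝ, 0 < c ∧ ∀ ρ : ℂ, ρ.re = 1/2 → (1 + ‖ρ‖)^2 * c ≤ 1 + (ρ.im - t)^2 := by
  refine ⟨1 / (2 * (2 + |t|)^2), by positivity, fun ρ hρ => ?_⟩
  have h1 : ‖ρ‖ ≤ |ρ.re| + |ρ.im| := Complex.norm_le_abs_re_add_abs_im ρ
  rw [hρ, abs_of_pos (by norm_num : (0:ℝ) < 1/2)] at h1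
  have h2 : |ρ.im| ≤ |ρ.im - t| + |t| := by simpa using abs_add_le (ρ.im - t) t
  have h3 : (1 + ‖ρ‖) ≤ (2 + |t|) + |ρ.im - t| := by linarith
  have h4 := norm_nonneg ρ
  have h5 : (1 + ‖ρ‖)^2 ≤ ((2 + |t|) + |ρ.im - t|)^2 := by gcongr
  rw [mul_one_div, div_le_iff₀ (by positivity)]
  have h6 := sq_abs (ρ.im - t)
  have h7 := abs_nonneg t
  have h8 := abs_nonneg (ρ.im - t)
  rw [← h6]
  nlinarith [sq_nonneg ((2 + |t|) - |ρ.im - t|), mul_nonneg h8 h8, mul_nonneg h7 h7, mul_nonneg (mul_nonneg h7 h7) (mul_nonneg h8 h8), mul_nonneg h7 (mul_nonneg h8 h8)]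

lemma G_summable (hRH : RiemannHypothesis) (t : ℝ) : Summable (fun ρ => nz ρ / ‖1 - aa t ρ ^ 2‖) := by
  obtain ⟨c, hc, hcb⟩ := norm_lower t
  have hs := (zf_sum (l := 2) (by norm_num)).mul_left (c⁻¹ + 2)
  refine Summable.of_nonneg_of_le (fun ρ => div_nonneg (nz_nonneg ρ) (norm_nonneg _)) ?_ hs
  intro ρ
  by_cases h0 : nz ρ = 0
  · simp [h0]
  have e : (1 + ‖ρ‖) ^ (-(2:ℝ)) = ((1 + ‖ρ‖)^2)⁻¹ := by
    rw [Real.rpow_neg (by positivity)]; norm_cast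
  rw [e]
  have hn := nz_nonneg ρ
  have hp : 0 < (1 + ‖ρ‖)^2 := by positivity
  rcases nz_cases hRH h0 with h | ⟨x, hx, h⟩
  · have h1 := hcb ρ h
    rw [one_sub_aa_crit h, Complex.norm_real, Real.norm_eq_abs, abs_of_pos (by positivity)]
    calc nz ρ / (1 + (ρ.im - t)^2) ≤ nz ρ / ((1 + ‖ρ‖)^2 * c) := by gcongr
      _ = c⁻¹ * (nz ρ * ((1+‖ρ‖)^2)⁻¹) := by field_simp
      _ ≤ _ := by gcongr; linarith
  · have h1 := one_sub_aa_triv (t := t) hx h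
    calc nz ρ / ‖1 - aa t ρ^2‖ ≤ nz ρ / ((1 + ‖ρ‖)^2 / 2) := by gcongr
      _ = 2 * (nz ρ * ((1+‖ρ‖)^2)⁻¹) := by field_simp
      _ ≤ _ := by gcongr; have := inv_pos.2 hc; linarith

lemma G_bound (hRH : RiemannHypothesis) {η : ℝ} (hη : 0 < η) (hη1 : η ≤ 1) :
    ∃ C : ℝ, 0 < C ∧ ∀ t : ℝ, ∑' ρ, nz ρ / ‖1 - aa t ρ ^ 2‖ ≤ C * (1 + |t|) ^ η := by
  obtain ⟨L, hL, hLb⟩ := logDeriv_bound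
  set A := ∑' ρ, nz ρ * (1 + ‖ρ‖) ^ (-(1+η)) with hA
  set B := ∑' ρ, nz ρ / ‖1 - aa 0 ρ ^ 2‖ with hB
  set E := ∑' ρ, nz ρ * (1 + ‖ρ‖) ^ (-(2:ℝ)) with hE
  have hA0 : 0 ≤ A := tsum_nonneg fun ρ => mul_nonneg (nz_nonneg ρ) (by positivity)
  have hB0 : 0 ≤ B := tsum_nonneg fun ρ => div_nonneg (nz_nonneg ρ) (by positivity)
  have hE0 : 0 ≤ E := tsum_nonneg fun ρ => mul_nonneg (nz_nonneg ρ) (by positivity)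
  refine ⟨2 * L + A + B + 2 * E, by positivity, fun t => ?_⟩
  have h1t : 1 ≤ (1 + |t|) ^ η := Real.one_le_rpow (by linarith [abs_nonneg t]) hη.le
  have hp := zf_pf (3/2 + t * Complex.I) (3/2 + (0:ℝ) * Complex.I) (Zf_ne (by simp; norm_num))
    (Zf_ne (by simp; norm_num))
  have hpre := Complex.hasSum_re hp
  have hSA := zf_sum (l := 1 + η) (by linarith)
  have hSE := zf_sum (l := 2) (by norm_num)
  -- termwise bound
  have hterm : ∀ ρ, nz ρ / ‖1 - aa t ρ ^ 2‖ ≤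
      ((nz ρ : ℂ) * (1 / (3/2 + t * Complex.I - ρ) - 1 / (3/2 + (0:ℝ) * Complex.I - ρ))).re
      + nz ρ / ‖1 - aa 0 ρ ^ 2‖ + (1 + |t|)^η * (nz ρ * (1 + ‖ρ‖) ^ (-(1+η)))
      + 2 * (nz ρ * (1 + ‖ρ‖) ^ (-(2:ℝ))) := by
    intro ρ
    by_cases h0 : nz ρ = 0
    · simp [h0]
    have hn := nz_nonneg ρ
    have q1 : 0 ≤ nz ρ / ‖1 - aa 0 ρ ^ 2‖ := by positivity
    have q2 : 0 ≤ (1 + |t|)^η * (nz ρ * (1 + ‖ρ‖) ^ (-(1+η))) := by positivity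
    have q3 : 0 ≤ 2 * (nz ρ * (1 + ‖ρ‖) ^ (-(2:ℝ))) := by positivity
    rcases nz_cases hRH h0 with h | ⟨x, hx, h⟩
    · have hre : ∀ u : ℝ, (1 / (3/2 + u * Complex.I - ρ)).re = 1 / ‖1 - aa u ρ ^ 2‖ := by
        intro u
        rw [one_sub_aa_crit h, Complex.norm_real, Real.norm_eq_abs, abs_of_pos (by positivity)]
        have e : 3/2 + u * Complex.I - ρ = ⟨1, u - ρ.im⟩ := by
          apply Complex.ext <;> simp [h]; norm_num
        rw [e, one_div, Complex.inv_re, Complex.normSq_mk]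
        simp only
        congr 1; ring
      rw [Complex.re_ofReal_mul, Complex.sub_re, hre t, hre 0, mul_sub, mul_one_div, mul_one_div]
      linarith
    · have hb := one_sub_aa_triv (t := t) hx h
      have hnx : ‖ρ‖ = x := by
        rw [h, Complex.norm_real, Real.norm_eq_abs, abs_neg, abs_of_pos (by linarith)]
      have f1 : nz ρ / ‖1 - aa t ρ ^ 2‖ ≤ 2 * (nz ρ * (1 + ‖ρ‖) ^ (-(2:ℝ))) := by
        have e : (1 + ‖ρ‖) ^ (-(2:ℝ)) = ((1 + ‖ρ‖)^2)⁻¹ := by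
          rw [Real.rpow_neg (by positivity)]; norm_cast
        rw [e]
        calc nz ρ / ‖1 - aa t ρ^2‖ ≤ nz ρ / ((1 + ‖ρ‖)^2 / 2) := by gcongr
          _ = 2 * (nz ρ * ((1+‖ρ‖)^2)⁻¹) := by field_simp
      have f2 : ‖1 / (3/2 + t * Complex.I - ρ) - 1 / (3/2 + (0:ℝ) * Complex.I - ρ)‖ ≤
          (1 + |t|)^η * (1 + ‖ρ‖) ^ (-(1+η)) := by
        have g1 : 1 + x ≤ ‖3/2 + t * Complex.I - ρ‖ := by
          refine le_trans ?_ (Complex.re_le_norm _)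
          simp [h]; linarith
        have g2 : |t| ≤ ‖3/2 + t * Complex.I - ρ‖ := by
          refine le_trans ?_ (Complex.abs_im_le_norm _)
          simp [h]
        have g3 : 1 + x ≤ ‖3/2 + (0:ℝ) * Complex.I - ρ‖ := by
          refine le_trans ?_ (Complex.re_le_norm _)
          simp [h]; linarith
        have n1 := norm_pos_iff.1 ((by linarith : 0 < 1 + x).trans_le g1)
        have n2 := norm_pos_iff.1 ((by linarith : 0 < 1 + x).trans_le g3)
        rw [div_sub_div _ _ n1 n2]
        have e1 : 1 * (3/2 + (0:ℝ) * Complex.I - ρ) - (3/2 + t * Complex.I - ρ) * 1 = -(t * Complex.I) := by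
          push_cast; ring
        rw [e1, norm_div, norm_neg, norm_mul, norm_mul, Complex.norm_I, mul_one, Complex.norm_real, Real.norm_eq_abs]
        set P := ‖3/2 + t * Complex.I - ρ‖
        set Q := ‖3/2 + (0:ℝ) * Complex.I - ρ‖
        have hP : 0 < P := by linarith
        have r1 : |t| / P ≤ (|t| / P) ^ η := by
          rcases eq_or_lt_of_le (abs_nonneg t) with h0 | h0
          · rw [← h0]; simp [Real.zero_rpow hη.ne']
          · nth_rewrite 1 [← Real.rpow_one (|t|/P)]
            exact Real.rpow_le_rpow_of_exponent_ge (by positivity) ((div_le_one hP).2 g2) hη1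
        have r2 : (|t| / P)^η ≤ (1 + |t|)^η * (1 + x)^(-η) := by
          rw [Real.rpow_neg (by linarith), ← div_eq_mul_inv, ← Real.div_rpow (by positivity) (by linarith)]
          gcongr
          linarith
        rw [hnx]
        calc |t| / (P * Q) = (|t| / P) * (1 / Q) := by field_simp
          _ ≤ ((1 + |t|)^η * (1 + x)^(-η)) * (1 / (1 + x)) := by
            gcongr
            exact r1.trans r2
          _ = _ := by
            rw [neg_add, Real.rpow_add (by linarith), Real.rpow_neg_one]; ring
      have f3 : -(nz ρ * ((1 + |t|)^η * (1 + ‖ρ‖) ^ (-(1+η)))) ≤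
          ((nz ρ : ℂ) * (1 / (3/2 + t * Complex.I - ρ) - 1 / (3/2 + (0:ℝ) * Complex.I - ρ))).re := by
        rw [Complex.re_ofReal_mul, ← mul_neg]
        have := (abs_le.1 ((Complex.abs_re_le_norm _).trans f2)).1
        gcongr
      linarith
  have hsum := ((hpre.summable.add (G_summable hRH 0)).add (hSA.mul_left ((1 + |t|)^η))).add (hSE.mul_left 2)
  refine ((G_summable hRH t).tsum_le_tsum hterm hsum).trans ?_
  rw [Summable.tsum_add ((hpre.summable.add (G_summable hRH 0)).add (hSA.mul_left ((1 + |t|)^η))) (hSE.mul_left 2),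
    Summable.tsum_add (hpre.summable.add (G_summable hRH 0)) (hSA.mul_left ((1 + |t|)^η)),
    Summable.tsum_add hpre.summable (G_summable hRH 0), tsum_mul_left, tsum_mul_left, hpre.tsum_eq]
  have k1 : (logDeriv Zf (3/2 + t * Complex.I) - logDeriv Zf (3/2 + (0:ℝ) * Complex.I)).re ≤ 2 * L := by
    refine (Complex.re_le_norm _).trans ((norm_sub_le _ _).trans ?_)
    linarith [hLb t, hLb 0]
  nlinarith

end B1

namespace B1
open Filter Topology Metric

/-! ### Laplace transforms and the explicit formula -/

lemma lap_unique (g : ℝ → ℂ) (hc : ContinuousOn g (Set.Ioi 0))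
    (hi : IntegrableOn (fun U : ℝ => Complex.exp (-2 * U) * g U) (Set.Ioi 0))
    (h0 : ∀ z : ℂ, z.re = 2 → ∫ U : ℝ in Set.Ioi 0, Complex.exp (-z * U) * g U = 0) :
    ∀ U : ℝ, 0 < U → g U = 0 := by
  intro U hU
  set f : ℝ → ℂ := (Set.Ioi (0:ℝ)).indicator (fun U : ℝ => Complex.exp (-2 * U) * g U) with hf
  have hfi : Integrable f := (integrable_indicator_iff measurableSet_Ioi).2 hi
  have hF : FourierTransform.fourier f = 0 := by
    funext w
    rw [Real.fourier_eq']
    have := h0 (2 + (2 * π * w : ℝ) * Complex.I) (by simp)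
    simp only [Pi.zero_apply]
    rw [← this, ← integral_indicator measurableSet_Ioi]
    congr 1
    funext v
    simp only [hf, Set.indicator]
    split_ifs with h
    · rw [smul_eq_mul, ← mul_assoc, ← Complex.exp_add]
      congr 2
      simp
      ring
    · simp
  have hcf : ContinuousAt f U := by
    have : ContinuousAt (fun U : ℝ => Complex.exp (-2 * U) * g U) U := by
      refine ContinuousAt.mul (by fun_prop) (hc.continuousAt (Ioi_mem_nhds hU))
    refine this.congr ?_
    filter_upwards [Ioi_mem_nhds hU] with x hx
    simp [hf, Set.indicator_of_mem hx]
  have h1 := hfi.fourierInv_fourier_eq (by rw [hF]; exact integrable_zero _ _ _) hcf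
  rw [hF, Real.fourierInv_eq'] at h1
  simp at h1
  have h2 : f U = Complex.exp (-2 * U) * g U := by simp only [hf]; exact Set.indicator_of_mem (by exact hU) _
  rw [h2] at h1
  exact (mul_eq_zero.1 h1.symm).resolve_left (Complex.exp_ne_zero _)

lemma norm_exp_mul (z : ℂ) (U : ℝ) : ‖Complex.exp (z * U)‖ = Real.exp (z.re * U) := by
  rw [Complex.norm_exp]; simp

lemma exp_int (l : ℝ) (hl : 0 < l) : IntegrableOn (fun U : ℝ => Real.exp (-l * U)) (Set.Ioi 0) :=
  integrableOn_exp_mul_Ioi (by linarith) 0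

lemma lap_tsum {ι : Type*} (f : ι → ℝ → ℂ) (b : ι → ℝ) (hb : Summable b) (hf : ∀ i, Continuous (f i))
    (hfb : ∀ i (U : ℝ), 0 < U → ‖f i U‖ ≤ b i * Real.exp U) :
    ContinuousOn (fun U => ∑' i, f i U) (Set.Ioi 0) ∧
    ∀ z : ℂ, z.re = 2 → IntegrableOn (fun U : ℝ => Complex.exp (-z * U) * ∑' i, f i U) (Set.Ioi 0) ∧
    HasSum (fun i => ∫ U : ℝ in Set.Ioi 0, Complex.exp (-z * U) * f i U)
      (∫ U : ℝ in Set.Ioi 0, Complex.exp (-z * U) * ∑' i, f i U) := by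
  have hb0 : ∀ i, 0 ≤ b i := fun i => by
    have := (norm_nonneg _).trans (hfb i 1 one_pos)
    exact nonneg_of_mul_nonneg_left this (Real.exp_pos _)
  have hcont : ContinuousOn (fun U => ∑' i, f i U) (Set.Ioi 0) := by
    have h1 : ContinuousOn (fun U : ℝ => ∑' i, Complex.exp (-1 * U) * f i U) (Set.Ioi 0) := by
      refine continuousOn_tsum (u := b) (fun i => ?_) hb ?_
      · have := hf i
        fun_prop
      · intro i U hU
        rw [norm_mul, norm_exp_mul]
        calc _ ≤ Real.exp ((-1:ℂ).re * U) * (b i * Real.exp U) := by gcongr; exact hfb i U hU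
          _ = b i * (Real.exp (-U) * Real.exp U) := by simp; ring
          _ = b i := by rw [← Real.exp_add]; simp
          _ ≤ _ := le_rfl
    have h2 : ContinuousOn (fun U : ℝ => Complex.exp (1 * U) * ∑' i, Complex.exp (-1 * U) * f i U) (Set.Ioi 0) :=
      ContinuousOn.mul (by fun_prop) h1
    refine h2.congr fun U _ => ?_
    simp only
    rw [tsum_mul_left, ← mul_assoc, ← Complex.exp_add]
    simp
  refine ⟨hcont, fun z hz => ?_⟩
  have hbd : ∀ i (U : ℝ), 0 < U → ‖Complex.exp (-z * U) * f i U‖ ≤ b i * Real.exp (-1 * U) := by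
    intro i U hU
    rw [norm_mul, norm_exp_mul, Complex.neg_re, hz]
    calc _ ≤ Real.exp (-2 * U) * (b i * Real.exp U) := by gcongr; exact hfb i U hU
      _ = b i * (Real.exp (-2 * U) * Real.exp U) := by ring
      _ = _ := by rw [← Real.exp_add]; ring_nf
  have hsupp : ∀ i, i ∉ Function.support b → ∀ U : ℝ, 0 < U → f i U = 0 := by
    intro i hi U hU
    have h := hfb i U hU
    simp only [Function.mem_support, not_not] at hi
    rw [hi, zero_mul] at h
    exact norm_le_zero_iff.1 h
  have hsi : ∀ U : ℝ, 0 < U → Summable (fun i => f i U) := fun U hU =>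
    Summable.of_norm_bounded (hb.mul_right (Real.exp U)) fun i => hfb i U hU
  have hexp := exp_int 1 one_pos
  constructor
  · refine Integrable.mono' (hexp.const_mul (∑' i, b i)) ?_ ?_
    · refine ContinuousOn.aestronglyMeasurable ?_ measurableSet_Ioi
      exact ContinuousOn.mul (by fun_prop) hcont
    · refine (ae_restrict_mem measurableSet_Ioi).mono fun U hU => ?_
      rw [← tsum_mul_left, ← tsum_mul_right]
      refine tsum_of_norm_bounded (hb.mul_right _).hasSum fun i => ?_
      exact hbd i U hU
  · have : Countable (Function.support b) := hb.countable_support.to_subtype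
    have hintg : ∀ i, IntegrableOn (fun U : ℝ => Complex.exp (-z * U) * f i U) (Set.Ioi 0) := fun i => by
      refine Integrable.mono' (hexp.const_mul (b i)) ?_ ?_
      · refine Continuous.aestronglyMeasurable ?_
        have := hf i
        fun_prop
      · exact (ae_restrict_mem measurableSet_Ioi).mono fun U hU => hbd i U hU
    have key := hasSum_integral_of_summable_integral_norm (μ := volume.restrict (Set.Ioi (0:ℝ)))
      (F := fun (i : Function.support b) (U : ℝ) => Complex.exp (-z * U) * f i U) (fun i => hintg i) ?_
    · have e : (∫ U : ℝ in Set.Ioi 0, ∑' i : Function.support b, Complex.exp (-z * U) * f i U) =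
          ∫ U : ℝ in Set.Ioi 0, Complex.exp (-z * U) * ∑' i, f i U := by
        refine setIntegral_congr_fun measurableSet_Ioi fun U hU => ?_
        beta_reduce
        rw [tsum_mul_left]
        congr 1
        refine tsum_subtype_eq_of_support_subset (f := fun i => f i U) ?_
        intro i hi
        by_contra h
        exact hi (hsupp i h U hU)
      rw [e] at key
      refine (hasSum_subtype_iff_of_support_subset ?_).1 key
      intro i hi
      by_contra h
      refine hi ?_
      simp only
      rw [setIntegral_congr_fun (g := fun _ => (0:ℂ)) measurableSet_Ioi]
      · simp
      · intro U hU
        simp [hsupp i h U hU]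
    · have hs2 : Summable fun i : Function.support b => b i := hb.subtype _
      refine Summable.of_nonneg_of_le (fun i => integral_nonneg fun _ => norm_nonneg _) (fun i => ?_)
        (hs2.mul_right (∫ U : ℝ in Set.Ioi 0, Real.exp (-1 * U)))
      rw [← integral_const_mul]
      refine setIntegral_mono_on (hintg i).norm (hexp.const_mul _) measurableSet_Ioi fun U hU => hbd i U hU

lemma Klap_int {z : ℂ} (hz : -1 < z.re) {v : ℝ} (hv : 0 ≤ v) :
    IntegrableOn (fun U : ℝ => Complex.exp (-z * U) * (Real.exp (-|U - v|) : ℂ)) (Set.Ioi 0) := by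
  rw [← Set.Ioc_union_Ioi_eq_Ioi hv]
  refine IntegrableOn.union ?_ ?_
  · refine IntegrableOn.mono_set (Continuous.integrableOn_Icc (by fun_prop) (a := 0) (b := v)) Set.Ioc_subset_Icc_self
  · refine IntegrableOn.congr_fun (Integrable.const_mul (integrableOn_exp_mul_complex_Ioi (a := -(z+1))
      (by simp; linarith) v) (Complex.exp v)) ?_ measurableSet_Ioi
    intro U hU
    beta_reduce
    rw [abs_of_pos (by linarith [Set.mem_Ioi.1 hU] : 0 < U - v), ← Complex.exp_add, Complex.ofReal_exp, ← Complex.exp_add]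
    congr 1; push_cast; ring

lemma Klap {z : ℂ} (hz : -1 < z.re) (hz1 : z ≠ 1) {v : ℝ} (hv : 0 ≤ v) :
    ∫ U : ℝ in Set.Ioi 0, Complex.exp (-z * U) * (Real.exp (-|U - v|) : ℂ) =
      2 * Complex.exp (-z * v) / (1 - z^2) - Complex.exp (-v) / (1 - z) := by
  have hi := Klap_int hz hv
  rw [← Set.Ioc_union_Ioi_eq_Ioi hv] at hi ⊢
  rw [setIntegral_union (Set.Ioc_disjoint_Ioi le_rfl) measurableSet_Ioi (hi.mono_set Set.subset_union_left)
    (hi.mono_set Set.subset_union_right)]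
  have h1 : ∫ U : ℝ in Set.Ioc 0 v, Complex.exp (-z * U) * (Real.exp (-|U - v|) : ℂ) =
      Complex.exp (-v) * ((Complex.exp ((1 - z) * v) - 1) / (1 - z)) := by
    have e := integral_exp_mul_complex (a := 0) (b := v) (c := 1 - z) (sub_ne_zero.2 hz1.symm)
    rw [Complex.ofReal_zero, mul_zero, Complex.exp_zero] at e
    rw [← e, intervalIntegral.integral_of_le hv, ← integral_const_mul]
    refine setIntegral_congr_fun measurableSet_Ioc fun U hU => ?_
    beta_reduce
    rw [abs_of_nonpos (by linarith [hU.2] : U - v ≤ 0), ← Complex.exp_add, Complex.ofReal_exp, ← Complex.exp_add]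
    congr 1; push_cast; ring
  have h2 : ∫ U : ℝ in Set.Ioi v, Complex.exp (-z * U) * (Real.exp (-|U - v|) : ℂ) =
      Complex.exp v * (-Complex.exp (-(z+1) * v) / (-(z+1))) := by
    rw [← integral_exp_mul_complex_Ioi (a := -(z+1)) (by simp; linarith) v, ← integral_const_mul]
    refine setIntegral_congr_fun measurableSet_Ioi fun U hU => ?_
    beta_reduce
    rw [abs_of_pos (by linarith [Set.mem_Ioi.1 hU] : 0 < U - v), ← Complex.exp_add, Complex.ofReal_exp, ← Complex.exp_add]
    congr 1; push_cast; ring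
  rw [h1, h2]
  have n1 : 1 - z ≠ 0 := sub_ne_zero.2 hz1.symm
  have n2 : z + 1 ≠ 0 := by
    intro h
    have := congrArg Complex.re h
    simp at this; linarith
  have n3 : 1 - z^2 ≠ 0 := by
    have : 1 - z^2 = (1 - z) * (z + 1) := by ring
    rw [this]; exact mul_ne_zero n1 n2
  have e1 : Complex.exp ((1 - z) * v) = Complex.exp v * Complex.exp (-z * v) := by
    rw [← Complex.exp_add]; ring_nf
  have e2 : Complex.exp (-(z+1) * v) = Complex.exp (-v) * Complex.exp (-z * v) := by
    rw [← Complex.exp_add]; ring_nf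
  have e3 : Complex.exp v * Complex.exp (-v) = 1 := by
    rw [← Complex.exp_add]; simp
  rw [e1, e2]
  generalize Complex.exp (-z * v) = A at *
  generalize Complex.exp (-(v:ℂ)) = B at *
  generalize Complex.exp (v:ℂ) = E at *
  have n3' : 1 - z^2 = (1 - z) * (z + 1) := by ring
  rw [n3']
  field_simp
  linear_combination (2 * A) * e3

lemma lap_exp {z a : ℂ} (h : a.re < z.re) :
    ∫ U : ℝ in Set.Ioi 0, Complex.exp (-z * U) * Complex.exp (a * U) = 1 / (z - a) := by
  have e := integral_exp_mul_complex_Ioi (a := a - z) (by simpa using h) 0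
  have : ∀ U : ℝ, Complex.exp (-z * U) * Complex.exp (a * U) = Complex.exp ((a - z) * U) := by
    intro U; rw [← Complex.exp_add]; ring_nf
  simp_rw [this]
  rw [e]
  have : z - a ≠ 0 := by
    intro h'; have := congrArg Complex.re h'; simp at this; linarith
  have : a - z ≠ 0 := by rw [← neg_sub]; exact neg_ne_zero.2 this
  rw [Complex.ofReal_zero, mul_zero, Complex.exp_zero]
  rw [div_eq_div_iff (by assumption) (by assumption)]; ring

lemma lap_exp_int {z a : ℂ} (h : a.re < z.re) :
    IntegrableOn (fun U : ℝ => Complex.exp (-z * U) * Complex.exp (a * U)) (Set.Ioi 0) := by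
  have e := integrableOn_exp_mul_complex_Ioi (a := a - z) (by simpa using h) 0
  have : ∀ U : ℝ, Complex.exp (-z * U) * Complex.exp (a * U) = Complex.exp ((a - z) * U) := by
    intro U; rw [← Complex.exp_add]; ring_nf
  simp_rw [this]
  exact e

end B1

namespace B1
open Filter Topology Metric

lemma LS_hasSum {s : ℂ} (hs : 1 < s.re) :
    HasSum (fun n : ℕ => (ArithmeticFunction.vonMangoldt n : ℂ) * Complex.exp (-s * (Real.log n : ℝ)))
      (1 / (s - 1) - logDeriv Zf s) := by
  have h := (ArithmeticFunction.LSeriesSummable_vonMangoldt hs).hasSum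
  have e : 1 / (s - 1) - logDeriv Zf s = ∑' n, LSeries.term (fun n => (ArithmeticFunction.vonMangoldt n : ℂ)) s n := by
    rw [Zf_logDeriv hs, LSeries]; ring
  rw [e]
  refine h.congr_fun ?_
  intro n
  rw [LSeries.term_def]
  split_ifs with h0
  · simp [h0]
  · rw [div_eq_mul_inv, ← Complex.cpow_neg, Complex.cpow_def_of_ne_zero (by exact_mod_cast h0), Complex.natCast_log,
      mul_comm (Complex.log _)]

/-- the prime side of the explicit formula -/
noncomputable def SS (U t : ℝ) : ℂ :=
  (∑' n : ℕ, (ArithmeticFunction.vonMangoldt n : ℂ) * Complex.exp (-(1/2 + t * Complex.I) * (Real.log n : ℝ)) *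
    (Real.exp (-|U - Real.log n|) : ℂ))
  - ∫ v : ℝ in Set.Ioi 0, Complex.exp (-(-(1/2 - t * Complex.I)) * v) * (Real.exp (-|v - U|) : ℂ)

lemma lam_term_bound (n : ℕ) (U t : ℝ) :
    ‖(ArithmeticFunction.vonMangoldt n : ℂ) * Complex.exp (-(1/2 + t * Complex.I) * (Real.log n : ℝ)) *
    (Real.exp (-|U - Real.log n|) : ℂ)‖ ≤ ArithmeticFunction.vonMangoldt n * (n:ℝ) ^ (-(3/2:ℝ)) * Real.exp U := by
  rcases Nat.eq_zero_or_pos n with h0 | h0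
  · simp [h0]
  have hn : (0:ℝ) < n := by exact_mod_cast h0
  rw [norm_mul, norm_mul, norm_exp_mul, Complex.norm_real, Complex.norm_real, Real.norm_eq_abs, Real.norm_eq_abs,
    abs_of_nonneg ArithmeticFunction.vonMangoldt_nonneg, abs_of_pos (Real.exp_pos _), mul_assoc, mul_assoc]
  have hl : 0 ≤ ArithmeticFunction.vonMangoldt n := ArithmeticFunction.vonMangoldt_nonneg
  refine mul_le_mul_of_nonneg_left ?_ hl
  rw [Real.rpow_def_of_pos hn, ← Real.exp_add, ← Real.exp_add]
  apply Real.exp_le_exp.2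
  have := neg_abs_le (U - Real.log n)
  simp
  linarith [neg_le_abs (U - Real.log n)]

lemma explicit (hRH : RiemannHypothesis) (t U : ℝ) (hU : 0 < U) :
    SS U t = -(∑' ρ, (nz ρ : ℂ) * (2 / (1 - aa t ρ ^ 2)) * (Complex.exp (aa t ρ * U) - Complex.exp (-1 * U)))
      - logDeriv Zf (3/2 + t * Complex.I) * Complex.exp (-1 * U) := by
  set q := logDeriv Zf (3/2 + t * Complex.I) with hq
  set b : ℂ := 1/2 - t * Complex.I with hb
  have hbre : b.re = 1/2 := by simp [hb]
  set f1 : ℕ → ℝ → ℂ := fun n U => (ArithmeticFunction.vonMangoldt n : ℂ) *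
    Complex.exp (-(1/2 + t * Complex.I) * (Real.log n : ℝ)) * (Real.exp (-|U - Real.log n|) : ℂ) with hf1
  set f2 : ℂ → ℝ → ℂ := fun ρ U => (nz ρ : ℂ) * (2 / (1 - aa t ρ ^ 2)) *
    (Complex.exp (aa t ρ * U) - Complex.exp (-1 * U)) with hf2
  set P : ℝ → ℂ := fun U => (2 / (1 - b^2)) * Complex.exp (b * U) - (1 / (1 + b)) * Complex.exp (-1 * U) with hP
  have hare : ∀ ρ, nz ρ ≠ 0 → (aa t ρ).re = 0 ∨ (aa t ρ).re ≤ -5/2 := by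
    intro ρ h
    rcases nz_cases hRH h with h | ⟨x, hx, h⟩
    · left; rw [aa_crit h]; simp
    · right; simp [aa, h]; linarith
  have L1 := lap_tsum f1 _ lam_sum (fun n => by simp only [hf1]; fun_prop) (fun n U _ => lam_term_bound n U t)
  have L2 := lap_tsum f2 (fun ρ => 4 * (nz ρ / ‖1 - aa t ρ ^ 2‖)) ((G_summable hRH t).mul_left 4)
    (fun n => by simp only [hf2]; fun_prop) (by
      intro ρ U hU
      by_cases h0 : nz ρ = 0
      · simp [hf2, h0]
      have hle : ‖Complex.exp (aa t ρ * U) - Complex.exp (-1 * U)‖ ≤ 2 := by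
        refine (norm_sub_le _ _).trans ?_
        rw [norm_exp_mul, norm_exp_mul]
        have e1 : Real.exp ((aa t ρ).re * U) ≤ 1 := by
          apply Real.exp_le_one_iff.2
          apply mul_nonpos_of_nonpos_of_nonneg _ hU.le
          rcases hare ρ h0 with h | h <;> linarith
        have e2 : Real.exp ((-1:ℂ).re * U) ≤ 1 := by
          apply Real.exp_le_one_iff.2
          simp; linarith
        linarith
      simp only [hf2]
      rw [norm_mul, norm_mul, norm_div, Complex.norm_real, Real.norm_eq_abs, abs_of_nonneg (nz_nonneg ρ)]
      have hn := nz_nonneg ρ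
      have h1 : 1 ≤ Real.exp U := Real.one_le_exp hU.le
      have hg : 0 ≤ nz ρ / ‖1 - aa t ρ ^ 2‖ := by positivity
      calc nz ρ * (‖(2:ℂ)‖ / ‖1 - aa t ρ ^ 2‖) * ‖Complex.exp (aa t ρ * U) - Complex.exp (-1 * U)‖
          ≤ nz ρ * (‖(2:ℂ)‖ / ‖1 - aa t ρ ^ 2‖) * 2 := by gcongr
        _ = 4 * (nz ρ / ‖1 - aa t ρ ^ 2‖) * 1 := by simp; ring
        _ ≤ _ := by gcongr)
  obtain ⟨c1, i1⟩ := L1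
  obtain ⟨c2, i2⟩ := L2
  have hPc : Continuous P := by simp only [hP]; fun_prop
  set g : ℝ → ℂ := fun U => ((∑' n, f1 n U) - P U) + (∑' ρ, f2 ρ U) + q * Complex.exp (-1 * U) with hg
  have hPint : ∀ z : ℂ, z.re = 2 → IntegrableOn (fun U : ℝ => Complex.exp (-z * U) * P U) (Set.Ioi 0) := by
    intro z hz
    have k1 := Integrable.const_mul (lap_exp_int (z := z) (a := b) (by rw [hz, hbre]; norm_num)) (2 / (1 - b^2))
    have k2 := Integrable.const_mul (lap_exp_int (z := z) (a := -1) (by rw [hz]; norm_num)) (1 / (1 + b))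
    refine (k1.sub k2).congr (Eventually.of_forall fun U => ?_)
    simp only [hP, Pi.sub_apply]; ring
  have hPlap : ∀ z : ℂ, z.re = 2 → ∫ U : ℝ in Set.Ioi 0, Complex.exp (-z * U) * P U =
      2 / (1 - b^2) * (1 / (z - b)) - 1 / (1 + b) * (1 / (z + 1)) := by
    intro z hz
    have k1 := Integrable.const_mul (lap_exp_int (z := z) (a := b) (by rw [hz, hbre]; norm_num)) (2 / (1 - b^2))
    have k2 := Integrable.const_mul (lap_exp_int (z := z) (a := -1) (by rw [hz]; norm_num)) (1 / (1 + b))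
    have := integral_sub k1 k2
    rw [integral_const_mul, integral_const_mul, lap_exp (by rw [hz, hbre]; norm_num),
      lap_exp (by rw [hz]; norm_num), sub_neg_eq_add] at this
    rw [← this]
    congr 1; funext U; simp only [hP]; ring
  have hEint : ∀ z : ℂ, z.re = 2 → IntegrableOn (fun U : ℝ => Complex.exp (-z * U) * (q * Complex.exp (-1 * U))) (Set.Ioi 0) := by
    intro z hz
    refine (Integrable.const_mul (lap_exp_int (z := z) (a := -1) (by rw [hz]; norm_num)) q).congr
      (Eventually.of_forall fun U => ?_)
    simp only; ring
  have hElap : ∀ z : ℂ, z.re = 2 → ∫ U : ℝ in Set.Ioi 0, Complex.exp (-z * U) * (q * Complex.exp (-1 * U)) = q * (1 / (z + 1)) := by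
    intro z hz
    have := lap_exp (z := z) (a := -1) (by rw [hz]; norm_num)
    rw [sub_neg_eq_add] at this
    rw [← this, ← integral_const_mul]
    congr 1; funext U; ring
  have hgint : ∀ z : ℂ, z.re = 2 → IntegrableOn (fun U : ℝ => Complex.exp (-z * U) * g U) (Set.Ioi 0) := by
    intro z hz
    refine (((Integrable.sub (i1 z hz).1 (hPint z hz)).add (i2 z hz).1).add (hEint z hz)).congr
      (Eventually.of_forall fun U => ?_)
    simp only [hg, Pi.add_apply, Pi.sub_apply]; ring
  have key := lap_unique g ?_ ?_ ?_ U hU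
  · have hSS : SS U t = (∑' n, f1 n U) - P U := by
      have hk := Klap (z := -b) (by simp [hbre]; norm_num) (by
        intro h; have := congrArg Complex.re h; simp [hbre] at this; norm_num at this) hU.le
      unfold SS
      rw [hk]
      simp only [hP]
      have : 1 - (-b)^2 = 1 - b^2 := by ring
      rw [this, neg_neg, sub_neg_eq_add, neg_one_mul]
      ring
    rw [hSS]
    simp only [hg] at key
    linear_combination key
  · simp only [hg]
    refine ((c1.sub hPc.continuousOn).add c2).add ?_
    fun_prop
  · have := hgint 2 (by simp)
    simpa using this
  · intro z hz
    have split : ∫ U : ℝ in Set.Ioi 0, Complex.exp (-z * U) * g U =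
        ((∫ U : ℝ in Set.Ioi 0, Complex.exp (-z * U) * (∑' n, f1 n U)) -
        (∫ U : ℝ in Set.Ioi 0, Complex.exp (-z * U) * P U)) +
        (∫ U : ℝ in Set.Ioi 0, Complex.exp (-z * U) * (∑' ρ, f2 ρ U)) +
        ∫ U : ℝ in Set.Ioi 0, Complex.exp (-z * U) * (q * Complex.exp (-1 * U)) := by
      rw [← integral_sub (i1 z hz).1 (hPint z hz), ← integral_add, ← integral_add]
      · congr 1; funext U; simp only [hg]; ring
      · exact (Integrable.sub (i1 z hz).1 (hPint z hz)).add (i2 z hz).1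
      · exact hEint z hz
      · exact Integrable.sub (i1 z hz).1 (hPint z hz)
      · exact (i2 z hz).1
    rw [split, hPlap z hz, hElap z hz]
    have z1 : z ≠ 1 := by rintro rfl; simp at hz
    have n1 : 1 - z ≠ 0 := sub_ne_zero.2 z1.symm
    have n2 : z + 1 ≠ 0 := by intro h; have := congrArg Complex.re h; simp [hz] at this; norm_num at this
    have n3 : z - b ≠ 0 := by intro h; have := congrArg Complex.re h; simp [hz, hbre] at this; norm_num at this
    have n4 : 1 - b ≠ 0 := by intro h; have := congrArg Complex.re h; simp [hbre] at this; norm_num at this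
    have n5 : 1 + b ≠ 0 := by intro h; have := congrArg Complex.re h; simp [hbre] at this; norm_num at this
    have h1re : 1 < (1/2 + t * Complex.I + z : ℂ).re := by simp [hz]; norm_num
    have h2re : 1 < (3/2 + t * Complex.I : ℂ).re := by simp; norm_num
    set qz := logDeriv Zf (1/2 + t * Complex.I + z) with hqz
    -- prime sum
    have I1 : ∫ U : ℝ in Set.Ioi 0, Complex.exp (-z * U) * (∑' n, f1 n U) =
        2 / (1 - z^2) * (1 / (z - b) - qz) - 1 / (1 - z) * (1 / (1 - b) - q) := by
      have A1 := (LS_hasSum h1re).mul_left (2 / (1 - z^2))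
      have A2 := (LS_hasSum h2re).mul_left (1 / (1 - z))
      have A := A1.sub A2
      have e1 : (1/2 + t * Complex.I + z : ℂ) - 1 = z - b := by rw [hb]; ring
      have e2 : (3/2 + t * Complex.I : ℂ) - 1 = 1 - b := by rw [hb]; ring
      rw [e1, e2] at A
      refine (i1 z hz).2.unique (A.congr_fun fun n => ?_)
      rcases Nat.eq_zero_or_pos n with h0 | h0
      · simp [hf1, h0]
      have hn : (0:ℝ) ≤ Real.log n := Real.log_natCast_nonneg n
      have kk := Klap (z := z) (by rw [hz]; norm_num) z1 hn
      have : ∀ U : ℝ, Complex.exp (-z * U) * f1 n U = ((ArithmeticFunction.vonMangoldt n : ℂ) *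
          Complex.exp (-(1/2 + t * Complex.I) * (Real.log n : ℝ))) * (Complex.exp (-z * U) * (Real.exp (-|U - Real.log n|) : ℂ)) := by
        intro U; simp only [hf1]; ring
      simp_rw [this]
      rw [integral_const_mul, kk]
      have e3 : Complex.exp (-(1/2 + t * Complex.I + z) * (Real.log n : ℝ)) =
        Complex.exp (-(1/2 + t * Complex.I) * (Real.log n : ℝ)) * Complex.exp (-z * (Real.log n : ℝ)) := by
        rw [← Complex.exp_add]; ring_nf
      have e4 : Complex.exp (-(3/2 + t * Complex.I) * (Real.log n : ℝ)) =
        Complex.exp (-(1/2 + t * Complex.I) * (Real.log n : ℝ)) * Complex.exp (-(Real.log n : ℝ)) := by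
        rw [← Complex.exp_add]; ring_nf
      rw [e3, e4]
      ring
    have I2 : ∫ U : ℝ in Set.Ioi 0, Complex.exp (-z * U) * (∑' ρ, f2 ρ U) =
        2 / ((1 - z) * (z + 1)) * (qz - q) := by
      have A := (zf_pf _ _ (Zf_ne h1re) (Zf_ne h2re)).mul_left (2 / ((1 - z) * (z + 1)))
      refine (i2 z hz).2.unique (A.congr_fun fun ρ => ?_)
      by_cases h0 : nz ρ = 0
      · simp [hf2, h0]
      have ha : (aa t ρ).re ≤ 0 ∧ (aa t ρ).re ≠ -1 := by
        rcases hare ρ h0 with h | h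
        · rw [h]; norm_num
        · constructor
          · linarith
          · intro h'; linarith
      have this : ∀ U : ℝ, Complex.exp (-z * U) * f2 ρ U = (nz ρ : ℂ) * (2 / (1 - aa t ρ ^ 2)) *
          (Complex.exp (-z * U) * Complex.exp (aa t ρ * U) - Complex.exp (-z * U) * Complex.exp (-1 * U)) := by
        intro U; simp only [hf2]; ring
      simp_rw [this]
      have l1 : (aa t ρ).re < z.re := by rw [hz]; linarith [ha.1]
      have l2 : (-1 : ℂ).re < z.re := by rw [hz]; norm_num
      rw [integral_const_mul, integral_sub (lap_exp_int l1) (lap_exp_int l2), lap_exp l1, lap_exp l2]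
      have e1 : (1/2 + t * Complex.I + z - ρ : ℂ) = z - aa t ρ := by simp only [aa]; ring
      have e2 : (3/2 + t * Complex.I - ρ : ℂ) = 1 - aa t ρ := by simp only [aa]; ring
      rw [e1, e2]
      generalize aa t ρ = a at *
      have m1 : z - a ≠ 0 := by intro h; have := congrArg Complex.re h; simp at this; linarith
      have m2 : 1 - a ≠ 0 := by intro h; have := congrArg Complex.re h; simp at this; linarith
      have m3 : 1 + a ≠ 0 := by
        intro h; have := congrArg Complex.re h; simp at this; exact ha.2 (by linarith)
      have m4 : 1 - a^2 = (1 - a) * (1 + a) := by ring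
      rw [m4, sub_neg_eq_add]
      field_simp
      ring
    rw [I1, I2]
    have d1 : 1 - z^2 = (1 - z) * (z + 1) := by ring
    have d2 : 1 - b^2 = (1 - b) * (1 + b) := by ring
    rw [d1, d2]
    field_simp
    ring

end B1

namespace B1
open Filter Topology Metric

/-! ### Zeros on the critical line -/

noncomputable def mm (γ : ℝ) : ℝ := nz (1/2 + γ * Complex.I)

lemma mm_nonneg (γ : ℝ) : 0 ≤ mm γ := nz_nonneg _

lemma crit_inj : Function.Injective (fun γ : ℝ => (1/2 + γ * Complex.I : ℂ)) := by
  intro x y h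
  have := congrArg Complex.im h
  simpa using this

lemma crit_range : Set.range (fun γ : ℝ => (1/2 + γ * Complex.I : ℂ)) = {ρ | ρ.re = 1/2} := by
  ext ρ
  constructor
  · rintro ⟨γ, rfl⟩; simp
  · intro h
    refine ⟨ρ.im, ?_⟩
    apply Complex.ext
    · simpa using h.symm
    · simp

lemma aa_line (t γ : ℝ) : aa t (1/2 + γ * Complex.I) = ((γ - t : ℝ) : ℂ) * Complex.I := by
  simp only [aa]; push_cast; ring

lemma G_line (t γ : ℝ) : nz (1/2 + γ * Complex.I) / ‖1 - aa t (1/2 + γ * Complex.I) ^ 2‖ = mm γ / (1 + (γ - t)^2) := by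
  rw [one_sub_aa_crit (by simp), Complex.norm_real, Real.norm_eq_abs, abs_of_pos (by positivity)]
  simp [mm]

lemma line_summable (hRH : RiemannHypothesis) (t : ℝ) : Summable (fun γ : ℝ => mm γ / (1 + (γ - t)^2)) := by
  refine ((G_summable hRH t).comp_injective crit_inj).congr fun γ => ?_
  exact G_line t γ

lemma line_bound (hRH : RiemannHypothesis) {η : ℝ} (hη : 0 < η) (hη1 : η ≤ 1) :
    ∃ C : ℝ, 0 < C ∧ ∀ t : ℝ, ∑' γ : ℝ, mm γ / (1 + (γ - t)^2) ≤ C * (1 + |t|) ^ η := by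
  obtain ⟨C, hC, h⟩ := G_bound hRH hη hη1
  refine ⟨C, hC, fun t => le_trans ?_ (h t)⟩
  refine Summable.tsum_le_tsum_of_inj _ crit_inj (fun ρ _ => div_nonneg (nz_nonneg ρ) (norm_nonneg _))
    (fun γ => (G_line t γ).ge) (line_summable hRH t) (G_summable hRH t)

/-- the zero side -/
noncomputable def ZZ (U t : ℝ) : ℂ :=
  ∑' γ : ℝ, ((mm γ * (2 / (1 + (γ - t)^2)) : ℝ) : ℂ) * Complex.exp (((γ - t : ℝ) : ℂ) * Complex.I * U)

lemma norm_exp_I (x U : ℝ) : ‖Complex.exp ((x : ℂ) * Complex.I * U)‖ = 1 := by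
  rw [norm_exp_mul]; simp

lemma ZZ_term_norm (U t γ : ℝ) :
    ‖((mm γ * (2 / (1 + (γ - t)^2)) : ℝ) : ℂ) * Complex.exp (((γ - t : ℝ) : ℂ) * Complex.I * U)‖ =
      2 * (mm γ / (1 + (γ - t)^2)) := by
  rw [norm_mul, norm_exp_I, Complex.norm_real, Real.norm_eq_abs, abs_of_nonneg
    (mul_nonneg (mm_nonneg γ) (by positivity))]
  ring

lemma ZZ_bound (hRH : RiemannHypothesis) (U t : ℝ) : ‖ZZ U t‖ ≤ 2 * ∑' γ : ℝ, mm γ / (1 + (γ - t)^2) := by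
  unfold ZZ
  rw [← tsum_mul_left]
  exact tsum_of_norm_bounded ((line_summable hRH t).mul_left 2).hasSum fun γ => (ZZ_term_norm U t γ).le

lemma SS_ZZ (hRH : RiemannHypothesis) {η : ℝ} (hη : 0 < η) (hη1 : η ≤ 1) :
    ∃ C : ℝ, 0 < C ∧ ∀ U t : ℝ, 0 < U → ‖SS U t + ZZ U t‖ ≤ C * (1 + |t|) ^ η * Real.exp (-U) := by
  obtain ⟨C, hC, h⟩ := G_bound hRH hη hη1
  obtain ⟨L, hL, hLb⟩ := logDeriv_bound
  refine ⟨4 * C + L, by positivity, fun U t hU => ?_⟩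
  rw [explicit hRH t U hU]
  set f2 : ℂ → ℂ := fun ρ => (nz ρ : ℂ) * (2 / (1 - aa t ρ ^ 2)) *
    (Complex.exp (aa t ρ * U) - Complex.exp (-1 * U)) with hf2
  set fc : ℂ → ℂ := fun ρ => if ρ.re = 1/2 then (nz ρ : ℂ) * (2 / (1 - aa t ρ ^ 2)) * Complex.exp (aa t ρ * U) else 0 with hfc
  have hG := G_summable hRH t
  have hnz : ∀ ρ, ‖(nz ρ : ℂ) * (2 / (1 - aa t ρ ^ 2))‖ = 2 * (nz ρ / ‖1 - aa t ρ ^ 2‖) := by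
    intro ρ
    rw [norm_mul, norm_div, Complex.norm_real, Real.norm_eq_abs, abs_of_nonneg (nz_nonneg ρ)]
    simp; ring
  have hZ : ZZ U t = ∑' ρ, fc ρ := by
    rw [← crit_inj.tsum_eq (f := fc)]
    · unfold ZZ
      congr 1; funext γ
      have : ((1/2 : ℂ) + γ * Complex.I).re = 1/2 := by simp
      simp only [hfc, this, if_true]
      rw [one_sub_aa_crit this, aa_line]
      have him : ((1/2 : ℂ) + γ * Complex.I).im = γ := by simp
      rw [him]
      simp only [mm]
      push_cast; ring
    · rw [crit_range]
      intro ρ hρ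
      by_contra h
      apply hρ
      exact if_neg h
  have hfcs : Summable fc := by
    refine Summable.of_norm_bounded (hG.mul_left 2) fun ρ => ?_
    simp only [hfc]
    split_ifs with hr
    · rw [norm_mul, hnz, aa_crit hr, norm_exp_I, mul_one, ← aa_crit hr]
    · simp only [norm_zero]
      exact mul_nonneg zero_le_two (div_nonneg (nz_nonneg ρ) (norm_nonneg _))
  have hterm : ∀ ρ, ‖f2 ρ - fc ρ‖ ≤ 4 * (nz ρ / ‖1 - aa t ρ ^ 2‖) * Real.exp (-U) := by
    intro ρ
    have hg : 0 ≤ nz ρ / ‖1 - aa t ρ ^ 2‖ := div_nonneg (nz_nonneg ρ) (norm_nonneg _)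
    have e1 : ‖Complex.exp (-1 * (U:ℂ))‖ = Real.exp (-U) := by rw [norm_exp_mul]; simp
    have hE := Real.exp_pos (-U)
    by_cases h0 : nz ρ = 0
    · simp [hf2, hfc, h0]
    rcases nz_cases hRH h0 with h | ⟨x, hx, h⟩
    · have : f2 ρ - fc ρ = -((nz ρ : ℂ) * (2 / (1 - aa t ρ ^ 2)) * Complex.exp (-1 * U)) := by
        simp only [hf2, hfc]; rw [if_pos h]; ring
      rw [this, norm_neg, norm_mul, hnz, e1]
      gcongr; norm_num
    · have hr : ¬ ρ.re = 1/2 := by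
        rw [h, Complex.ofReal_re]; intro h'; linarith
      have : f2 ρ - fc ρ = (nz ρ : ℂ) * (2 / (1 - aa t ρ ^ 2)) *
        (Complex.exp (aa t ρ * U) - Complex.exp (-1 * U)) := by
        simp only [hf2, hfc]; rw [if_neg hr, sub_zero]
      rw [this, norm_mul, hnz]
      have e2 : ‖Complex.exp (aa t ρ * U) - Complex.exp (-1 * U)‖ ≤ 2 * Real.exp (-U) := by
        refine (norm_sub_le _ _).trans ?_
        rw [e1, norm_exp_mul]
        have : Real.exp ((aa t ρ).re * U) ≤ Real.exp (-U) := by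
          apply Real.exp_le_exp.2
          have : (aa t ρ).re ≤ -1 := by simp [aa, h]; linarith
          nlinarith
        linarith
      calc _ ≤ 2 * (nz ρ / ‖1 - aa t ρ ^ 2‖) * (2 * Real.exp (-U)) := by gcongr
        _ = _ := by ring
  have hds : Summable (fun ρ => f2 ρ - fc ρ) :=
    Summable.of_norm_bounded ((hG.mul_left 4).mul_right _) hterm
  have hf2s : Summable f2 := by
    refine (hds.add hfcs).congr fun ρ => ?_
    ring
  have e : -(∑' ρ, f2 ρ) - logDeriv Zf (3/2 + t * Complex.I) * Complex.exp (-1 * U) + ZZ U t =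
      -(∑' ρ, (f2 ρ - fc ρ)) - logDeriv Zf (3/2 + t * Complex.I) * Complex.exp (-1 * U) := by
    rw [hZ, Summable.tsum_sub hf2s hfcs]; ring
  rw [e]
  have h1t : 1 ≤ (1 + |t|) ^ η := Real.one_le_rpow (by linarith [abs_nonneg t]) hη.le
  have hE := Real.exp_pos (-U)
  have b1 : ‖∑' ρ, (f2 ρ - fc ρ)‖ ≤ 4 * (C * (1 + |t|)^η) * Real.exp (-U) := by
    refine (tsum_of_norm_bounded ((hG.mul_left 4).mul_right _).hasSum hterm).trans ?_
    rw [tsum_mul_right, tsum_mul_left]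
    gcongr
    exact h t
  have b2 : ‖logDeriv Zf (3/2 + t * Complex.I) * Complex.exp (-1 * U)‖ ≤ L * (1 + |t|)^η * Real.exp (-U) := by
    rw [norm_mul, norm_exp_mul]
    simp only [Complex.neg_re, Complex.one_re, neg_mul, one_mul]
    gcongr
    calc _ ≤ L * 1 := by rw [mul_one]; exact hLb t
      _ ≤ _ := by gcongr
  calc _ ≤ ‖∑' ρ, (f2 ρ - fc ρ)‖ + ‖logDeriv Zf (3/2 + t * Complex.I) * Complex.exp (-1 * U)‖ := by
        refine (norm_sub_le _ _).trans ?_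
        rw [norm_neg]
    _ ≤ _ := by linarith

lemma SS_bound (hRH : RiemannHypothesis) {η : ℝ} (hη : 0 < η) (hη1 : η ≤ 1) :
    ∃ C : ℝ, 0 < C ∧ ∀ U t : ℝ, 0 < U → ‖SS U t‖ ≤ C * (1 + |t|) ^ η := by
  obtain ⟨C, hC, h⟩ := SS_ZZ hRH hη hη1
  obtain ⟨C', hC', h'⟩ := line_bound hRH hη hη1
  refine ⟨C + 2 * C', by positivity, fun U t hU => ?_⟩
  have e : SS U t = (SS U t + ZZ U t) - ZZ U t := by ring
  rw [e]
  refine (norm_sub_le _ _).trans ?_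
  have h1 := h U t hU
  have h2 := ZZ_bound hRH U t
  have h3 := h' t
  have h4 : Real.exp (-U) ≤ 1 := Real.exp_le_one_iff.2 (by linarith)
  have h5 : C * (1 + |t|) ^ η * Real.exp (-U) ≤ C * (1 + |t|) ^ η * 1 := by gcongr
  linarith

lemma SS_cont {U : ℝ} (hU : 0 ≤ U) : Continuous (SS U) := by
  have h1 : Continuous (fun t : ℝ => ∑' n : ℕ, (ArithmeticFunction.vonMangoldt n : ℂ) *
      Complex.exp (-(1/2 + t * Complex.I) * (Real.log n : ℝ)) * (Real.exp (-|U - Real.log n|) : ℂ)) := by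
    refine continuous_tsum (fun n => by fun_prop) (lam_sum.mul_right (Real.exp U)) fun n t => lam_term_bound n U t
  have h2 : ∀ t : ℝ, ∫ v : ℝ in Set.Ioi 0, Complex.exp (-(-(1/2 - t * Complex.I)) * v) * (Real.exp (-|v - U|) : ℂ) =
      2 * Complex.exp (-(-(1/2 - t * Complex.I)) * U) / (1 - (-(1/2 - t * Complex.I))^2)
        - Complex.exp (-U) / (1 - (-(1/2 - t * Complex.I))) := by
    intro t
    exact Klap (z := -(1/2 - t * Complex.I)) (by simp; norm_num) (by
        intro h; have := congrArg Complex.re h; simp at this; norm_num at this) hU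
  have h3 : ∀ t : ℝ, (1 - (-(1/2 - t * Complex.I)) : ℂ) ≠ 0 := by
    intro t h; have := congrArg Complex.re h; simp at this; norm_num at this
  have h4 : ∀ t : ℝ, (1 + (-(1/2 - t * Complex.I)) : ℂ) ≠ 0 := by
    intro t h; have := congrArg Complex.re h; simp at this; norm_num at this
  have h5 : ∀ t : ℝ, (1 - (-(1/2 - t * Complex.I))^2 : ℂ) ≠ 0 := by
    intro t
    have : (1 - (-(1/2 - t * Complex.I))^2 : ℂ) = (1 - (-(1/2 - t * Complex.I))) * (1 + (-(1/2 - t * Complex.I))) := by ring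
    rw [this]; exact mul_ne_zero (h3 t) (h4 t)
  have : SS U = fun t : ℝ => SS U t := rfl
  rw [this]
  unfold SS
  simp_rw [h2]
  refine h1.sub (Continuous.sub (Continuous.div (by fun_prop) (by fun_prop) h5) (Continuous.div (by fun_prop) (by fun_prop) h3))

/-! weighted sums with exponent 5/4 -/

lemma int_summable {s : ℝ} (hs : 1 < s) : Summable (fun k : ℤ => (1 + |(k:ℝ)|) ^ (-s)) := by
  have h := (Real.summable_one_div_int_add_rpow (1/2) s).2 hs
  refine Summable.of_nonneg_of_le (fun k => by positivity) (fun k => ?_) h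
  have h0 : (k:ℝ) + 1/2 ≠ 0 := by
    intro h
    have : (2 * k + 1 : ℤ) = 0 := by
      have : (2 * (k:ℝ) + 1) = 0 := by linarith
      exact_mod_cast this
    omega
  rw [Real.rpow_neg (by positivity), one_div]
  gcongr
  refine (abs_add_le _ _).trans ?_
  rw [abs_of_pos (by norm_num : (0:ℝ) < 1/2)]; linarith

lemma wt_bound (hRH : RiemannHypothesis) {η : ℝ} (hη : 0 < η) (hη1 : η ≤ 1/8) :
    ∃ C : ℝ, 0 < C ∧ ∀ t : ℝ, Summable (fun γ : ℝ => mm γ * (1 + |γ - t|) ^ (-(5/4:ℝ))) ∧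
      ∑' γ : ℝ, mm γ * (1 + |γ - t|) ^ (-(5/4:ℝ)) ≤ C * (1 + |t|) ^ η := by
  obtain ⟨C, hC, h⟩ := line_bound hRH hη (by linarith)
  set A := ∑' k : ℤ, (1 + |(k:ℝ)|) ^ (-(5/4 - η)) with hA
  have hAs : Summable (fun k : ℤ => (1 + |(k:ℝ)|) ^ (-(5/4 - η))) := int_summable (by linarith)
  have hA0 : 0 ≤ A := tsum_nonneg fun k => by positivity
  refine ⟨8 * C * A + 1, by positivity, fun t => ?_⟩
  have hk1 : ∀ k : ℤ, (1 + |(k:ℝ)|) ^ (-(5/4:ℝ)) * (C * (1 + |t + k|)^η) ≤ (C * (1 + |t|)^η) * (1 + |(k:ℝ)|) ^ (-(5/4 - η)) := by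
    intro k
    have e1 : (1 + |t + k|) ≤ (1 + |t|) * (1 + |(k:ℝ)|) := by
      have := abs_add_le t k
      nlinarith [abs_nonneg t, abs_nonneg (k:ℝ)]
    have e2 : (1 + |t + k|)^η ≤ (1 + |t|)^η * (1 + |(k:ℝ)|)^η := by
      rw [← Real.mul_rpow (by positivity) (by positivity)]
      gcongr
    have e3 : (1 + |(k:ℝ)|) ^ (-(5/4 - η)) = (1 + |(k:ℝ)|) ^ (-(5/4:ℝ)) * (1 + |(k:ℝ)|)^η := by
      rw [← Real.rpow_add (by positivity)]; ring_nf
    rw [e3]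
    calc _ ≤ (1 + |(k:ℝ)|) ^ (-(5/4:ℝ)) * (C * ((1 + |t|)^η * (1 + |(k:ℝ)|)^η)) := by gcongr
      _ = _ := by ring
  have hpt : ∀ x : ℝ, (1 + |x|) ^ (-(5/4:ℝ)) ≤ 8 * ∑' k : ℤ, (1 + |(k:ℝ)|) ^ (-(5/4:ℝ)) * (1 / (1 + (x - k)^2)) := by
    intro x
    have hs : Summable (fun k : ℤ => (1 + |(k:ℝ)|) ^ (-(5/4:ℝ)) * (1 / (1 + (x - k)^2))) := by
      refine Summable.of_nonneg_of_le (fun k => by positivity) (fun k => ?_) (int_summable (s := 5/4) (by norm_num))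
      refine mul_le_of_le_one_right (by positivity) ?_
      rw [div_le_one (by positivity)]; nlinarith [sq_nonneg (x - k)]
    have h1 := hs.le_tsum ⌊x⌋ (fun k _ => by positivity)
    refine le_trans ?_ (mul_le_mul_of_nonneg_left h1 (by norm_num))
    have f1 := Int.floor_le x
    have f2 := Int.lt_floor_add_one x
    have g1 : 1 / 2 ≤ 1 / (1 + (x - (⌊x⌋:ℝ))^2) := by
      apply one_div_le_one_div_of_le (by positivity)
      nlinarith
    have g2 : 1 + |(⌊x⌋:ℝ)| ≤ 2 * (1 + |x|) := by
      have : |(⌊x⌋:ℝ)| ≤ |x| + 1 := by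
        have := abs_sub_abs_le_abs_sub (⌊x⌋:ℝ) x
        have h2 : |(⌊x⌋:ℝ) - x| ≤ 1 := by rw [abs_le]; constructor <;> linarith
        linarith
      linarith [abs_nonneg x]
    have g3 : (2 * (1 + |x|)) ^ (-(5/4:ℝ)) ≤ (1 + |(⌊x⌋:ℝ)|) ^ (-(5/4:ℝ)) :=
      Real.rpow_le_rpow_of_nonpos (by positivity) g2 (by norm_num)
    rw [Real.mul_rpow (by norm_num) (by positivity)] at g3
    have g4 : (1/4:ℝ) ≤ 2 ^ (-(5/4:ℝ)) := by
      have : (2:ℝ)^(-(2:ℝ)) ≤ 2 ^ (-(5/4:ℝ)) := Real.rpow_le_rpow_of_exponent_le (by norm_num) (by norm_num)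
      refine le_trans ?_ this
      rw [Real.rpow_neg (by norm_num)]; norm_num
    calc (1 + |x|) ^ (-(5/4:ℝ)) = 8 * (1/4 * (1 + |x|) ^ (-(5/4:ℝ)) * (1/2)) := by ring
      _ ≤ 8 * (2 ^ (-(5/4:ℝ)) * (1 + |x|) ^ (-(5/4:ℝ)) * (1/2)) := by gcongr
      _ ≤ 8 * ((1 + |(⌊x⌋:ℝ)|) ^ (-(5/4:ℝ)) * (1 / (1 + (x - (⌊x⌋:ℝ))^2))) := by gcongr
  have hfin : ∀ s : Finset ℝ, ∑ γ ∈ s, mm γ * (1 + |γ - t|) ^ (-(5/4:ℝ)) ≤ 8 * C * A * (1 + |t|)^η := by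
    intro s
    have hsum : ∀ γ, Summable (fun k : ℤ => mm γ * ((1 + |(k:ℝ)|) ^ (-(5/4:ℝ)) * (1 / (1 + ((γ - t) - k)^2)))) := by
      intro γ
      refine Summable.mul_left _ ?_
      refine Summable.of_nonneg_of_le (fun k => by positivity) (fun k => ?_) (int_summable (s := 5/4) (by norm_num))
      refine mul_le_of_le_one_right (by positivity) ?_
      rw [div_le_one (by positivity)]; nlinarith [sq_nonneg ((γ - t) - k)]
    calc ∑ γ ∈ s, mm γ * (1 + |γ - t|) ^ (-(5/4:ℝ))
        ≤ ∑ γ ∈ s, 8 * ∑' k : ℤ, mm γ * ((1 + |(k:ℝ)|) ^ (-(5/4:ℝ)) * (1 / (1 + ((γ - t) - k)^2))) := by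
          refine Finset.sum_le_sum fun γ hγ => ?_
          rw [tsum_mul_left]
          have := mul_le_mul_of_nonneg_left (hpt (γ - t)) (mm_nonneg γ)
          linarith
      _ = 8 * ∑' k : ℤ, ∑ γ ∈ s, mm γ * ((1 + |(k:ℝ)|) ^ (-(5/4:ℝ)) * (1 / (1 + ((γ - t) - k)^2))) := by
          rw [← Finset.mul_sum, Summable.tsum_finsetSum fun γ _ => hsum γ]
      _ ≤ 8 * ∑' k : ℤ, (C * (1 + |t|)^η) * (1 + |(k:ℝ)|) ^ (-(5/4 - η)) := by
          gcongr with k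
          · exact summable_sum fun γ _ => hsum γ
          · exact hAs.mul_left _
          · refine le_trans ?_ (hk1 k)
            have : ∑ γ ∈ s, mm γ * ((1 + |(k:ℝ)|) ^ (-(5/4:ℝ)) * (1 / (1 + ((γ - t) - k)^2))) =
              (1 + |(k:ℝ)|) ^ (-(5/4:ℝ)) * ∑ γ ∈ s, mm γ / (1 + (γ - (t + k))^2) := by
              rw [Finset.mul_sum]
              refine Finset.sum_congr rfl fun γ _ => ?_
              rw [show γ - t - k = γ - (t + k) by ring]; ring
            rw [this]
            gcongr
            refine le_trans ?_ (h (t + k))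
            exact (line_summable hRH (t + k)).sum_le_tsum s (fun γ _ => div_nonneg (mm_nonneg γ) (by positivity))
      _ = _ := by rw [tsum_mul_left]; ring
  have hnn : ∀ γ, 0 ≤ mm γ * (1 + |γ - t|) ^ (-(5/4:ℝ)) := fun γ => mul_nonneg (mm_nonneg γ) (by positivity)
  refine ⟨summable_of_sum_le hnn hfin, ?_⟩
  refine (Real.tsum_le_of_sum_le hnn hfin).trans ?_
  gcongr; linarith

end B1

namespace B1
open Filter Topology Metric

/-! ### The pair correlation function as an integral -/

lemma log_ratio_tendsto (u : ℝ) {l : Filter ℝ} (hl : Tendsto (fun t : ℝ => |t - u|) l atTop) :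
    Tendsto (fun t : ℝ => Real.log ((1 + t^2) / (1 + (t - u)^2))) l (𝓝 0) := by
  have h1 : Tendsto (fun t : ℝ => (1 + t^2) / (1 + (t - u)^2)) l (𝓝 1) := by
    rw [tendsto_iff_norm_sub_tendsto_zero]
    have h2 : Tendsto (fun t : ℝ => (2 * |u| + u^2) * |t - u|⁻¹) l (𝓝 ((2 * |u| + u^2) * 0)) :=
      (tendsto_inv_atTop_zero.comp hl).const_mul _
    rw [mul_zero] at h2
    refine squeeze_zero' (Eventually.of_forall fun _ => norm_nonneg _) ?_ h2
    filter_upwards [hl.eventually_ge_atTop 1] with t ht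
    have e : (1 + t^2) / (1 + (t - u)^2) - 1 = (2 * u * (t - u) + u^2) / (1 + (t - u)^2) := by
      field_simp; ring
    rw [e, norm_div, Real.norm_eq_abs, Real.norm_eq_abs, abs_of_pos (by positivity : 0 < 1 + (t-u)^2),
      ← div_eq_mul_inv, div_le_div_iff₀ (by positivity) (by linarith)]
    have h3 : |2 * u * (t - u) + u^2| ≤ 2 * |u| * |t - u| + u^2 := by
      refine (abs_add_le _ _).trans ?_
      rw [abs_mul, abs_mul, abs_of_pos (by norm_num : (0:ℝ) < 2), abs_of_nonneg (sq_nonneg u)]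
    rw [← sq_abs (t - u)]
    have h4 := abs_nonneg u
    have h5 := sq_nonneg u
    generalize |t - u| = s at *
    calc _ ≤ (2 * |u| * s + u^2) * s := by gcongr
      _ ≤ _ := by nlinarith [mul_nonneg h5 (by linarith : 0 ≤ s), mul_nonneg h5 (mul_nonneg (by linarith : 0 ≤ s) (by linarith : 0 ≤ s - 1))]
  have := (Real.continuousAt_log one_ne_zero).tendsto.comp h1
  rw [Real.log_one] at this
  exact this

lemma arctan_top (u : ℝ) : Tendsto (fun t => Real.arctan (t - u)) atTop (𝓝 (π/2)) :=
  (tendsto_nhds_of_tendsto_nhdsWithin Real.tendsto_arctan_atTop).comp (tendsto_atTop_add_const_right _ (-u) tendsto_id)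
lemma arctan_bot (u : ℝ) : Tendsto (fun t => Real.arctan (t - u)) atBot (𝓝 (-(π/2))) :=
  (tendsto_nhds_of_tendsto_nhdsWithin Real.tendsto_arctan_atBot).comp (tendsto_atBot_add_const_right _ (-u) tendsto_id)

lemma cauchy_int (u : ℝ) : Integrable (fun t : ℝ => 1 / ((1 + t^2) * (1 + (t - u)^2))) := by
  refine integrable_inv_one_add_sq.mono' (by
    refine Continuous.aestronglyMeasurable ?_
    refine Continuous.div continuous_const (by fun_prop) fun t => by positivity) (Eventually.of_forall fun t => ?_)
  rw [Real.norm_eq_abs, abs_of_pos (by positivity), ← one_div]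
  apply one_div_le_one_div_of_le (by positivity)
  nlinarith [sq_nonneg t, sq_nonneg (t-u), mul_nonneg (sq_nonneg t) (sq_nonneg (t - u))]

lemma cauchy_conv0 (u : ℝ) : ∫ t : ℝ, 1 / ((1 + t^2) * (1 + (t - u)^2)) = 2 * π / (4 + u^2) := by
  have hd1 : ∀ t v : ℝ, HasDerivAt (fun t => Real.arctan (t - v)) (1 / (1 + (t - v)^2)) t := fun t v => by
    simpa using ((hasDerivAt_id t).sub_const v).arctan
  by_cases hu : u = 0
  · subst hu
    have hder : ∀ t : ℝ, HasDerivAt (fun t => (Real.arctan (t - 0) + t / (1 + t^2)) / 2) (1 / ((1 + t^2) * (1 + (t - 0)^2))) t := by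
      intro t
      have h2 : HasDerivAt (fun t : ℝ => t / (1 + t^2)) ((1 * (1 + t^2) - t * (2 * t)) / (1 + t^2)^2) t := by
        refine HasDerivAt.div (hasDerivAt_id t) ?_ (by positivity)
        simpa using (hasDerivAt_pow 2 t).const_add 1
      refine (((hd1 t 0).add h2).div_const 2).congr_deriv ?_
      rw [sub_zero]
      field_simp; ring
    have hq : ∀ l : Filter ℝ, Tendsto (fun t : ℝ => |t|) l atTop → Tendsto (fun t : ℝ => t / (1 + t^2)) l (𝓝 0) := by
      intro l hl
      refine squeeze_zero_norm (fun t => ?_) (tendsto_inv_atTop_zero.comp hl)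
      simp only [Function.comp]
      rcases eq_or_ne t 0 with h | h
      · simp [h]
      have : 0 < |t| := abs_pos.2 h
      rw [norm_div, Real.norm_eq_abs, Real.norm_eq_abs, abs_of_pos (by positivity : 0 < 1 + t^2), inv_eq_one_div, div_le_div_iff₀ (by positivity) this, ← sq_abs]
      nlinarith
    rw [integral_of_hasDerivAt_of_tendsto hder (cauchy_int 0)
      (((arctan_bot 0).add (hq _ tendsto_abs_atBot_atTop)).div_const 2)
      (((arctan_top 0).add (hq _ tendsto_abs_atTop_atTop)).div_const 2)]
    ring
  · have hder : ∀ t : ℝ, HasDerivAt (fun t => (1 / (u * (4 + u^2))) * Real.log ((1 + t^2) / (1 + (t - u)^2)) +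
        (1 / (4 + u^2)) * (Real.arctan (t - 0) + Real.arctan (t - u))) (1 / ((1 + t^2) * (1 + (t - u)^2))) t := by
      intro t
      have e1 : HasDerivAt (fun t : ℝ => 1 + t^2) (2 * t) t := by
        simpa using (hasDerivAt_pow 2 t).const_add 1
      have e2 : HasDerivAt (fun t : ℝ => 1 + (t - u)^2) (2 * (t - u)) t := by
        simpa using (((hasDerivAt_id t).sub_const u).pow 2).const_add 1
      have e3 := HasDerivAt.log (f := fun t : ℝ => (1 + t^2) / (1 + (t - u)^2)) (e1.div e2 (by positivity)) (by positivity)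
      refine ((e3.const_mul (1 / (u * (4 + u^2)))).add (((hd1 t 0).add (hd1 t u)).const_mul (1 / (4 + u^2)))).congr_deriv ?_
      have p1 : 1 + t^2 ≠ 0 := by positivity
      have p2 : 1 + (t-u)^2 ≠ 0 := by positivity
      have p3 : 4 + u^2 ≠ 0 := by positivity
      rw [sub_zero]
      field_simp
      ring
    have hb : Tendsto (fun t : ℝ => |t - u|) atBot atTop :=
      tendsto_abs_atBot_atTop.comp (tendsto_atBot_add_const_right _ (-u) tendsto_id)
    have ht : Tendsto (fun t : ℝ => |t - u|) atTop atTop :=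
      tendsto_abs_atTop_atTop.comp (tendsto_atTop_add_const_right _ (-u) tendsto_id)
    rw [integral_of_hasDerivAt_of_tendsto hder (cauchy_int u)
      (((log_ratio_tendsto u hb).const_mul _).add (((arctan_bot 0).add (arctan_bot u)).const_mul _))
      (((log_ratio_tendsto u ht).const_mul _).add (((arctan_top 0).add (arctan_top u)).const_mul _))]
    ring

lemma cauchy_conv (x y : ℝ) : Integrable (fun t : ℝ => 1 / ((1 + (x - t)^2) * (1 + (y - t)^2))) ∧
    ∫ t : ℝ, 1 / ((1 + (x - t)^2) * (1 + (y - t)^2)) = 2 * π / (4 + (x - y)^2) := by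
  have e : ∀ t : ℝ, 1 / ((1 + (x - t)^2) * (1 + (y - t)^2)) =
      (fun t : ℝ => 1 / ((1 + t^2) * (1 + (t - (y - x))^2))) (t - x) := by
    intro t; simp only; congr 2 <;> ring
  simp_rw [e]
  constructor
  · exact (cauchy_int (y - x)).comp_sub_right x
  · rw [integral_sub_right_eq_self (fun t : ℝ => 1 / ((1 + t^2) * (1 + (t - (y - x))^2))) x, cauchy_conv0]
    congr 1; ring

noncomputable def ZT (s : Finset ℝ) (U t : ℝ) : ℂ :=
  ∑ γ ∈ s, ((mm γ * (2 / (1 + (γ - t)^2)) : ℝ) : ℂ) * Complex.exp (((γ - t : ℝ) : ℂ) * Complex.I * U)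

lemma ZT_sq (s : Finset ℝ) (U t : ℝ) : ((‖ZT s U t‖^2 : ℝ) : ℂ) =
    ∑ γ ∈ s, ∑ γ' ∈ s, ((4 * mm γ * mm γ' : ℝ) : ℂ) * Complex.exp (((γ - γ' : ℝ) : ℂ) * Complex.I * U) *
      ((1 / ((1 + (γ - t)^2) * (1 + (γ' - t)^2)) : ℝ) : ℂ) := by
  push_cast
  rw [← Complex.mul_conj', ZT, map_sum, Finset.sum_mul_sum]
  refine Finset.sum_congr rfl fun γ _ => Finset.sum_congr rfl fun γ' _ => ?_
  rw [map_mul, ← Complex.exp_conj, Complex.conj_ofReal]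
  have e : Complex.exp (((γ - γ' : ℝ) : ℂ) * Complex.I * U) = Complex.exp (((γ - t : ℝ) : ℂ) * Complex.I * U) *
     Complex.exp ((starRingEnd ℂ) (((γ' - t : ℝ) : ℂ) * Complex.I * U)) := by
    rw [← Complex.exp_add]
    congr 1
    rw [map_mul, map_mul, Complex.conj_ofReal, Complex.conj_ofReal, Complex.conj_I]
    push_cast; ring
  have e' := e
  push_cast at e' ⊢
  rw [e', one_div, mul_inv]
  ring

lemma ZT_cont (s : Finset ℝ) (U : ℝ) : Continuous (ZT s U) := by
  have : ZT s U = fun t => ZT s U t := rfl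
  rw [this]; unfold ZT
  refine continuous_finsetSum _ fun γ _ => ?_
  refine Continuous.mul (Complex.continuous_ofReal.comp (continuous_const.mul
    (Continuous.div continuous_const (by fun_prop) fun t => by positivity))) (by fun_prop)

lemma ZT_int (s : Finset ℝ) (U : ℝ) : Integrable (fun t => ‖ZT s U t‖^2) ∧
    ((∫ t, ‖ZT s U t‖^2 : ℝ) : ℂ) = 2 * π * ∑ γ ∈ s, ∑ γ' ∈ s, ((mm γ * mm γ' : ℝ) : ℂ) *
      Complex.exp (((γ - γ' : ℝ) : ℂ) * Complex.I * U) * ((4 / (4 + (γ - γ')^2) : ℝ) : ℂ) := by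
  have hi : ∀ γ γ' : ℝ, Integrable (fun t : ℝ => ((4 * mm γ * mm γ' : ℝ) : ℂ) * Complex.exp (((γ - γ' : ℝ) : ℂ) * Complex.I * U) *
      ((1 / ((1 + (γ - t)^2) * (1 + (γ' - t)^2)) : ℝ) : ℂ)) := fun γ γ' =>
    ((cauchy_conv γ γ').1.ofReal).const_mul _
  constructor
  · have h : Integrable (fun t => ((‖ZT s U t‖^2 : ℝ) : ℂ)) := by
      simp_rw [ZT_sq]
      exact integrable_finsetSum _ fun γ _ => integrable_finsetSum _ fun γ' _ => hi γ γ'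
    refine h.norm.congr (Eventually.of_forall fun t => ?_)
    beta_reduce
    rw [Complex.norm_real, Real.norm_eq_abs, abs_of_nonneg (by positivity)]
  · rw [← integral_complex_ofReal]
    simp_rw [ZT_sq]
    rw [integral_finsetSum _ fun γ _ => integrable_finsetSum _ fun γ' _ => hi γ γ', Finset.mul_sum]
    refine Finset.sum_congr rfl fun γ _ => ?_
    rw [integral_finsetSum _ fun γ' _ => hi γ γ', Finset.mul_sum]
    refine Finset.sum_congr rfl fun γ' _ => ?_
    rw [integral_const_mul, integral_complex_ofReal, (cauchy_conv γ γ').2]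
    push_cast; ring

lemma zeta_mult (γ : ℝ) : (zetaZeroMult γ : ℝ) = mm γ := by
  set s : ℂ := 1/2 + γ * Complex.I with hs
  have h1 : s ≠ 1 := by
    intro h; have := congrArg Complex.re h; simp [hs] at this
  have han : AnalyticAt ℂ riemannZeta s := by
    rw [Complex.analyticAt_iff_eventually_differentiableAt]
    filter_upwards [isOpen_ne.mem_nhds h1] with z hz using differentiableAt_riemannZeta hz
  have hev : Zf =ᶠ[𝓝 s] ((fun s => s - 1) * riemannZeta) := by
    filter_upwards [isOpen_ne.mem_nhds h1] with z hz using Zf_eq hz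
  have hl : AnalyticAt ℂ (fun s : ℂ => s - 1) s := by fun_prop
  have hl0 : analyticOrderAt (fun s : ℂ => s - 1) s = 0 := by
    rw [hl.analyticOrderAt_eq_zero]; exact sub_ne_zero.2 h1
  have := analyticOrderAt_congr hev
  rw [analyticOrderAt_mul hl han, hl0, zero_add] at this
  unfold zetaZeroMult mm nz mu analyticOrderNatAt
  rw [dif_pos han, this]

lemma zeta_zero_iff (γ : ℝ) : riemannZeta (1/2 + γ * Complex.I) = 0 ↔ mm γ ≠ 0 := by
  have h1 : (1/2 + γ * Complex.I : ℂ) ≠ 1 := by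
    intro h; have := congrArg Complex.re h; simp at this
  have := mu_ne_zero_iff Zf_diff Zf_zero (1/2 + γ * Complex.I)
  rw [Zf_eq h1, mul_eq_zero, or_iff_right (sub_ne_zero.2 h1)] at this
  rw [← this, mm, nz]
  simp

lemma gam_finite (T : ℝ) : {γ : ℝ | riemannZeta (1/2 + γ * Complex.I) = 0 ∧ |γ| ≤ T}.Finite := by
  refine Set.Finite.of_finite_image ((zeros_finite Zf_diff Zf_zero (1/2 + T)).subset ?_) crit_inj.injOn
  rintro _ ⟨γ, ⟨h1, h2⟩, rfl⟩
  constructor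
  · refine (Complex.norm_le_abs_re_add_abs_im _).trans ?_
    simp
    linarith
  · have h : (1/2 + γ * Complex.I : ℂ) ≠ 1 := by
      intro h; have := congrArg Complex.re h; simp at this
    beta_reduce
    rw [Zf_eq h, h1, mul_zero]

noncomputable def gs (T : ℝ) : Finset ℝ := (gam_finite T).toFinset

lemma mem_gs (T γ : ℝ) : γ ∈ gs T ↔ riemannZeta (1/2 + γ * Complex.I) = 0 ∧ |γ| ≤ T := by
  simp [gs]

lemma tsum_sub_fin {p : ℝ → Prop} (s : Finset ℝ) (hs : ∀ γ, γ ∈ s ↔ p γ) (f : ℝ → ℂ) :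
    ∑' γ : {γ // p γ}, f γ.1 = ∑ γ ∈ s, f γ := by
  have : p = fun γ => γ ∈ s := by funext γ; exact propext (hs γ).symm
  subst this
  exact Finset.tsum_subtype' s f

lemma pair_eq (U T : ℝ) : zetaPairCorr (Real.exp U) T = (((2 * π)⁻¹ * ∫ t, ‖ZT (gs T) U t‖^2 : ℝ) : ℂ) := by
  push_cast
  rw [(ZT_int (gs T) U).2, ← mul_assoc, inv_mul_cancel₀ (by
    have := Real.pi_ne_zero
    simp [this]), one_mul]
  unfold zetaPairCorr
  rw [tsum_sub_fin (gs T) (mem_gs T) (fun γ => ∑' γ' : {γ : ℝ // riemannZeta (1 / 2 + (γ : ℂ) * Complex.I) = 0 ∧ |γ| ≤ T},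
      ((zetaZeroMult γ * zetaZeroMult γ'.1 : ℕ) : ℂ) *
        ((Real.exp U : ℝ) : ℂ) ^ (Complex.I * ((γ - γ'.1 : ℝ) : ℂ)) *
        (((4 / (4 + (γ - γ'.1) ^ 2) : ℝ)) : ℂ))]
  refine Finset.sum_congr rfl fun γ _ => ?_
  rw [tsum_sub_fin (gs T) (mem_gs T) (fun γ' => 
      ((zetaZeroMult γ * zetaZeroMult γ' : ℕ) : ℂ) *
        ((Real.exp U : ℝ) : ℂ) ^ (Complex.I * ((γ - γ' : ℝ) : ℂ)) *
        (((4 / (4 + (γ - γ') ^ 2) : ℝ)) : ℂ))]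
  refine Finset.sum_congr rfl fun γ' _ => ?_
  have e1 : ((zetaZeroMult γ * zetaZeroMult γ' : ℕ) : ℂ) = ((mm γ * mm γ' : ℝ) : ℂ) := by
    rw [← zeta_mult, ← zeta_mult]; push_cast; ring
  have e2 : ((Real.exp U : ℝ) : ℂ) ^ (Complex.I * ((γ - γ' : ℝ) : ℂ)) = Complex.exp (((γ - γ' : ℝ) : ℂ) * Complex.I * U) := by
    rw [Complex.cpow_def_of_ne_zero (by exact_mod_cast (Real.exp_pos U).ne'), ← Complex.ofReal_log (Real.exp_pos U).le,
      Real.log_exp]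
    congr 1; ring
  rw [e1, e2]

end B1

namespace B1
open Filter Topology Metric

noncomputable def wt (t : ℝ) : ℝ := (1 + |t|) ^ (-(5/4:ℝ))

lemma wt_int : Integrable wt := by
  have := integrable_one_add_norm (E := ℝ) (μ := volume) (r := 5/4) (by simp; norm_num)
  exact this

lemma wt_pos (t : ℝ) : 0 < wt t := by unfold wt; positivity

/-- distance weight: `(1+||t|-T|)^{-5/4} ≤ wt (t-T) + wt (t+T)` -/
lemma wt_two (t T : ℝ) : (1 + |(|t| - T)|) ^ (-(5/4:ℝ)) ≤ wt (t - T) + wt (t + T) := by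
  rcases le_total 0 t with h | h
  · rw [abs_of_nonneg h]
    have := wt_pos (t + T)
    show wt (t - T) ≤ _
    linarith
  · rw [abs_of_nonpos h, show -t - T = -(t + T) by ring, abs_neg]
    have := wt_pos (t - T)
    show wt (t + T) ≤ _
    linarith

lemma ker_decay {x d : ℝ} (hd : 0 ≤ d) (h : d ≤ |x|) :
    2 / (1 + x^2) ≤ 4 * ((1 + |x|) ^ (-(5/4:ℝ)) * (1 + d) ^ (-(3/4:ℝ))) := by
  have hx := abs_nonneg x
  have h1 : (1 + |x|) ^ (-(3/4:ℝ)) ≤ (1 + d) ^ (-(3/4:ℝ)) :=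
    Real.rpow_le_rpow_of_nonpos (by linarith) (by linarith) (by norm_num)
  have h2 : (1 + |x|) ^ (-(5/4:ℝ)) * (1 + |x|) ^ (-(3/4:ℝ)) = ((1 + |x|)^2)⁻¹ := by
    rw [← Real.rpow_add (by linarith)]
    norm_num
  calc 2 / (1 + x^2) ≤ 4 * ((1 + |x|)^2)⁻¹ := by
        rw [← div_eq_mul_inv, div_le_div_iff₀ (by positivity) (by positivity), ← sq_abs x]
        nlinarith [sq_nonneg (1 - |x|)]
    _ = 4 * ((1 + |x|) ^ (-(5/4:ℝ)) * (1 + |x|) ^ (-(3/4:ℝ))) := by rw [h2]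
    _ ≤ _ := by gcongr

lemma ZT_decay (hRH : RiemannHypothesis) {η : ℝ} (hη : 0 < η) (hη1 : η ≤ 1/8) :
    ∃ C : ℝ, 0 < C ∧ ∀ U t T : ℝ, 
      (|t| ≤ T → ‖ZZ U t - ZT (gs T) U t‖ ≤ C * (1 + |t|)^η * (1 + |(|t| - T)|) ^ (-(3/4:ℝ))) ∧
      (T ≤ |t| → ‖ZT (gs T) U t‖ ≤ C * (1 + |t|)^η * (1 + |(|t| - T)|) ^ (-(3/4:ℝ))) := by
  obtain ⟨C, hC, h⟩ := wt_bound hRH hη hη1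
  refine ⟨4 * C, by positivity, fun U t T => ?_⟩
  obtain ⟨hs, hb⟩ := h t
  set f : ℝ → ℂ := fun γ => ((mm γ * (2 / (1 + (γ - t)^2)) : ℝ) : ℂ) * Complex.exp (((γ - t : ℝ) : ℂ) * Complex.I * U) with hf
  set d := |(|t| - T)| with hd
  have hfb : ∀ γ, d ≤ |γ - t| → ‖f γ‖ ≤ 4 * (1 + d) ^ (-(3/4:ℝ)) * (mm γ * (1 + |γ - t|) ^ (-(5/4:ℝ))) := by
    intro γ hγ
    simp only [hf]
    rw [norm_mul, norm_exp_I, Complex.norm_real, Real.norm_eq_abs, mul_one, abs_of_nonneg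
      (mul_nonneg (mm_nonneg γ) (by positivity))]
    calc mm γ * (2 / (1 + (γ - t)^2)) ≤ mm γ * (4 * ((1 + |γ - t|) ^ (-(5/4:ℝ)) * (1 + d) ^ (-(3/4:ℝ)))) :=
          mul_le_mul_of_nonneg_left (ker_decay (abs_nonneg _) hγ) (mm_nonneg γ)
      _ = _ := by ring
  have hfs : Summable f := Summable.of_norm_bounded ((line_summable hRH t).mul_left 2) fun γ => (ZZ_term_norm U t γ).le
  have fin : 4 * (1 + d) ^ (-(3/4:ℝ)) * ∑' γ, (mm γ * (1 + |γ - t|) ^ (-(5/4:ℝ))) ≤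
      4 * C * (1 + |t|)^η * (1 + d) ^ (-(3/4:ℝ)) := by
    have : 0 ≤ 4 * (1 + d) ^ (-(3/4:ℝ)) := by positivity
    calc _ ≤ 4 * (1 + d) ^ (-(3/4:ℝ)) * (C * (1 + |t|)^η) := by gcongr
      _ = _ := by ring
  have hnn : ∀ γ, 0 ≤ 4 * (1 + d) ^ (-(3/4:ℝ)) * (mm γ * (1 + |γ - t|) ^ (-(5/4:ℝ))) := fun γ =>
    mul_nonneg (by positivity) (mul_nonneg (mm_nonneg γ) (by positivity))
  constructor
  · intro ht
    have hdd : d = T - |t| := by rw [hd, abs_of_nonpos (by linarith)]; ring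
    have e : ZZ U t - ZT (gs T) U t = ∑' γ, (f γ - if γ ∈ gs T then f γ else 0) := by
      rw [Summable.tsum_sub hfs]
      · rw [tsum_eq_sum (f := fun γ => if γ ∈ gs T then f γ else 0) (s := gs T)]
        · rw [ZZ, ZT]
          congr 1
          refine Finset.sum_congr rfl fun γ hγ => ?_
          rw [if_pos hγ]
        · intro γ hγ; rw [if_neg hγ]
      · refine summable_of_ne_finset_zero (s := gs T) fun γ hγ => ?_
        rw [if_neg hγ]
    rw [e]
    refine le_trans ?_ fin
    rw [← tsum_mul_left]
    refine tsum_of_norm_bounded (hs.mul_left _).hasSum fun γ => ?_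
    split_ifs with hγ
    · rw [sub_self, norm_zero]; exact hnn γ
    · rw [sub_zero]
      by_cases h0 : mm γ = 0
      · have : f γ = 0 := by simp [hf, h0]
        rw [this, norm_zero]; exact hnn γ
      · apply hfb
        rw [mem_gs, zeta_zero_iff, not_and, not_le] at hγ
        have h1 := hγ h0
        have := abs_sub_abs_le_abs_sub γ t
        linarith
  · intro ht
    have hdd : d = |t| - T := by rw [hd, abs_of_nonneg (by linarith)]
    refine le_trans ?_ fin
    rw [← tsum_mul_left]
    refine le_trans ?_ ((hs.mul_left _).sum_le_tsum (gs T) fun γ _ => hnn γ)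
    rw [ZT]
    refine norm_sum_le_of_le _ fun γ hγ => hfb γ ?_
    have h1 := ((mem_gs T γ).1 hγ).2
    have := abs_sub_abs_le_abs_sub t γ
    rw [abs_sub_comm] at this
    linarith

set_option maxHeartbeats 1600000 in
lemma F_vs_S (hRH : RiemannHypothesis) {η : ℝ} (hη : 0 < η) (hη1 : η ≤ 1/8) :
    ∃ C : ℝ, 0 < C ∧ ∀ T U : ℝ, 1 ≤ T → T ≤ Real.exp U → 0 < U →
      ‖zetaPairCorr (Real.exp U) T - (((2 * π)⁻¹ * ∫ t in (-T)..T, ‖SS U t‖^2 : ℝ) : ℂ)‖ ≤ C * T ^ (1/2 + 2 * η) := by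
  obtain ⟨C1, hC1, h1⟩ := ZT_decay hRH hη hη1
  obtain ⟨C2, hC2, h2⟩ := SS_ZZ hRH hη (by linarith)
  obtain ⟨C3, hC3, h3⟩ := SS_bound hRH hη (by linarith)
  obtain ⟨C4, hC4, h4⟩ := line_bound hRH hη (by linarith)
  set K := (C1 + 2 * C2) * (C3 + C1 + C3 + C2) * 1 + C1^2 + (C1 + 2 * C2) * (2 * C3 + C1 + 2 * C2) with hK
  have hK0 : 0 < K := by positivity
  set I0 := ∫ t, wt t with hI0
  have hI00 : 0 ≤ I0 := integral_nonneg fun t => (wt_pos t).le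
  refine ⟨K * (2 * I0) * 2 ^ (1/2 + 2 * η) + 1, by positivity, fun T U hT hTU hU => ?_⟩
  rw [pair_eq, ← Complex.ofReal_sub, Complex.norm_real, ← mul_sub, norm_mul]
  set f := fun t => ‖ZT (gs T) U t‖^2 with hf
  set g := fun t => ‖SS U t‖^2 with hg
  have hgc : Continuous g := by
    have := SS_cont hU.le
    simp only [hg]; fun_prop
  have hfi : Integrable f := (ZT_int (gs T) U).1
  have hgi : IntegrableOn g (Set.Ioc (-T) T) := (hgc.integrableOn_Icc (a := -T) (b := T)).mono_set Set.Ioc_subset_Icc_self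
  set h := fun t => K * (1 + T) ^ (1/2 + 2 * η) * (wt (t - T) + wt (t + T)) with hh
  have hhi : Integrable h := ((wt_int.comp_sub_right T).add (wt_int.comp_add_right T)).const_mul _
  have hT1 : 0 < 1 + T := by linarith
  have hpt : ∀ t, ‖f t - (Set.Ioc (-T) T).indicator g t‖ ≤ h t := by
    intro t
    have hwt := wt_two t T
    set d := |(|t| - T)| with hd
    have hd0 : 0 ≤ d := abs_nonneg _
    have goal1 : ‖f t - (Set.Ioc (-T) T).indicator g t‖ ≤ K * (1 + T) ^ (1/2 + 2 * η) * (1 + d) ^ (-(5/4:ℝ)) := by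
      have split1 : (1 + T) ^ (1/2 + 2 * η) = (1 + T)^(1/2:ℝ) * ((1 + T)^η * (1 + T)^η) := by
        rw [← Real.rpow_add hT1, ← Real.rpow_add hT1]; ring_nf
      have hq1 : 1 ≤ (1 + T)^η := Real.one_le_rpow (by linarith) hη.le
      have hq2 : 1 ≤ (1 + T)^(1/2:ℝ) := Real.one_le_rpow (by linarith) (by norm_num)
      by_cases htm : t ∈ Set.Ioc (-T) T
      · rw [Set.indicator_of_mem htm]
        have ht : |t| ≤ T := abs_le.2 ⟨htm.1.le, htm.2⟩
        have hdd : d = T - |t| := by rw [hd, abs_of_nonpos (by linarith)]; ring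
        have hdT : 1 + d ≤ 1 + T := by linarith [abs_nonneg t]
        have ht2 : (1 + |t|)^η ≤ (1 + T)^η := by gcongr
        have a1 := (h1 U t T).1 ht
        have a2 := h2 U t hU
        have a3 := h3 U t hU
        have d34 : (1 + d) ^ (-(3/4:ℝ)) ≤ (1 + T)^(1/2:ℝ) * (1 + d) ^ (-(5/4:ℝ)) := by
          have : (1 + d) ^ (-(3/4:ℝ)) = (1 + d)^(1/2:ℝ) * (1 + d) ^ (-(5/4:ℝ)) := by
            rw [← Real.rpow_add (by linarith)]; norm_num
          rw [this]; gcongr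
        have d34' : (1 + d) ^ (-(3/4:ℝ)) ≤ 1 := Real.rpow_le_one_of_one_le_of_nonpos (by linarith) (by norm_num)
        have hE1 : Real.exp (-U) ≤ 2 * (1 + T)⁻¹ := by
          rw [Real.exp_neg]
          calc (Real.exp U)⁻¹ ≤ T⁻¹ := by gcongr
            _ ≤ 2 * (1 + T)⁻¹ := by
              rw [← div_eq_mul_inv, inv_eq_one_div, div_le_div_iff₀ (by linarith) hT1]; linarith
        have hE2 : (1 + T)⁻¹ ≤ (1 + T)^(1/2:ℝ) * (1 + d) ^ (-(5/4:ℝ)) := by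
          have : (1 + T) ^ (-(5/4:ℝ)) ≤ (1 + d) ^ (-(5/4:ℝ)) :=
            Real.rpow_le_rpow_of_nonpos (by linarith) hdT (by norm_num)
          calc (1 + T)⁻¹ = (1 + T)^(-1:ℝ) := (Real.rpow_neg_one _).symm
            _ ≤ (1 + T)^(-(3/4):ℝ) := Real.rpow_le_rpow_of_exponent_le (by linarith) (by norm_num)
            _ = (1 + T)^(1/2:ℝ) * (1 + T) ^ (-(5/4:ℝ)) := by rw [← Real.rpow_add hT1]; norm_num
            _ ≤ _ := by gcongr
        have hE1' : Real.exp (-U) ≤ 1 := Real.exp_le_one_iff.2 (by linarith)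
        set w := (1 + T)^(1/2:ℝ) * (1 + d) ^ (-(5/4:ℝ)) with hw
        have hw0 : 0 ≤ w := by positivity
        set q := (1 + T)^η with hqdef
        have s1 : ‖ZT (gs T) U t + SS U t‖ ≤ (C1 + 2 * C2) * q * w := by
          have : ZT (gs T) U t + SS U t = (SS U t + ZZ U t) - (ZZ U t - ZT (gs T) U t) := by ring
          rw [this]
          refine (norm_sub_le _ _).trans ?_
          have b1 : ‖SS U t + ZZ U t‖ ≤ C2 * q * (2 * w) := by
            refine a2.trans ?_
            gcongr
            linarith
          have b2 : ‖ZZ U t - ZT (gs T) U t‖ ≤ C1 * q * w := by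
            refine a1.trans ?_
            gcongr
          linarith
        have s1' : ‖ZT (gs T) U t + SS U t‖ ≤ (C1 + 2 * C2) * q := by
          have : ZT (gs T) U t + SS U t = (SS U t + ZZ U t) - (ZZ U t - ZT (gs T) U t) := by ring
          rw [this]
          refine (norm_sub_le _ _).trans ?_
          have b1 : ‖SS U t + ZZ U t‖ ≤ C2 * q * 1 := by
            refine a2.trans ?_
            gcongr
          have b2 : ‖ZZ U t - ZT (gs T) U t‖ ≤ C1 * q * 1 := by
            refine a1.trans ?_
            gcongr
          nlinarith [mul_nonneg hC2.le (by linarith : 0 ≤ q)]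
        have s2 : ‖SS U t‖ ≤ C3 * q := a3.trans (by gcongr)
        have s3 : ‖ZT (gs T) U t‖ ≤ (C3 + C1 + 2 * C2) * q := by
          have : ZT (gs T) U t = (ZT (gs T) U t + SS U t) - SS U t := by ring
          rw [this]
          refine (norm_sub_le _ _).trans ?_
          linarith
        have s4 : |‖ZT (gs T) U t‖ - ‖SS U t‖| ≤ ‖ZT (gs T) U t + SS U t‖ := by
          have := abs_norm_sub_norm_le (ZT (gs T) U t) (-SS U t)
          rwa [norm_neg, sub_neg_eq_add] at this
        simp only [hf, hg]
        rw [Real.norm_eq_abs, sq_sub_sq, abs_mul, abs_of_nonneg (by positivity : 0 ≤ ‖ZT (gs T) U t‖ + ‖SS U t‖)]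
        calc (‖ZT (gs T) U t‖ + ‖SS U t‖) * |‖ZT (gs T) U t‖ - ‖SS U t‖|
            ≤ ((C3 + C1 + 2 * C2) * q + C3 * q) * ((C1 + 2 * C2) * q * w) := by
              gcongr
              exact s4.trans s1
          _ = ((C1 + 2 * C2) * (2 * C3 + C1 + 2 * C2)) * (q * q * w) := by ring
          _ ≤ K * (q * q * w) := by
              gcongr
              rw [hK]
              have : 0 ≤ (C1 + 2 * C2) * (C3 + C1 + C3 + C2) * 1 + C1^2 := by positivity
              linarith
          _ = _ := by rw [split1, hw]; ring
      · rw [Set.indicator_of_notMem htm, sub_zero]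
        have ht : T ≤ |t| := by
          by_contra hlt
          push Not at hlt
          rw [abs_lt] at hlt
          exact htm ⟨hlt.1, hlt.2.le⟩
        have hdd : d = |t| - T := by rw [hd, abs_of_nonneg (by linarith)]
        have a1 := (h1 U t T).2 ht
        have e1 : (1 + |t|)^η ≤ (1 + T)^η * (1 + d)^η := by
          rw [← Real.mul_rpow (by linarith) (by linarith)]
          gcongr
          rw [hdd]; nlinarith
        have e2 : (1 + d)^η * (1 + d)^η * ((1 + d) ^ (-(3/4:ℝ)) * (1 + d) ^ (-(3/4:ℝ))) ≤ (1 + d) ^ (-(5/4:ℝ)) := by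
          rw [← Real.rpow_add (by linarith), ← Real.rpow_add (by linarith), ← Real.rpow_add (by linarith)]
          apply Real.rpow_le_rpow_of_exponent_le (by linarith)
          linarith
        simp only [hf]
        rw [Real.norm_eq_abs, abs_of_nonneg (by positivity)]
        calc ‖ZT (gs T) U t‖^2 ≤ (C1 * ((1 + T)^η * (1 + d)^η) * (1 + d) ^ (-(3/4:ℝ)))^2 := by
              gcongr
              refine a1.trans ?_
              gcongr
          _ = C1^2 * ((1 + T)^η * (1 + T)^η) * ((1 + d)^η * (1 + d)^η * ((1 + d) ^ (-(3/4:ℝ)) * (1 + d) ^ (-(3/4:ℝ)))) := by ring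
          _ ≤ C1^2 * ((1 + T)^η * (1 + T)^η) * (1 + d) ^ (-(5/4:ℝ)) := by gcongr
          _ ≤ K * (1 + T) ^ (1/2 + 2 * η) * (1 + d) ^ (-(5/4:ℝ)) := by
              rw [split1]
              have k1 : C1^2 ≤ K := by
                rw [hK]
                have : 0 ≤ (C1 + 2 * C2) * (C3 + C1 + C3 + C2) * 1 + (C1 + 2 * C2) * (2 * C3 + C1 + 2 * C2) := by positivity
                linarith
              have k2 : (1 + T)^η * (1 + T)^η ≤ (1 + T)^(1/2:ℝ) * ((1 + T)^η * (1 + T)^η) :=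
                le_mul_of_one_le_left (by positivity) hq2
              exact mul_le_mul_of_nonneg_right (mul_le_mul k1 k2 (by positivity) hK0.le) (by positivity)
    refine goal1.trans ?_
    simp only [hh]
    gcongr
  have hind : ∫ t in (-T)..T, g t = ∫ t, (Set.Ioc (-T) T).indicator g t := by
    rw [intervalIntegral.integral_of_le (by linarith), integral_indicator measurableSet_Ioc]
  have main : ‖(∫ t, f t) - ∫ t in (-T)..T, g t‖ ≤ K * (1 + T) ^ (1/2 + 2 * η) * (2 * I0) := by
    rw [hind, ← integral_sub hfi ((integrable_indicator_iff measurableSet_Ioc).2 hgi)]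
    refine (norm_integral_le_of_norm_le hhi (Eventually.of_forall hpt)).trans ?_
    simp only [hh]
    rw [integral_const_mul, integral_add (wt_int.comp_sub_right T) (wt_int.comp_add_right T),
      integral_sub_right_eq_self wt, integral_add_right_eq_self wt, ← two_mul]
  have hpi : ‖(2 * π)⁻¹‖ ≤ 1 := by
    rw [Real.norm_eq_abs, abs_of_pos (by positivity)]
    apply inv_le_one_of_one_le₀
    linarith [Real.pi_gt_three]
  have hT2 : (1 + T) ^ (1/2 + 2 * η) ≤ 2 ^ (1/2 + 2 * η) * T ^ (1/2 + 2 * η) := by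
    rw [← Real.mul_rpow (by norm_num) (by linarith)]
    gcongr
    linarith
  calc _ ≤ 1 * (K * (1 + T) ^ (1/2 + 2 * η) * (2 * I0)) := by gcongr
    _ ≤ 1 * (K * (2 ^ (1/2 + 2 * η) * T ^ (1/2 + 2 * η)) * (2 * I0)) := by gcongr
    _ ≤ _ := by
      have : 0 ≤ T ^ (1/2 + 2 * η) := by positivity
      nlinarith

end B1

namespace B1
open Filter Topology Metric

noncomputable def hker (κ u v : ℝ) : ℝ := if u < v ∧ v ≤ u + κ then 1 else 0

noncomputable def hh (M : Measure ℝ) (σ : ℝ → ℝ) (κ u : ℝ) : ℝ := ∫ v, hker κ u v * σ v ∂M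

noncomputable def WW (M : Measure ℝ) (σ : ℝ → ℝ) (κ : ℝ) : ℝ := ∫ u, (hh M σ κ u)^2

lemma hker_nonneg (κ u v : ℝ) : 0 ≤ hker κ u v := by unfold hker; split_ifs <;> norm_num
lemma hker_le (κ u v : ℝ) : hker κ u v ≤ 1 := by unfold hker; split_ifs <;> norm_num
lemma hker_abs (κ u v : ℝ) : |hker κ u v| ≤ 1 := by
  rw [abs_of_nonneg (hker_nonneg _ _ _)]; exact hker_le _ _ _

lemma hker_meas {α : Type*} [MeasurableSpace α] {a b c : α → ℝ} (ha : Measurable a) (hb : Measurable b)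
    (hc : Measurable c) : Measurable fun x => hker (a x) (b x) (c x) := by
  unfold hker
  refine Measurable.ite ?_ measurable_const measurable_const
  exact (measurableSet_lt hb hc).inter (measurableSet_le hc (hb.add ha))

lemma hker_mul (κ v v' : ℝ) : (fun u => hker κ u v * hker κ u v') =
    (Set.Ico (max (v - κ) (v' - κ)) (min v v')).indicator (fun _ => (1:ℝ)) := by
  ext u
  unfold hker
  by_cases h : u ∈ Set.Ico (max (v - κ) (v' - κ)) (min v v')
  · rw [Set.indicator_of_mem h]
    rw [Set.mem_Ico, max_le_iff, lt_min_iff] at h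
    rw [if_pos ⟨h.2.1, by linarith [h.1.1]⟩, if_pos ⟨h.2.2, by linarith [h.1.2]⟩, mul_one]
  · rw [Set.indicator_of_notMem h]
    rw [Set.mem_Ico, max_le_iff, lt_min_iff] at h
    by_cases h1 : u < v ∧ v ≤ u + κ
    · have h2 : ¬ (u < v' ∧ v' ≤ u + κ) := by
        intro h2
        exact h ⟨⟨by linarith [h1.2], by linarith [h2.2]⟩, h1.1, h2.1⟩
      rw [if_neg h2, mul_zero]
    · rw [if_neg h1, zero_mul]

lemma len_eq (κ v v' : ℝ) : min v v' - max (v - κ) (v' - κ) = κ - |v - v'| := by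
  rcases le_total v v' with h | h
  · rw [min_eq_left h, max_eq_right (by linarith), abs_of_nonpos (by linarith)]; ring
  · rw [min_eq_right h, max_eq_left (by linarith), abs_of_nonneg (by linarith)]; ring

lemma hker_mul_int (κ v v' : ℝ) : Integrable (fun u => hker κ u v * hker κ u v') ∧
    ∫ u, hker κ u v * hker κ u v' = max (κ - |v - v'|) 0 := by
  rw [hker_mul]
  constructor
  · rw [integrable_indicator_iff measurableSet_Ico]
    simp [integrableOn_const_iff]
  · rw [integral_indicator measurableSet_Ico, setIntegral_const, Measure.real, Real.volume_Ico, len_eq,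
      ENNReal.toReal_ofReal']
    simp

section gen
variable (M : Measure ℝ) [IsFiniteMeasure M] {σ : ℝ → ℝ}

lemma sig_int {f : ℝ → ℝ} (hσ : Measurable σ) (h1 : ∀ v, |σ v| ≤ 1) (hf : Measurable f) {B : ℝ} (hB : ∀ v, |f v| ≤ B) :
    Integrable (fun v => f v * σ v) M := by
  refine Integrable.mono' (integrable_const B) (hf.mul hσ).aestronglyMeasurable (Eventually.of_forall fun v => ?_)
  rw [Real.norm_eq_abs, abs_mul]
  have := mul_le_mul (hB v) (h1 v) (abs_nonneg _) ((abs_nonneg _).trans (hB v))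
  linarith

lemma sig2_le (h1 : ∀ v, |σ v| ≤ 1) (p : ℝ × ℝ) : |σ p.1 * σ p.2| ≤ 1 := by
  rw [abs_mul]
  have := mul_le_mul (h1 p.1) (h1 p.2) (abs_nonneg _) zero_le_one
  linarith

lemma sig2_int {f : ℝ × ℝ → ℝ} (hσ : Measurable σ) (h1 : ∀ v, |σ v| ≤ 1) (hf : Measurable f) {B : ℝ} (hB : ∀ p, |f p| ≤ B) :
    Integrable (fun p : ℝ × ℝ => f p * (σ p.1 * σ p.2)) (M.prod M) := by
  refine Integrable.mono' (integrable_const B) (by fun_prop) (Eventually.of_forall fun v => ?_)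
  rw [Real.norm_eq_abs, abs_mul]
  have := mul_le_mul (hB v) (sig2_le h1 v) (abs_nonneg _) ((abs_nonneg _).trans (hB v))
  linarith

lemma hh_sq (hσ : Measurable σ) (h1 : ∀ v, |σ v| ≤ 1) (κ u : ℝ) :
    (hh M σ κ u)^2 = ∫ p : ℝ × ℝ, hker κ u p.1 * hker κ u p.2 * (σ p.1 * σ p.2) ∂(M.prod M) := by
  rw [hh, sq, ← integral_prod_mul]
  congr 1; ext p; ring

lemma W_aux (hσ : Measurable σ) (h1 : ∀ v, |σ v| ≤ 1) {κ : ℝ} (hκ : 0 ≤ κ) :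
    Integrable (fun q : (ℝ × ℝ) × ℝ => hker κ q.2 q.1.1 * hker κ q.2 q.1.2 * (σ q.1.1 * σ q.1.2)) ((M.prod M).prod volume) := by
  have hm : Measurable (fun q : (ℝ × ℝ) × ℝ => hker κ q.2 q.1.1 * hker κ q.2 q.1.2 * (σ q.1.1 * σ q.1.2)) := by
    have a1 : Measurable (fun q : (ℝ × ℝ) × ℝ => hker κ q.2 q.1.1) := hker_meas measurable_const (by fun_prop) (by fun_prop)
    have a2 : Measurable (fun q : (ℝ × ℝ) × ℝ => hker κ q.2 q.1.2) := hker_meas measurable_const (by fun_prop) (by fun_prop)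
    fun_prop
  rw [integrable_prod_iff hm.aestronglyMeasurable]
  constructor
  · refine Eventually.of_forall fun p => ?_
    exact (hker_mul_int κ p.1 p.2).1.mul_const (σ p.1 * σ p.2)
  · refine Integrable.mono' (integrable_const κ) ?_ (Eventually.of_forall fun p => ?_)
    · exact (hm.norm.stronglyMeasurable.integral_prod_right').aestronglyMeasurable
    · rw [Real.norm_eq_abs, abs_of_nonneg (integral_nonneg fun u => norm_nonneg _)]
      calc _ ≤ ∫ u, hker κ u p.1 * hker κ u p.2 := by
            refine integral_mono ((hker_mul_int κ p.1 p.2).1.mul_const (σ p.1 * σ p.2)).norm (hker_mul_int κ p.1 p.2).1 fun u => ?_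
            beta_reduce
            have h0 := mul_nonneg (hker_nonneg κ u p.1) (hker_nonneg κ u p.2)
            rw [norm_mul, Real.norm_of_nonneg h0]
            exact mul_le_of_le_one_right h0 (sig2_le h1 p)
        _ ≤ κ := by
            rw [(hker_mul_int κ p.1 p.2).2]
            exact max_le (by linarith [abs_nonneg (p.1 - p.2)]) hκ

lemma hh_sq_int (hσ : Measurable σ) (h1 : ∀ v, |σ v| ≤ 1) {κ : ℝ} (hκ : 0 ≤ κ) : Integrable (fun u => (hh M σ κ u)^2) := by
  have := (W_aux M hσ h1 hκ).integral_prod_right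
  refine this.congr (Eventually.of_forall fun u => ?_)
  exact (hh_sq M hσ h1 κ u).symm

lemma W_eq (hσ : Measurable σ) (h1 : ∀ v, |σ v| ≤ 1) {κ : ℝ} (hκ : 0 ≤ κ) :
    WW M σ κ = ∫ p : ℝ × ℝ, max (κ - |p.1 - p.2|) 0 * (σ p.1 * σ p.2) ∂(M.prod M) := by
  unfold WW
  simp_rw [hh_sq M hσ h1]
  have sw := integral_integral_swap (f := fun (p : ℝ × ℝ) u => hker κ u p.1 * hker κ u p.2 * (σ p.1 * σ p.2)) (μ := M.prod M) (ν := volume) (W_aux M hσ h1 hκ)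
  rw [← sw]
  congr 1; ext p
  rw [integral_mul_const, (hker_mul_int κ p.1 p.2).2]

lemma max_int (hσ : Measurable σ) (h1 : ∀ v, |σ v| ≤ 1) {κ : ℝ} (hκ : 0 ≤ κ) :
    Integrable (fun p : ℝ × ℝ => max (κ - |p.1 - p.2|) 0 * (σ p.1 * σ p.2)) (M.prod M) := by
  refine sig2_int M hσ h1 (by fun_prop) (B := κ) fun p => ?_
  rw [abs_of_nonneg (le_max_right _ _)]
  exact max_le (by linarith [abs_nonneg (p.1 - p.2)]) hκ

lemma W_nonneg (κ : ℝ) : 0 ≤ WW M σ κ := integral_nonneg fun u => sq_nonneg _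

lemma W_lip (hσ : Measurable σ) (h1 : ∀ v, |σ v| ≤ 1) {κ κ' : ℝ} (hκ : 0 ≤ κ) (hκ' : 0 ≤ κ') :
    |WW M σ κ - WW M σ κ'| ≤ |κ - κ'| * (M.prod M).real Set.univ := by
  rw [W_eq M hσ h1 hκ, W_eq M hσ h1 hκ', ← integral_sub (max_int M hσ h1 hκ) (max_int M hσ h1 hκ')]
  rw [← Real.norm_eq_abs]
  refine norm_integral_le_of_norm_le_const (μ := M.prod M) (Eventually.of_forall fun p => ?_)
  rw [← sub_mul, norm_mul, Real.norm_eq_abs, Real.norm_eq_abs]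
  have a := abs_max_sub_max_le_abs (κ - |p.1 - p.2|) (κ' - |p.1 - p.2|) 0
  rw [sub_sub_sub_cancel_right] at a
  have := mul_le_mul a (sig2_le h1 p) (abs_nonneg _) (abs_nonneg _)
  linarith

lemma W_zero (hσ : Measurable σ) (h1 : ∀ v, |σ v| ≤ 1) : WW M σ 0 = 0 := by
  have : ∀ u, hh M σ 0 u = 0 := by
    intro u
    unfold hh hker
    have : ∀ v, ¬ (u < v ∧ v ≤ u + 0) := by intro v h; linarith [h.1, h.2]
    simp only [this, if_false, zero_mul, integral_zero]
  simp [WW, this]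

lemma W_le (hσ : Measurable σ) (h1 : ∀ v, |σ v| ≤ 1) {κ : ℝ} (hκ : 0 ≤ κ) : WW M σ κ ≤ κ * (M.real Set.univ)^2 := by
  have := W_lip M hσ h1 hκ le_rfl
  rw [W_zero M hσ h1, sub_zero, sub_zero, abs_of_nonneg (W_nonneg M κ), abs_of_nonneg hκ] at this
  refine this.trans (le_of_eq ?_)
  rw [← Set.univ_prod_univ, measureReal_prod_prod, sq]

lemma W_cont (hσ : Measurable σ) (h1 : ∀ v, |σ v| ≤ 1) : ContinuousOn (WW M σ) (Set.Ici 0) := by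
  have : LipschitzOnWith ((M.prod M).real Set.univ).toNNReal (WW M σ) (Set.Ici 0) := by
    refine LipschitzOnWith.of_dist_le_mul fun x hx y hy => ?_
    rw [Real.dist_eq, Real.dist_eq, Real.coe_toNNReal _ measureReal_nonneg, mul_comm]
    exact W_lip M hσ h1 hx hy
  exact this.continuousOn

lemma hker_sig_int (hσ : Measurable σ) (h1 : ∀ v, |σ v| ≤ 1) (κ u : ℝ) : Integrable (fun v => hker κ u v * σ v) M :=
  sig_int M hσ h1 (f := fun v => hker κ u v) (hker_meas measurable_const measurable_const measurable_id) (hker_abs _ _)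

lemma hh_split (hσ : Measurable σ) (h1 : ∀ v, |σ v| ≤ 1) {a b : ℝ} (ha : 0 ≤ a) (hb : 0 ≤ b) (u : ℝ) :
    hh M σ (a + b) u = hh M σ a u + hh M σ b (u + a) := by
  unfold hh
  rw [← integral_add (hker_sig_int M hσ h1 a u) (hker_sig_int M hσ h1 b (u + a))]
  congr 1; ext v
  rw [← add_mul]
  congr 1
  unfold hker
  by_cases h2 : v ≤ u + a
  · by_cases h3 : u < v
    · rw [if_pos ⟨h3, by linarith⟩, if_pos ⟨h3, h2⟩, if_neg (by intro h; linarith [h.1])]; ring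
    · rw [if_neg (by tauto), if_neg (by tauto), if_neg (by intro h; linarith [h.1])]; ring
  · push Not at h2
    by_cases h3 : v ≤ u + a + b
    · rw [if_pos ⟨by linarith, by linarith⟩, if_neg (by intro h; linarith [h.2]), if_pos ⟨h2, h3⟩]; ring
    · rw [if_neg (by intro h; exact h3 (by linarith [h.2])), if_neg (by intro h; linarith [h.2]), if_neg (by tauto)]; ring

lemma W_sub (hσ : Measurable σ) (h1 : ∀ v, |σ v| ≤ 1) {a b : ℝ} (ha : 0 ≤ a) (hb : 0 ≤ b) :
    WW M σ (a + b) ≤ 2 * WW M σ a + 2 * WW M σ b := by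
  have i1 := hh_sq_int M hσ h1 ha
  have i2 := hh_sq_int M hσ h1 hb
  have i3 := hh_sq_int M hσ h1 (add_nonneg ha hb)
  have e2 : WW M σ b = ∫ u, (hh M σ b (u + a))^2 := (integral_add_right_eq_self (fun u => (hh M σ b u)^2) a).symm
  rw [e2]
  unfold WW
  rw [← integral_const_mul, ← integral_const_mul, ← integral_add (i1.const_mul 2) ((i2.comp_add_right a).const_mul 2)]
  refine integral_mono i3 ((i1.const_mul 2).add ((i2.comp_add_right a).const_mul 2)) fun u => ?_
  beta_reduce
  rw [hh_split M hσ h1 ha hb]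
  nlinarith [sq_nonneg (hh M σ a u - hh M σ b (u + a))]

end gen
end B1

namespace B1
open Filter Topology Metric

lemma laplace_int (w : ℝ) : Integrable (fun x : ℝ => Complex.exp ((-2 * π * (x * w) : ℝ) * Complex.I) * (Real.exp (-|x|) : ℂ)) ∧
    ∫ x : ℝ, Complex.exp ((-2 * π * (x * w) : ℝ) * Complex.I) * (Real.exp (-|x|) : ℂ) = 2 / (1 + (2 * π * w)^2) := by
  set a : ℂ := 1 - 2 * π * w * Complex.I with ha
  set b : ℂ := -1 - 2 * π * w * Complex.I with hb
  have har : 0 < a.re := by simp [ha]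
  have hbr : b.re < 0 := by simp [hb]
  have e1 : Set.EqOn (fun x : ℝ => Complex.exp ((-2 * π * (x * w) : ℝ) * Complex.I) * (Real.exp (-|x|) : ℂ)) (fun x => Complex.exp (a * x)) (Set.Iic 0) := by
    intro x hx
    simp only
    rw [abs_of_nonpos hx, Complex.ofReal_exp, ← Complex.exp_add]
    congr 1
    rw [ha]; push_cast; ring
  have e2 : Set.EqOn (fun x : ℝ => Complex.exp ((-2 * π * (x * w) : ℝ) * Complex.I) * (Real.exp (-|x|) : ℂ)) (fun x => Complex.exp (b * x)) (Set.Ioi 0) := by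
    intro x hx
    simp only
    rw [abs_of_pos hx, Complex.ofReal_exp, ← Complex.exp_add]
    congr 1
    rw [hb]; push_cast; ring
  have i1 := (integrableOn_exp_mul_complex_Iic har 0).congr_fun e1.symm measurableSet_Iic
  have i2 := (integrableOn_exp_mul_complex_Ioi hbr 0).congr_fun e2.symm measurableSet_Ioi
  refine ⟨?_, ?_⟩
  · rw [← integrableOn_univ, ← Set.Iic_union_Ioi (a := (0:ℝ))]
    exact i1.union i2
  · rw [← intervalIntegral.integral_Iic_add_Ioi i1 i2, setIntegral_congr_fun measurableSet_Iic e1,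
      setIntegral_congr_fun measurableSet_Ioi e2, integral_exp_mul_complex_Iic har, integral_exp_mul_complex_Ioi hbr]
    have ha0 : a ≠ 0 := by intro h; rw [h] at har; simp at har
    have hb0 : b ≠ 0 := by intro h; rw [h] at hbr; simp at hbr
    have hab : a * -b = 1 + (2 * π * w)^2 := by
      rw [ha, hb]; ring_nf; rw [Complex.I_sq]; ring
    rw [← hab]
    simp only [Complex.ofReal_zero, mul_zero, Complex.exp_zero]
    field_simp
    rw [ha, hb]; ring

lemma cauchy_ft_c (y : ℝ) : ∫ s : ℝ, Complex.exp ((s * y : ℝ) * Complex.I) * ((1 + s^2 : ℝ) : ℂ)⁻¹ = (π * Real.exp (-|y|) : ℝ) := by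
  set f : ℝ → ℂ := fun x => (Real.exp (-|x|) : ℂ) with hf
  have hfc : Continuous f := by simp only [hf]; fun_prop
  have hfi : Integrable f := by
    have := (laplace_int 0).1
    simpa [hf] using this
  have hF : FourierTransform.fourier f = fun w : ℝ => (2:ℂ) / (1 + (2 * π * w)^2) := by
    ext w
    rw [Real.fourier_eq', ← (laplace_int w).2]
    congr 1; ext x
    simp [hf, mul_comm]
  have hFi : Integrable (FourierTransform.fourier f) := by
    rw [hF]
    have := ((integrable_inv_one_add_sq.comp_mul_left' (R := 2 * π) (by positivity)).const_mul 2).ofReal (𝕜 := ℂ)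
    refine this.congr (Eventually.of_forall fun w => ?_)
    simp [div_eq_mul_inv]
  have key := congrFun (hfc.fourierInv_fourier_eq hfi hFi) y
  rw [Real.fourierInv_eq', hF] at key
  have sub := Measure.integral_comp_mul_left (fun s : ℝ => Complex.exp ((s * y : ℝ) * Complex.I) * ((1 + s^2 : ℝ) : ℂ)⁻¹) (2 * π)
  have e : ∫ w : ℝ, Complex.exp ((2 * π * w * y : ℝ) * Complex.I) * ((1 + (2 * π * w)^2 : ℝ) : ℂ)⁻¹ = f y / 2 := by
    rw [← key, ← integral_div]
    congr 1; ext w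
    simp only [RCLike.inner_apply, conj_trivial, smul_eq_mul]
    push_cast
    rw [show (2 * π * (y * w) * Complex.I : ℂ) = 2 * π * w * y * Complex.I by ring]
    ring
  rw [e] at sub
  rw [abs_of_pos (by positivity), Complex.real_smul] at sub
  have hp : ((2 * π : ℝ) : ℂ) ≠ 0 := by exact_mod_cast (by positivity : (2 * π) ≠ 0)
  have : ∫ s : ℝ, Complex.exp ((s * y : ℝ) * Complex.I) * ((1 + s^2 : ℝ) : ℂ)⁻¹ = (2 * π : ℝ) * (f y / 2) := by
    rw [sub, Complex.ofReal_inv, mul_inv_cancel_left₀ hp]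
  rw [this]; simp only [hf]; push_cast; ring

lemma cauchy_ft (y : ℝ) : ∫ s : ℝ, Real.cos (s * y) * (1 + s^2)⁻¹ = π * Real.exp (-|y|) := by
  have h := congrArg Complex.re (cauchy_ft_c y)
  rw [Complex.ofReal_re] at h
  rw [← h, ← RCLike.re_eq_complex_re, ← integral_re]
  · congr 1; ext s
    rw [RCLike.re_eq_complex_re, ← Complex.ofReal_inv, Complex.re_mul_ofReal, Complex.exp_ofReal_mul_I_re]
  · refine Integrable.mono' integrable_inv_one_add_sq (by fun_prop) (Eventually.of_forall fun s => ?_)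
    rw [norm_mul, Complex.norm_exp_ofReal_mul_I, ← Complex.ofReal_inv, Complex.norm_real, one_mul, Real.norm_of_nonneg (by positivity)]

lemma cauchy_sin (y : ℝ) : ∫ s : ℝ, Real.sin (s * y) * (1 + s^2)⁻¹ = 0 := by
  have h := integral_neg_eq_self (fun s : ℝ => Real.sin (s * y) * (1 + s^2)⁻¹) volume
  have : ∀ s : ℝ, Real.sin (-s * y) * (1 + (-s)^2)⁻¹ = -(Real.sin (s * y) * (1 + s^2)⁻¹) := by
    intro s; rw [neg_mul, Real.sin_neg, neg_sq]; ring
  simp_rw [this] at h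
  rw [integral_neg] at h
  linarith

lemma cs_int {f : ℝ → ℝ} (hf : Continuous f) (h1 : ∀ s, |f s| ≤ 1) : Integrable (fun s : ℝ => f s * (1 + s^2)⁻¹) := by
  refine Integrable.mono' integrable_inv_one_add_sq ?_ (Eventually.of_forall fun s => ?_)
  · exact (hf.mul (Continuous.inv₀ (by fun_prop) fun s => by positivity)).aestronglyMeasurable
  · rw [Real.norm_eq_abs, abs_mul, abs_of_nonneg (by positivity : 0 ≤ (1 + s^2)⁻¹)]
    exact mul_le_of_le_one_left (by positivity) (h1 s)

lemma cauchy_shift {H τ y : ℝ} (hH : 0 ≤ H) :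
    ∫ s : ℝ, Real.cos ((τ + H * s) * y) * (1 + s^2)⁻¹ = π * (Real.cos (τ * y) * Real.exp (-(H * |y|))) := by
  have e : ∀ s : ℝ, Real.cos ((τ + H * s) * y) * (1 + s^2)⁻¹ =
      Real.cos (τ * y) * (Real.cos (s * (H * y)) * (1 + s^2)⁻¹) - Real.sin (τ * y) * (Real.sin (s * (H * y)) * (1 + s^2)⁻¹) := by
    intro s
    rw [show (τ + H * s) * y = τ * y + s * (H * y) by ring, Real.cos_add]; ring
  simp_rw [e]
  rw [integral_sub, integral_const_mul, integral_const_mul, cauchy_ft, cauchy_sin, abs_mul, abs_of_nonneg hH]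
  · ring
  · exact (cs_int (f := fun s => Real.cos (s * (H * y))) (by fun_prop) fun s => Real.abs_cos_le_one _).const_mul _
  · exact (cs_int (f := fun s => Real.sin (s * (H * y))) (by fun_prop) fun s => Real.abs_sin_le_one _).const_mul _

end B1

namespace B1
open Filter Topology Metric

lemma lin_exp_int {H : ℝ} (hH : 0 < H) : IntegrableOn (fun κ : ℝ => κ * Real.exp (-H * κ)) (Set.Ioi 0) := by
  have := Real.GammaIntegral_convergent (s := 2) (by norm_num)
  have h2 := (integrableOn_Ioi_comp_mul_left_iff (fun x => Real.exp (-x) * x ^ ((2:ℝ) - 1)) 0 hH).2 (by simpa using this)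
  refine IntegrableOn.congr_fun (Integrable.const_mul h2 H⁻¹) ?_ measurableSet_Ioi
  intro x hx
  simp only
  rw [show (2:ℝ) - 1 = 1 by norm_num, Real.rpow_one, neg_mul]
  field_simp

lemma zexp_norm (z : ℂ) (κ : ℝ) : ‖Complex.exp (-z * κ)‖ = Real.exp (-z.re * κ) := by
  rw [norm_exp_mul]; simp

lemma ramp_int {z : ℂ} (hz : 0 < z.re) {y : ℝ} (hy : 0 ≤ y) :
    IntegrableOn (fun κ : ℝ => Complex.exp (-z * κ) * (max (κ - y) 0 : ℝ)) (Set.Ioi 0) := by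
  refine Integrable.mono' (lin_exp_int hz) (by fun_prop) ((ae_restrict_iff' measurableSet_Ioi).2 (Eventually.of_forall fun κ hκ => ?_))
  have hκ' : 0 < κ := hκ
  rw [norm_mul, zexp_norm, Complex.norm_real, Real.norm_of_nonneg (le_max_right _ _), mul_comm]
  gcongr
  exact max_le (by linarith) hκ'.le

lemma ramp {z : ℂ} (hz : 0 < z.re) {y : ℝ} (hy : 0 ≤ y) :
    z^2 * ∫ κ in Set.Ioi (0:ℝ), Complex.exp (-z * κ) * (max (κ - y) 0 : ℝ) = Complex.exp (-z * y) := by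
  have hz0 : z ≠ 0 := by rintro rfl; simp at hz
  have hintg := ramp_int hz hy
  have hsplit : ∫ κ in Set.Ioi (0:ℝ), Complex.exp (-z * κ) * (max (κ - y) 0 : ℝ) = ∫ κ in Set.Ioi y, Complex.exp (-z * κ) * (κ - y) := by
    rw [← integral_indicator measurableSet_Ioi, ← integral_indicator measurableSet_Ioi]
    congr 1; ext κ
    by_cases h : y < κ
    · rw [Set.indicator_of_mem (show κ ∈ Set.Ioi 0 from lt_of_le_of_lt hy h), Set.indicator_of_mem (show κ ∈ Set.Ioi y from h), max_eq_left (by linarith)]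
      push_cast; rfl
    · rw [Set.indicator_of_notMem (show κ ∉ Set.Ioi y from h)]
      by_cases h0 : 0 < κ
      · rw [Set.indicator_of_mem (show κ ∈ Set.Ioi 0 from h0), max_eq_right (by linarith)]; simp
      · rw [Set.indicator_of_notMem (show κ ∉ Set.Ioi 0 from h0)]
  have hint2 : IntegrableOn (fun κ : ℝ => Complex.exp (-z * κ) * (κ - y)) (Set.Ioi y) := by
    refine IntegrableOn.congr_fun (hintg.mono_set (Set.Ioi_subset_Ioi hy)) ?_ measurableSet_Ioi
    intro κ hκ
    have : y < κ := hκ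
    simp only
    rw [max_eq_left (by linarith)]; push_cast; rfl
  have hlim1 : Tendsto (fun κ : ℝ => κ * Real.exp (-z.re * κ)) atTop (𝓝 0) := by
    have := (Real.tendsto_pow_mul_exp_neg_atTop_nhds_zero 1).comp (tendsto_id.const_mul_atTop hz)
    have h2 := this.const_mul (z.re)⁻¹
    rw [mul_zero] at h2
    refine h2.congr fun κ => ?_
    simp only [Function.comp, id, pow_one, neg_mul]
    field_simp
  have hlim2 : Tendsto (fun κ : ℝ => Real.exp (-z.re * κ)) atTop (𝓝 0) := by
    have := Real.tendsto_exp_neg_atTop_nhds_zero.comp (tendsto_id.const_mul_atTop hz)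
    refine this.congr fun κ => ?_
    simp
  have F := integral_Ioi_of_hasDerivAt_of_tendsto' (a := y) (m := 0)
    (f := fun κ : ℝ => -(Complex.exp (-z * κ) * ((κ - y) / z + 1 / z^2))) (f' := fun κ : ℝ => Complex.exp (-z * κ) * (κ - y)) ?_ hint2 ?_
  · rw [hsplit, F]; simp; field_simp
  · intro κ _
    have h1 : HasDerivAt (fun κ : ℝ => (κ : ℂ)) 1 κ := Complex.ofRealCLM.hasDerivAt
    have := ((h1.const_mul (-z)).cexp.mul (((h1.sub_const (y:ℂ)).div_const z).add_const (1/z^2))).neg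
    refine this.congr_deriv ?_
    field_simp; ring
  · rw [tendsto_zero_iff_norm_tendsto_zero]
    have h3 : Tendsto (fun κ : ℝ => ‖z‖⁻¹ * (κ * Real.exp (-z.re * κ)) + (y * ‖z‖⁻¹ + (‖z‖⁻¹)^2) * Real.exp (-z.re * κ)) atTop (𝓝 0) := by
      have := (hlim1.const_mul ‖z‖⁻¹).add (hlim2.const_mul (y * ‖z‖⁻¹ + (‖z‖⁻¹)^2))
      rwa [mul_zero, mul_zero, add_zero] at this
    refine tendsto_of_tendsto_of_tendsto_of_le_of_le' tendsto_const_nhds h3 (Eventually.of_forall fun κ => norm_nonneg _) ?_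
    filter_upwards [eventually_ge_atTop 0] with κ hκ
    rw [norm_neg, norm_mul, zexp_norm]
    have : ‖((κ:ℂ) - y) / z + 1 / z^2‖ ≤ (κ + y) * ‖z‖⁻¹ + (‖z‖⁻¹)^2 := by
      refine (norm_add_le _ _).trans ?_
      rw [norm_div, norm_div, norm_one, norm_pow, one_div, inv_pow, div_eq_mul_inv, ← Complex.ofReal_sub, Complex.norm_real, Real.norm_eq_abs]
      have : |κ - y| ≤ κ + y := by rw [abs_le]; constructor <;> linarith
      gcongr
    calc _ ≤ Real.exp (-z.re * κ) * ((κ + y) * ‖z‖⁻¹ + (‖z‖⁻¹)^2) := by gcongr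
      _ = _ := by ring

noncomputable def ST (M : Measure ℝ) (σ : ℝ → ℝ) (t : ℝ) : ℂ := ∫ v, Complex.exp (-(t * v : ℝ) * Complex.I) * (σ v : ℂ) ∂M

section gen
variable (M : Measure ℝ) [IsFiniteMeasure M] {σ : ℝ → ℝ}

lemma ST_sq (hσ : Measurable σ) (h1 : ∀ v, |σ v| ≤ 1) (t : ℝ) :
    ‖ST M σ t‖^2 = ∫ p : ℝ × ℝ, Real.cos (t * (p.1 - p.2)) * (σ p.1 * σ p.2) ∂(M.prod M) := by
  have hintg : Integrable (fun v => Complex.exp (-(t * v : ℝ) * Complex.I) * (σ v : ℂ)) M := by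
    refine Integrable.mono' (integrable_const 1) (by fun_prop) (Eventually.of_forall fun v => ?_)
    rw [norm_mul, ← Complex.ofReal_neg, Complex.norm_exp_ofReal_mul_I, one_mul, Complex.norm_real]
    exact h1 v
  have hre : (ST M σ t).re = ∫ v, Real.cos (t * v) * σ v ∂M := by
    rw [ST, ← RCLike.re_eq_complex_re, ← integral_re hintg]
    congr 1; ext v
    rw [RCLike.re_eq_complex_re, Complex.re_mul_ofReal, ← Complex.ofReal_neg, Complex.exp_ofReal_mul_I_re, Real.cos_neg]
  have him : (ST M σ t).im = ∫ v, -Real.sin (t * v) * σ v ∂M := by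
    rw [ST, ← RCLike.im_eq_complex_im, ← integral_im hintg]
    congr 1; ext v
    rw [RCLike.im_eq_complex_im, Complex.im_mul_ofReal, ← Complex.ofReal_neg, Complex.exp_ofReal_mul_I_im, Real.sin_neg]
  rw [← Complex.normSq_eq_norm_sq, Complex.normSq_apply, hre, him, ← integral_prod_mul, ← integral_prod_mul, ← integral_add]
  · congr 1; ext p
    rw [mul_sub, Real.cos_sub]; ring
  · refine (sig2_int M hσ h1 (f := fun p => Real.cos (t * p.1) * Real.cos (t * p.2)) (by fun_prop) (B := 1) fun p => ?_).congr (Eventually.of_forall fun p => ?_)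
    · rw [abs_mul]; exact mul_le_one₀ (Real.abs_cos_le_one _) (abs_nonneg _) (Real.abs_cos_le_one _)
    · beta_reduce; ring
  · refine (sig2_int M hσ h1 (f := fun p => Real.sin (t * p.1) * Real.sin (t * p.2)) (by fun_prop) (B := 1) fun p => ?_).congr (Eventually.of_forall fun p => ?_)
    · rw [abs_mul]; exact mul_le_one₀ (Real.abs_sin_le_one _) (abs_nonneg _) (Real.abs_sin_le_one _)
    · beta_reduce; ring

noncomputable def JJ (f : ℝ → ℂ) (H τ : ℝ) : ℝ := π⁻¹ * ∫ s : ℝ, ‖f (τ + H * s)‖^2 * (1 + s^2)⁻¹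

lemma J_eq (hσ : Measurable σ) (h1 : ∀ v, |σ v| ≤ 1) {H τ : ℝ} (hH : 0 ≤ H) :
    JJ (ST M σ) H τ = ∫ p : ℝ × ℝ, Real.cos (τ * (p.1 - p.2)) * Real.exp (-(H * |p.1 - p.2|)) * (σ p.1 * σ p.2) ∂(M.prod M) := by
  unfold JJ
  simp_rw [ST_sq M hσ h1, ← integral_mul_const]
  have hi : Integrable (Function.uncurry fun (s : ℝ) (p : ℝ × ℝ) => Real.cos ((τ + H * s) * (p.1 - p.2)) * (σ p.1 * σ p.2) * (1 + s^2)⁻¹) (volume.prod (M.prod M)) := by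
    have := (integrable_inv_one_add_sq).mul_prod (integrable_const (μ := M.prod M) (1:ℝ))
    refine Integrable.mono' this (by unfold Function.uncurry; fun_prop) (Eventually.of_forall fun q => ?_)
    simp only [Function.uncurry]
    rw [norm_mul, norm_mul, mul_one, Real.norm_of_nonneg (by positivity : 0 ≤ (1 + q.1^2)⁻¹)]
    refine mul_le_of_le_one_left (by positivity) (mul_le_one₀ (Real.abs_cos_le_one _) (norm_nonneg _) (sig2_le h1 _))
  rw [integral_integral_swap hi, ← integral_const_mul]
  congr 1; ext p
  have : ∀ s : ℝ, Real.cos ((τ + H * s) * (p.1 - p.2)) * (σ p.1 * σ p.2) * (1 + s^2)⁻¹ = Real.cos ((τ + H * s) * (p.1 - p.2)) * (1 + s^2)⁻¹ * (σ p.1 * σ p.2) := fun s => by ring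
  simp_rw [this]
  rw [integral_mul_const, cauchy_shift hH]
  have := Real.pi_pos.ne'
  field_simp

lemma W_lap_int (hσ : Measurable σ) (h1 : ∀ v, |σ v| ≤ 1) {z : ℂ} (hz : 0 < z.re) :
    IntegrableOn (fun κ : ℝ => Complex.exp (-z * κ) * (WW M σ κ : ℂ)) (Set.Ioi 0) := by
  refine Integrable.mono' ((lin_exp_int hz).const_mul ((M.real Set.univ)^2)) ?_ ((ae_restrict_iff' measurableSet_Ioi).2 (Eventually.of_forall fun κ hκ => ?_))
  · refine ContinuousOn.aestronglyMeasurable ?_ measurableSet_Ioi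
    have := (W_cont M hσ h1).mono (Set.Ioi_subset_Ici_self)
    fun_prop
  have hκ' : 0 < κ := hκ
  rw [norm_mul, zexp_norm, Complex.norm_real, Real.norm_of_nonneg (W_nonneg M κ)]
  have := W_le M hσ h1 hκ'.le
  have := mul_le_mul_of_nonneg_left this (Real.exp_pos (-z.re * κ)).le
  linarith

lemma J_W (hσ : Measurable σ) (h1 : ∀ v, |σ v| ≤ 1) {z : ℂ} (hz : 0 < z.re) :
    JJ (ST M σ) z.re z.im = (z^2 * ∫ κ in Set.Ioi (0:ℝ), Complex.exp (-z * κ) * (WW M σ κ : ℂ)).re := by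
  have e1 : ∫ κ in Set.Ioi (0:ℝ), Complex.exp (-z * κ) * (WW M σ κ : ℂ) =
      ∫ κ in Set.Ioi (0:ℝ), ∫ p : ℝ × ℝ, Complex.exp (-z * κ) * (max (κ - |p.1 - p.2|) 0 : ℝ) * (σ p.1 * σ p.2 : ℝ) ∂(M.prod M) := by
    refine setIntegral_congr_fun measurableSet_Ioi fun κ hκ => ?_
    rw [W_eq M hσ h1 (le_of_lt hκ), ← integral_complex_ofReal, ← integral_const_mul]
    congr 1; ext p; push_cast; ring
  have hi : Integrable (Function.uncurry fun (κ : ℝ) (p : ℝ × ℝ) => Complex.exp (-z * κ) * (max (κ - |p.1 - p.2|) 0 : ℝ) * (σ p.1 * σ p.2 : ℝ))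
      ((volume.restrict (Set.Ioi 0)).prod (M.prod M)) := by
    have := (show Integrable (fun κ : ℝ => κ * Real.exp (-z.re * κ)) (volume.restrict (Set.Ioi (0:ℝ))) from lin_exp_int hz).mul_prod (integrable_const (μ := M.prod M) (1:ℝ))
    refine Integrable.mono' this (by unfold Function.uncurry; fun_prop) ?_
    have hae : ∀ᵐ q ∂((volume.restrict (Set.Ioi (0:ℝ))).prod (M.prod M)), 0 < q.1 :=
      (Measure.quasiMeasurePreserving_fst).ae ((ae_restrict_iff' measurableSet_Ioi).2 (Eventually.of_forall fun x hx => hx))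
    filter_upwards [hae] with q hq
    simp only [Function.uncurry]
    rw [norm_mul, norm_mul, zexp_norm, Complex.norm_real, Complex.norm_real, Real.norm_of_nonneg (le_max_right _ _), mul_one, mul_comm q.1]
    have hm : max (q.1 - |q.2.1 - q.2.2|) 0 ≤ q.1 := max_le (by linarith [abs_nonneg (q.2.1 - q.2.2)]) hq.le
    calc _ ≤ Real.exp (-z.re * q.1) * max (q.1 - |q.2.1 - q.2.2|) 0 * 1 := by
          gcongr
          exact sig2_le h1 _
      _ ≤ _ := by rw [mul_one]; gcongr
  rw [e1, integral_integral_swap hi, ← integral_const_mul, J_eq M hσ h1 hz.le]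
  have e2 : ∀ p : ℝ × ℝ, z^2 * ∫ κ in Set.Ioi (0:ℝ), Complex.exp (-z * κ) * (max (κ - |p.1 - p.2|) 0 : ℝ) * (σ p.1 * σ p.2 : ℝ) =
      Complex.exp (-z * (|p.1 - p.2| : ℝ)) * (σ p.1 * σ p.2 : ℝ) := by
    intro p
    rw [integral_mul_const, ← mul_assoc, ramp hz (abs_nonneg _)]
  simp_rw [e2]
  rw [← RCLike.re_eq_complex_re, ← integral_re]
  · congr 1; ext p
    rw [RCLike.re_eq_complex_re, Complex.re_mul_ofReal, Complex.exp_re]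
    simp only [Complex.mul_re, Complex.mul_im, Complex.neg_re, Complex.neg_im, Complex.ofReal_re, Complex.ofReal_im, mul_zero, sub_zero, zero_add, add_zero]
    have : Real.cos (-z.im * |p.1 - p.2|) = Real.cos (z.im * (p.1 - p.2)) := by
      rw [neg_mul, Real.cos_neg]
      rcases abs_choice (p.1 - p.2) with h | h <;> rw [h]
      rw [mul_neg, Real.cos_neg]
    rw [this, neg_mul]; ring
  · refine Integrable.mono' (integrable_const 1) (by fun_prop) (Eventually.of_forall fun p => ?_)
    rw [norm_mul, zexp_norm, Complex.norm_real]
    refine mul_le_one₀ ?_ (norm_nonneg _) (sig2_le h1 _)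
    rw [Real.exp_le_one_iff]
    nlinarith [abs_nonneg (p.1 - p.2)]

end gen
end B1

namespace B1
open Filter Topology Metric

section gen
variable (M : Measure ℝ) [IsFiniteMeasure M] {σ : ℝ → ℝ}

lemma W_lap_int_real (hσ : Measurable σ) (h1 : ∀ v, |σ v| ≤ 1) {H : ℝ} (hH : 0 < H) :
    IntegrableOn (fun κ : ℝ => Real.exp (-H * κ) * WW M σ κ) (Set.Ioi 0) := by
  have := (W_lap_int M hσ h1 (z := (H:ℂ)) (by simpa using hH)).re
  refine Integrable.congr this (Eventually.of_forall fun κ => ?_)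
  beta_reduce
  rw [RCLike.re_eq_complex_re, Complex.re_mul_ofReal, ← Complex.ofReal_neg, ← Complex.ofReal_mul, Complex.exp_ofReal_re]

lemma J_W_real (hσ : Measurable σ) (h1 : ∀ v, |σ v| ≤ 1) {H : ℝ} (hH : 0 < H) :
    JJ (ST M σ) H 0 = H^2 * ∫ κ in Set.Ioi (0:ℝ), Real.exp (-H * κ) * WW M σ κ := by
  have h := J_W M hσ h1 (z := (H:ℂ)) (by simpa using hH)
  rw [Complex.ofReal_re, Complex.ofReal_im] at h
  rw [h, ← Complex.ofReal_pow, Complex.re_ofReal_mul]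
  congr 1
  rw [← Complex.ofReal_re (∫ κ in Set.Ioi (0:ℝ), Real.exp (-H * κ) * WW M σ κ), ← integral_complex_ofReal]
  congr 2; ext κ; push_cast; rfl

lemma W_triv (hσ : Measurable σ) (h1 : ∀ v, |σ v| ≤ 1) {κ : ℝ} (hκ : 0 < κ) :
    WW M σ κ ≤ 12 * κ * JJ (ST M σ) κ⁻¹ 0 := by
  have hc : ContinuousOn (WW M σ) (Set.uIcc 0 κ) := (W_cont M hσ h1).mono (by rw [Set.uIcc_of_le hκ.le]; exact Set.Icc_subset_Ici_self)
  have i1 : IntervalIntegrable (WW M σ) volume 0 κ := hc.intervalIntegrable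
  have i2 : IntervalIntegrable (fun x => WW M σ (κ - x)) volume 0 κ := by
    have := (i1.comp_sub_left κ).symm
    simpa using this
  have s1 : κ * WW M σ κ ≤ 4 * ∫ x in (0:ℝ)..κ, WW M σ x := by
    have e : ∫ x in (0:ℝ)..κ, WW M σ (κ - x) = ∫ x in (0:ℝ)..κ, WW M σ x := by
      rw [intervalIntegral.integral_comp_sub_left]; simp
    calc κ * WW M σ κ = ∫ x in (0:ℝ)..κ, WW M σ κ := by simp
      _ ≤ ∫ x in (0:ℝ)..κ, (2 * WW M σ x + 2 * WW M σ (κ - x)) := by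
          refine intervalIntegral.integral_mono_on hκ.le (by simp) ((i1.const_mul 2).add (i2.const_mul 2)) fun x hx => ?_
          have := W_sub M hσ h1 hx.1 (sub_nonneg.2 hx.2)
          rwa [add_sub_cancel] at this
      _ = 4 * ∫ x in (0:ℝ)..κ, WW M σ x := by
          rw [intervalIntegral.integral_add (i1.const_mul 2) (i2.const_mul 2), intervalIntegral.integral_const_mul, intervalIntegral.integral_const_mul, e]; ring
  have s2 : ∫ x in (0:ℝ)..κ, WW M σ x ≤ 3 * ∫ x in Set.Ioi (0:ℝ), Real.exp (-κ⁻¹ * x) * WW M σ x := by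
    have iL := W_lap_int_real M hσ h1 (inv_pos.2 hκ)
    calc ∫ x in (0:ℝ)..κ, WW M σ x = ∫ x in Set.Ioc 0 κ, WW M σ x := intervalIntegral.integral_of_le hκ.le
      _ ≤ ∫ x in Set.Ioc 0 κ, 3 * (Real.exp (-κ⁻¹ * x) * WW M σ x) := by
          refine setIntegral_mono_on ((intervalIntegrable_iff_integrableOn_Ioc_of_le hκ.le).1 i1) (Integrable.const_mul (iL.mono_set Set.Ioc_subset_Ioi_self) 3) measurableSet_Ioc fun x hx => ?_
          have : 1 ≤ 3 * Real.exp (-κ⁻¹ * x) := by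
            have h2 : Real.exp (-1) ≤ Real.exp (-κ⁻¹ * x) := by
              apply Real.exp_le_exp.2
              have : κ⁻¹ * x ≤ 1 := by rw [inv_mul_le_iff₀ hκ]; linarith [hx.2]
              linarith
            have h3 : 1 ≤ 3 * Real.exp (-1) := by
              rw [Real.exp_neg, ← div_eq_mul_inv, le_div_iff₀ (Real.exp_pos 1)]
              linarith [Real.exp_one_lt_d9]
            linarith
          have := mul_le_mul_of_nonneg_right this (W_nonneg (σ := σ) M x)
          linarith
      _ = 3 * ∫ x in Set.Ioc 0 κ, (Real.exp (-κ⁻¹ * x) * WW M σ x) := integral_const_mul _ _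
      _ ≤ _ := by
          refine mul_le_mul_of_nonneg_left ?_ (by norm_num)
          refine setIntegral_mono_set iL (Eventually.of_forall fun x => ?_) (Eventually.of_forall Set.Ioc_subset_Ioi_self)
          exact mul_nonneg (Real.exp_pos _).le (W_nonneg M x)
  rw [J_W_real M hσ h1 (inv_pos.2 hκ)]
  have : WW M σ κ = κ⁻¹ * (κ * WW M σ κ) := by field_simp
  rw [this]
  calc κ⁻¹ * (κ * WW M σ κ) ≤ κ⁻¹ * (4 * (3 * ∫ x in Set.Ioi (0:ℝ), Real.exp (-κ⁻¹ * x) * WW M σ x)) := by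
        exact mul_le_mul_of_nonneg_left (by linarith) (inv_pos.2 hκ).le
    _ = _ := by field_simp; ring
end gen

lemma pw_int {a : ℝ} (ha : a < 1) : Integrable (fun s : ℝ => (1 + |s|)^a * (1 + s^2)⁻¹) := by
  have := (integrable_one_add_norm (E := ℝ) (μ := volume) (r := 2 - a) (by simp; linarith)).const_mul 2
  refine Integrable.mono' this ?_ (Eventually.of_forall fun s => ?_)
  · refine Continuous.aestronglyMeasurable (Continuous.mul (Continuous.rpow_const (by fun_prop) fun s => Or.inl (by positivity)) (Continuous.inv₀ (by fun_prop) fun s => by positivity))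
  · have h0 : 0 < 1 + |s| := by positivity
    rw [Real.norm_of_nonneg (by positivity), Real.norm_eq_abs, neg_sub, Real.rpow_sub h0]
    have : (1 + s^2)⁻¹ ≤ 2 * ((1 + |s|)^(2:ℝ))⁻¹ := by
      rw [Real.rpow_two, ← div_eq_mul_inv, inv_eq_one_div, div_le_div_iff₀ (by positivity) (by positivity), ← sq_abs s]
      nlinarith [sq_nonneg (1 - |s|)]
    calc (1 + |s|)^a * (1 + s^2)⁻¹ ≤ (1 + |s|)^a * (2 * ((1 + |s|)^(2:ℝ))⁻¹) := by gcongr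
      _ = _ := by ring

noncomputable def Kc (a : ℝ) : ℝ := ∫ s : ℝ, (1 + |s|)^a * (1 + s^2)⁻¹
lemma Kc_nonneg (a : ℝ) : 0 ≤ Kc a := integral_nonneg fun s => by positivity

lemma J_bound {f : ℝ → ℂ} (hf : Continuous f) {C η : ℝ} (hC : 0 ≤ C) (hη : 0 ≤ η) (hη1 : η ≤ 1/8)
    (hb : ∀ t, ‖f t‖ ≤ C * (1 + |t|)^η) {H : ℝ} (hH : 1 ≤ H) (τ : ℝ) :
    Integrable (fun s : ℝ => ‖f (τ + H * s)‖^2 * (1 + s^2)⁻¹) ∧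
    JJ f H τ ≤ C^2 * Kc (2 * η) * (H + |τ|)^(2 * η) := by
  have hpt : ∀ s : ℝ, ‖f (τ + H * s)‖^2 * (1 + s^2)⁻¹ ≤ C^2 * (H + |τ|)^(2 * η) * ((1 + |s|)^(2 * η) * (1 + s^2)⁻¹) := by
    intro s
    have h1 : 1 + |τ + H * s| ≤ (H + |τ|) * (1 + |s|) := by
      have := abs_add_le τ (H * s)
      rw [abs_mul, abs_of_nonneg (by linarith : 0 ≤ H)] at this
      nlinarith [mul_nonneg (abs_nonneg τ) (abs_nonneg s)]
    have h2 : ‖f (τ + H * s)‖^2 ≤ C^2 * ((H + |τ|)^(2 * η) * (1 + |s|)^(2 * η)) := by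
      rw [← Real.mul_rpow (by positivity) (by positivity)]
      calc ‖f (τ + H * s)‖^2 ≤ (C * (1 + |τ + H * s|)^η)^2 := by gcongr; exact hb _
        _ = C^2 * (1 + |τ + H * s|)^(2 * η) := by
            rw [mul_pow, ← Real.rpow_natCast, ← Real.rpow_natCast, ← Real.rpow_mul (by positivity)]; 
            push_cast; rw [mul_comm η 2]
        _ ≤ _ := by gcongr
    calc _ ≤ C^2 * ((H + |τ|)^(2 * η) * (1 + |s|)^(2 * η)) * (1 + s^2)⁻¹ := by gcongr
      _ = _ := by ring
  have hi := (pw_int (a := 2 * η) (by linarith)).const_mul (C^2 * (H + |τ|)^(2 * η))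
  have hi2 : Integrable (fun s : ℝ => ‖f (τ + H * s)‖^2 * (1 + s^2)⁻¹) := by
    refine Integrable.mono' hi ?_ (Eventually.of_forall fun s => ?_)
    · exact (Continuous.mul (by fun_prop) (Continuous.inv₀ (by fun_prop) fun s => by positivity)).aestronglyMeasurable
    · rw [Real.norm_of_nonneg (by positivity)]; exact hpt s
  refine ⟨hi2, ?_⟩
  unfold JJ
  have h3 : ∫ s : ℝ, ‖f (τ + H * s)‖^2 * (1 + s^2)⁻¹ ≤ C^2 * (H + |τ|)^(2 * η) * Kc (2 * η) := by
    rw [Kc, ← integral_const_mul]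
    exact integral_mono hi2 hi hpt
  have h4 : 0 ≤ ∫ s : ℝ, ‖f (τ + H * s)‖^2 * (1 + s^2)⁻¹ := integral_nonneg fun s => by positivity
  have hpi : π⁻¹ ≤ 1 := inv_le_one_of_one_le₀ (by linarith [Real.pi_gt_three])
  calc _ ≤ 1 * ∫ s : ℝ, ‖f (τ + H * s)‖^2 * (1 + s^2)⁻¹ := by gcongr
    _ ≤ _ := by linarith

lemma W_small (M : Measure ℝ) [IsFiniteMeasure M] {σ : ℝ → ℝ} (hσ : Measurable σ) (h1 : ∀ v, |σ v| ≤ 1)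
    (hf : Continuous (ST M σ)) {C η : ℝ} (hC : 0 ≤ C) (hη : 0 ≤ η) (hη1 : η ≤ 1/8)
    (hb : ∀ t, ‖ST M σ t‖ ≤ C * (1 + |t|)^η) {κ : ℝ} (hκ : 0 < κ) (hκ1 : κ ≤ 1) :
    WW M σ κ ≤ 12 * C^2 * Kc (2 * η) * κ^(1 - 2 * η) := by
  have a := W_triv M hσ h1 hκ
  have b := (J_bound hf hC hη hη1 hb (one_le_inv_iff₀.2 ⟨hκ, hκ1⟩) 0).2
  rw [abs_zero, add_zero] at b
  have e : κ^(1 - 2 * η) = κ * κ⁻¹^(2 * η) := by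
    rw [Real.rpow_sub hκ, Real.rpow_one, Real.inv_rpow hκ.le, div_eq_mul_inv]
  rw [e]
  calc _ ≤ 12 * κ * JJ (ST M σ) κ⁻¹ 0 := a
    _ ≤ 12 * κ * (C^2 * Kc (2 * η) * κ⁻¹^(2 * η)) := by gcongr
    _ = _ := by ring
end B1

namespace B1
open Filter Topology Metric

noncomputable def rho (U u v : ℝ) : ℝ := Real.exp (|v - U| - |u - U| + (v - u) / 2)
noncomputable def eps (U s : ℝ) : ℝ := if U ≤ s then 3/2 else -(1/2)
noncomputable def gg (U u w : ℝ) : ℝ := rho U u (u + w) * eps U (u + w)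

lemma eps_abs (U s : ℝ) : |eps U s| ≤ 3/2 := by
  unfold eps; split_ifs <;> norm_num [abs_le]

lemma eps_meas (U : ℝ) : Measurable (eps U) := by
  unfold eps
  exact Measurable.ite measurableSet_Ici measurable_const measurable_const

lemma rho_bound {U u v κ : ℝ} (h1 : u ≤ v) (h2 : v ≤ u + κ) (hκ : κ ≤ 1) : rho U u v ≤ 9/2 := by
  have : |v - U| - |u - U| + (v - u) / 2 ≤ 3/2 := by
    have := abs_sub_abs_le_abs_sub (v - U) (u - U)
    rw [sub_sub_sub_cancel_right, abs_of_nonneg (sub_nonneg.2 h1)] at this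
    linarith
  refine (Real.exp_le_exp.2 this).trans ?_
  have h3 : Real.exp (3/2) ^ 2 ≤ (9/2)^2 := by
    rw [← Real.exp_nat_mul, show ((2:ℕ):ℝ) * (3/2) = (3:ℕ) * 1 by norm_num, Real.exp_nat_mul]
    calc Real.exp 1 ^ 3 ≤ 2.7182818286 ^ 3 := by gcongr; exact Real.exp_one_lt_d9.le
      _ ≤ _ := by norm_num
  exact (abs_le_of_sq_le_sq' h3 (by norm_num)).2

lemma gg_bound {U u w : ℝ} (h1 : 0 ≤ w) (h2 : w ≤ 1) : |gg U u w| ≤ 7 := by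
  unfold gg
  rw [abs_mul, abs_of_pos (show 0 < rho U u (u + w) from Real.exp_pos _)]
  have a := rho_bound (U := U) (u := u) (v := u + w) (κ := 1) (by linarith) (by linarith) le_rfl
  have := mul_le_mul a (eps_abs U (u + w)) (abs_nonneg _) (by norm_num)
  linarith

lemma rho_meas (U : ℝ) {α : Type*} [MeasurableSpace α] {a b : α → ℝ} (ha : Measurable a) (hb : Measurable b) :
    Measurable fun x => rho U (a x) (b x) := by
  unfold rho
  have h1 : Measurable fun x => |b x - U| := by fun_prop
  have h2 : Measurable fun x => |a x - U| := by fun_prop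
  fun_prop

lemma gg_meas (U : ℝ) {α : Type*} [MeasurableSpace α] {a b : α → ℝ} (ha : Measurable a) (hb : Measurable b) :
    Measurable fun x => gg U (a x) (b x) := by
  unfold gg
  exact (rho_meas U ha (ha.add hb)).mul ((eps_meas U).comp (ha.add hb))

lemma gg_intOn (U u : ℝ) {a : ℝ} (ha : a ≤ 1) : IntegrableOn (fun w => gg U u w) (Set.Ioc 0 a) := by
  refine Integrable.mono' (g := fun _ => (7:ℝ)) (by simp [integrableOn_const_iff]) (gg_meas U measurable_const measurable_id).aestronglyMeasurable ((ae_restrict_iff' measurableSet_Ioc).2 (Eventually.of_forall fun w hw => ?_))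
  exact gg_bound hw.1.le (hw.2.trans ha)

lemma rho_ftc (U u : ℝ) {y : ℝ} (hy : 0 ≤ y) (hy1 : y ≤ 1) : rho U u (u + y) - 1 = ∫ w in Set.Ioo 0 y, gg U u w := by
  have h := intervalIntegral.integral_eq_sub_of_hasDeriv_right (a := 0) (b := y) (f := fun w => rho U u (u + w)) (f' := fun w => gg U u w) ?_ ?_ ?_
  · rw [intervalIntegral.integral_of_le hy, integral_Ioc_eq_integral_Ioo] at h
    rw [h]; simp [rho]
  · unfold rho
    exact Continuous.continuousOn (by fun_prop)
  · intro w _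
    have ha : HasDerivWithinAt (fun w => |u + w - U|) (eps U (u + w) - 1/2) (Set.Ioi w) w := by
      unfold eps
      have hb : HasDerivAt (fun w : ℝ => u + w - U) 1 w := by
        simpa using ((hasDerivAt_id w).const_add u).sub_const U
      split_ifs with h0
      · refine (hb.hasDerivWithinAt (s := Set.Ioi w)).congr_deriv (by norm_num) |>.congr (fun x hx => ?_) ?_
        · have : w < x := hx
          exact abs_of_nonneg (by linarith)
        · exact abs_of_nonneg (by linarith)
      · push Not at h0
        have : HasDerivAt (fun w => |u + w - U|) (-1) w := by
          refine hb.neg.congr_of_eventuallyEq ?_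
          have : ∀ᶠ x in 𝓝 w, x < U - u := gt_mem_nhds (by linarith)
          filter_upwards [this] with x hx
          exact abs_of_neg (by linarith)
        exact this.hasDerivWithinAt.congr_deriv (by norm_num)
    have hb : HasDerivWithinAt (fun w : ℝ => (u + w - u) / 2) (1/2) (Set.Ioi w) w := by
      have : HasDerivAt (fun w : ℝ => (u + w - u) / 2) (1/2) w := by
        simpa using (((hasDerivAt_id w).const_add u).sub_const u).div_const 2
      exact this.hasDerivWithinAt
    have := ((ha.sub_const |u - U|).add hb).exp
    refine this.congr_deriv ?_
    simp only [gg, rho, Pi.add_apply]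
    ring
  · rw [intervalIntegrable_iff_integrableOn_Ioc_of_le hy]
    exact gg_intOn U u hy1

lemma sq_int_le {α : Type*} [MeasurableSpace α] (μ : Measure α) [IsFiniteMeasure μ] {f : α → ℝ} (h1 : Integrable f μ) (h2 : Integrable (fun x => f x ^ 2) μ) :
    (∫ x, f x ∂μ)^2 ≤ μ.real Set.univ * ∫ x, f x ^ 2 ∂μ := by
  set m := μ.real Set.univ with hm
  set a := ∫ x, f x ∂μ with ha
  have h3 : 0 ≤ ∫ x, (m * f x - a)^2 ∂μ := integral_nonneg fun x => sq_nonneg _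
  have h4 : ∫ x, (m * f x - a)^2 ∂μ = m^2 * (∫ x, f x ^ 2 ∂μ) - 2 * m * a * a + a^2 * m := by
    have : ∀ x, (m * f x - a)^2 = m^2 * f x ^ 2 - 2 * m * a * f x + a^2 := fun x => by ring
    simp_rw [this]
    have hs : Integrable (fun x => m^2 * f x ^ 2 - 2 * m * a * f x) μ := (h2.const_mul _).sub (h1.const_mul _)
    rw [integral_add hs (integrable_const _), integral_sub (h2.const_mul _) (h1.const_mul _),
      integral_const_mul, integral_const_mul, integral_const, smul_eq_mul]
    ring
  rw [h4] at h3
  rcases (measureReal_nonneg : 0 ≤ μ.real Set.univ).eq_or_lt with h0 | h0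
  · have : μ = 0 := by
      rw [eq_comm, measureReal_eq_zero_iff] at h0
      exact Measure.measure_univ_eq_zero.1 h0
    rw [ha, this]; simp
  · have h5 : 0 ≤ m * (m * (∫ x, f x ^ 2 ∂μ) - a^2) := by nlinarith
    have := nonneg_of_mul_nonneg_right h5 h0
    linarith

noncomputable def DD (U : ℝ) (M : Measure ℝ) (σ : ℝ → ℝ) (κ u : ℝ) : ℝ := ∫ v, hker κ u v * rho U u v * σ v ∂M

section gen
variable (U : ℝ) (M : Measure ℝ) [IsFiniteMeasure M] {σ : ℝ → ℝ}

lemma DD_kint (hσ : Measurable σ) (h1 : ∀ v, |σ v| ≤ 1) {κ : ℝ} (hκ1 : κ ≤ 1) (u : ℝ) :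
    Integrable (fun v => hker κ u v * rho U u v * σ v) M := by
  refine sig_int M hσ h1 (f := fun v => hker κ u v * rho U u v) ?_ (B := 9/2) fun v => ?_
  · exact (hker_meas measurable_const measurable_const measurable_id).mul (rho_meas U measurable_const measurable_id)
  · rw [abs_of_nonneg (mul_nonneg (hker_nonneg _ _ _) (show 0 ≤ rho U u v from (Real.exp_pos _).le))]
    unfold hker
    split_ifs with h
    · rw [one_mul]; exact rho_bound h.1.le h.2 hκ1
    · norm_num

lemma DD_sub (hσ : Measurable σ) (h1 : ∀ v, |σ v| ≤ 1) {κ : ℝ} (hκ : 0 < κ) (hκ1 : κ ≤ 1) (u : ℝ) :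
    DD U M σ κ u - hh M σ κ u = ∫ w in Set.Ioc 0 κ, gg U u w * hh M σ (κ - w) (u + w) := by
  unfold DD hh
  rw [← integral_sub (DD_kint U M hσ h1 hκ1 u) (hker_sig_int M hσ h1 κ u)]
  simp_rw [← integral_const_mul]
  have hi : Integrable (Function.uncurry fun (w v : ℝ) => gg U u w * (hker (κ - w) (u + w) v * σ v)) ((volume.restrict (Set.Ioc 0 κ)).prod M) := by
    have := (show Integrable _ (volume.restrict (Set.Ioc 0 κ)) from gg_intOn U u hκ1).mul_prod (integrable_const (μ := M) (1:ℝ))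
    refine Integrable.mono' this.norm ?_ (Eventually.of_forall fun q => ?_)
    · refine Measurable.aestronglyMeasurable ?_
      unfold Function.uncurry
      exact (gg_meas U measurable_const measurable_fst).mul ((hker_meas (by fun_prop) (by fun_prop) measurable_snd).mul (hσ.comp measurable_snd))
    · simp only [Function.uncurry]
      rw [norm_mul, norm_mul, norm_mul, norm_one, mul_one]
      exact mul_le_of_le_one_right (norm_nonneg _) (mul_le_one₀ (hker_abs _ _ _) (norm_nonneg _) (h1 _))
  rw [integral_integral_swap hi]
  congr 1; ext v
  have e : ∀ w, gg U u w * (hker (κ - w) (u + w) v * σ v) = gg U u w * hker (κ - w) (u + w) v * σ v := fun w => by ring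
  simp_rw [e]
  rw [integral_mul_const, ← sub_mul]
  congr 1
  by_cases hv : u < v ∧ v ≤ u + κ
  · have h3 := rho_ftc U u (y := v - u) (by linarith [hv.1]) (by linarith [hv.2])
    rw [add_sub_cancel] at h3
    have : hker κ u v = 1 := if_pos hv
    rw [this, one_mul, h3, ← integral_indicator measurableSet_Ioo, ← integral_indicator measurableSet_Ioc]
    congr 1; ext w
    by_cases hw : w ∈ Set.Ioo 0 (v - u)
    · rw [Set.indicator_of_mem hw, Set.indicator_of_mem (show w ∈ Set.Ioc 0 κ from ⟨hw.1, by linarith [hw.2, hv.2]⟩)]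
      unfold hker
      rw [if_pos ⟨by linarith [hw.2], by linarith [hv.2]⟩, mul_one]
    · rw [Set.indicator_of_notMem hw]
      by_cases hw2 : w ∈ Set.Ioc 0 κ
      · rw [Set.indicator_of_mem hw2]
        unfold hker
        rw [if_neg, mul_zero]
        intro h4
        exact hw ⟨hw2.1, by linarith [h4.1]⟩
      · rw [Set.indicator_of_notMem hw2]
  · have : hker κ u v = 0 := if_neg hv
    rw [this, zero_mul, sub_zero, eq_comm]
    refine (setIntegral_congr_fun measurableSet_Ioc fun w hw => ?_).trans (integral_zero _ _)
    unfold hker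
    rw [if_neg, mul_zero]
    intro h4
    exact hv ⟨by linarith [h4.1, hw.1], by linarith [h4.2]⟩

lemma hh_meas (hσ : Measurable σ) {α : Type*} [MeasurableSpace α] {a b : α → ℝ} (ha : Measurable a) (hb : Measurable b) :
    Measurable fun x => hh M σ (a x) (b x) := by
  unfold hh
  have : Measurable (fun q : α × ℝ => hker (a q.1) (b q.1) q.2 * σ q.2) :=
    (hker_meas (ha.comp measurable_fst) (hb.comp measurable_fst) measurable_snd).mul (hσ.comp measurable_snd)
  exact (this.stronglyMeasurable.integral_prod_right' (ν := M)).measurable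

lemma DD_meas (hσ : Measurable σ) (κ : ℝ) : Measurable (DD U M σ κ) := by
  unfold DD
  have : Measurable (fun q : ℝ × ℝ => hker κ q.1 q.2 * rho U q.1 q.2 * σ q.2) :=
    ((hker_meas measurable_const measurable_fst measurable_snd).mul (rho_meas U measurable_fst measurable_snd)).mul (hσ.comp measurable_snd)
  exact (this.stronglyMeasurable.integral_prod_right' (ν := M)).measurable

lemma hh_le (hσ : Measurable σ) (h1 : ∀ v, |σ v| ≤ 1) (κ u : ℝ) : |hh M σ κ u| ≤ M.real Set.univ := by
  unfold hh
  have := norm_integral_le_of_norm_le_const (μ := M) (f := fun v => hker κ u v * σ v) (C := 1) (Eventually.of_forall fun v => by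
    rw [norm_mul]; exact mul_le_one₀ (hker_abs _ _ _) (norm_nonneg _) (h1 _))
  simpa using this

lemma Phi_int (hσ : Measurable σ) (h1 : ∀ v, |σ v| ≤ 1) {κ : ℝ} (hκ : 0 < κ) :
    Integrable (fun q : ℝ × ℝ => (hh M σ (κ - q.1) (q.2 + q.1))^2) ((volume.restrict (Set.Ioc 0 κ)).prod volume) := by
  have hm : Measurable (fun q : ℝ × ℝ => (hh M σ (κ - q.1) (q.2 + q.1))^2) :=
    (hh_meas M hσ (by fun_prop) (by fun_prop)).pow_const 2
  rw [integrable_prod_iff hm.aestronglyMeasurable]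
  constructor
  · refine (ae_restrict_iff' measurableSet_Ioc).2 (Eventually.of_forall fun w hw => ?_)
    exact (hh_sq_int M hσ h1 (sub_nonneg.2 hw.2)).comp_add_right w
  · have : IntegrableOn (fun w => WW M σ (κ - w)) (Set.Ioc 0 κ) := by
      refine (ContinuousOn.integrableOn_Icc ?_).mono_set Set.Ioc_subset_Icc_self
      exact (W_cont M hσ h1).comp (by fun_prop) fun w hw => sub_nonneg.2 hw.2
    refine IntegrableOn.congr_fun this (fun w hw => ?_) measurableSet_Ioc
    simp only [Real.norm_of_nonneg (sq_nonneg _)]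
    exact (integral_add_right_eq_self (fun u => (hh M σ (κ - w) u)^2) w).symm

lemma DD_diff (hσ : Measurable σ) (h1 : ∀ v, |σ v| ≤ 1) {κ B : ℝ} (hκ : 0 < κ) (hκ1 : κ ≤ 1) (hB0 : 0 ≤ B)
    (hB : ∀ w, 0 < w → w ≤ κ → WW M σ w ≤ B) :
    Integrable (fun u => (DD U M σ κ u - hh M σ κ u)^2) ∧ ∫ u, (DD U M σ κ u - hh M σ κ u)^2 ≤ 49 * κ^2 * B := by
  have hP := Phi_int M hσ h1 hκ
  have hr : Integrable (fun u => ∫ w in Set.Ioc 0 κ, (hh M σ (κ - w) (u + w))^2) := hP.integral_prod_right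
  have hpt : ∀ u, (DD U M σ κ u - hh M σ κ u)^2 ≤ 49 * κ * ∫ w in Set.Ioc 0 κ, (hh M σ (κ - w) (u + w))^2 := by
    intro u
    rw [DD_sub U M hσ h1 hκ hκ1]
    have hms : Measurable (fun w => gg U u w * hh M σ (κ - w) (u + w)) :=
      (gg_meas U measurable_const measurable_id).mul (hh_meas M hσ (by fun_prop) (by fun_prop))
    have hfin : IntegrableOn (fun _ : ℝ => (1:ℝ)) (Set.Ioc 0 κ) := by simp [integrableOn_const_iff]
    set m := M.real Set.univ
    have hm0 : 0 ≤ m := measureReal_nonneg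
    have hbd : ∀ w ∈ Set.Ioc 0 κ, |gg U u w * hh M σ (κ - w) (u + w)| ≤ 7 * m := by
      intro w hw
      rw [abs_mul]
      exact mul_le_mul (gg_bound hw.1.le (hw.2.trans hκ1)) (hh_le M hσ h1 _ _) (abs_nonneg _) (by norm_num)
    have i1 : IntegrableOn (fun w => gg U u w * hh M σ (κ - w) (u + w)) (Set.Ioc 0 κ) := by
      refine Integrable.mono' (g := fun _ => 7 * m) (integrable_const _) hms.aestronglyMeasurable ((ae_restrict_iff' measurableSet_Ioc).2 (Eventually.of_forall hbd))
    have i2 : IntegrableOn (fun w => (gg U u w * hh M σ (κ - w) (u + w))^2) (Set.Ioc 0 κ) := by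
      refine Integrable.mono' (g := fun _ => (7 * m)^2) (integrable_const _) (hms.pow_const 2).aestronglyMeasurable ((ae_restrict_iff' measurableSet_Ioc).2 (Eventually.of_forall fun w hw => ?_))
      rw [norm_pow]
      exact pow_le_pow_left₀ (norm_nonneg _) (hbd w hw) 2
    have i3 : IntegrableOn (fun w => (hh M σ (κ - w) (u + w))^2) (Set.Ioc 0 κ) := by
      refine Integrable.mono' (g := fun _ => m^2) (integrable_const _) ((hh_meas M hσ (by fun_prop) (by fun_prop)).pow_const 2).aestronglyMeasurable (Eventually.of_forall fun w => ?_)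
      rw [norm_pow]
      exact pow_le_pow_left₀ (norm_nonneg _) (hh_le M hσ h1 _ _) 2
    have := sq_int_le (volume.restrict (Set.Ioc 0 κ)) i1 i2
    refine this.trans ?_
    rw [show (volume.restrict (Set.Ioc 0 κ)).real Set.univ = κ by simp [Measure.real, hκ.le], mul_comm (49:ℝ), mul_assoc]
    refine mul_le_mul_of_nonneg_left ?_ hκ.le
    rw [← integral_const_mul]
    refine setIntegral_mono_on i2 (Integrable.const_mul i3 49) measurableSet_Ioc fun w hw => ?_
    rw [mul_pow]
    refine mul_le_mul_of_nonneg_right ?_ (sq_nonneg _)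
    rw [← sq_abs]
    have := pow_le_pow_left₀ (abs_nonneg _) (gg_bound (U := U) (u := u) hw.1.le (hw.2.trans hκ1)) 2
    linarith
  have hi : Integrable (fun u => (DD U M σ κ u - hh M σ κ u)^2) := by
    refine Integrable.mono' (hr.const_mul (49 * κ)) (((DD_meas U M hσ κ).sub (hh_meas M hσ measurable_const measurable_id)).pow_const 2).aestronglyMeasurable (Eventually.of_forall fun u => ?_)
    rw [Real.norm_of_nonneg (sq_nonneg _)]
    exact hpt u
  refine ⟨hi, ?_⟩
  calc _ ≤ ∫ u, 49 * κ * ∫ w in Set.Ioc 0 κ, (hh M σ (κ - w) (u + w))^2 := integral_mono hi (hr.const_mul _) hpt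
    _ = 49 * κ * ∫ u, ∫ w in Set.Ioc 0 κ, (hh M σ (κ - w) (u + w))^2 := integral_const_mul _ _
    _ = 49 * κ * ∫ w in Set.Ioc 0 κ, ∫ u, (hh M σ (κ - w) (u + w))^2 := by
        congr 1
        exact (integral_integral_swap (f := fun w u => (hh M σ (κ - w) (u + w))^2) hP).symm
    _ ≤ 49 * κ * (κ * B) := by
        refine mul_le_mul_of_nonneg_left ?_ (by positivity)
        have e : ∀ w, ∫ u, (hh M σ (κ - w) (u + w))^2 = WW M σ (κ - w) := fun w => integral_add_right_eq_self (fun u => (hh M σ (κ - w) u)^2) w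
        simp_rw [e]
        have i4 : IntegrableOn (fun w => WW M σ (κ - w)) (Set.Ioc 0 κ) := by
          refine (ContinuousOn.integrableOn_Icc ?_).mono_set Set.Ioc_subset_Icc_self
          exact (W_cont M hσ h1).comp (by fun_prop) fun w hw => sub_nonneg.2 hw.2
        calc _ ≤ ∫ w in Set.Ioc 0 κ, B := by
              refine setIntegral_mono_on i4 (by simp [integrableOn_const_iff]) measurableSet_Ioc fun w hw => ?_
              rcases (sub_nonneg.2 hw.2).eq_or_lt with h0 | h0
              · rw [← h0, W_zero M hσ h1]; exact hB0
              · exact hB _ h0 (by linarith [hw.1])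
          _ = _ := by simp [hκ.le]
    _ = _ := by ring

lemma DD_comp (hσ : Measurable σ) (h1 : ∀ v, |σ v| ≤ 1) {κ B : ℝ} (hκ : 0 < κ) (hκ1 : κ ≤ 1) (hB0 : 0 ≤ B)
    (hB : ∀ w, 0 < w → w ≤ κ → WW M σ w ≤ B) :
    Integrable (fun u => (DD U M σ κ u)^2) ∧ ∀ S : Set ℝ, MeasurableSet S →
      |(∫ u in S, (DD U M σ κ u)^2) - ∫ u in S, (hh M σ κ u)^2| ≤ 99 * κ * B := by
  obtain ⟨i1, b1⟩ := DD_diff U M hσ h1 hκ hκ1 hB0 hB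
  have i2 := hh_sq_int M hσ h1 hκ.le
  have hb := hB κ hκ le_rfl
  have i3 : Integrable (fun u => (DD U M σ κ u)^2) := by
    refine Integrable.mono' ((i1.const_mul 2).add (i2.const_mul 2)) ((DD_meas U M hσ κ).pow_const 2).aestronglyMeasurable (Eventually.of_forall fun u => ?_)
    rw [Real.norm_of_nonneg (sq_nonneg _)]
    simp only [Pi.add_apply]
    nlinarith [sq_nonneg (DD U M σ κ u - 2 * hh M σ κ u)]
  refine ⟨i3, fun S hS => ?_⟩
  rw [← integral_sub i3.integrableOn i2.integrableOn, ← Real.norm_eq_abs]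
  have i4 := (i1.const_mul (1 + κ⁻¹)).add (i2.const_mul κ)
  calc _ ≤ ∫ u in S, ((1 + κ⁻¹) * (DD U M σ κ u - hh M σ κ u)^2 + κ * (hh M σ κ u)^2) := by
        refine norm_integral_le_of_norm_le i4.integrableOn (Eventually.of_forall fun u => ?_)
        set a := DD U M σ κ u - hh M σ κ u with ha
        set b := hh M σ κ u with hb
        have : DD U M σ κ u = a + b := by rw [ha]; ring
        rw [this, Real.norm_eq_abs, abs_le]
        have e1 : 0 ≤ κ * (b + κ⁻¹ * a)^2 := by positivity
        have e2 : 0 ≤ κ * (b - κ⁻¹ * a)^2 := by positivity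
        have f1 : κ * (b + κ⁻¹ * a)^2 = κ * b^2 + 2 * a * b + κ⁻¹ * a^2 := by field_simp; ring
        have f2 : κ * (b - κ⁻¹ * a)^2 = κ * b^2 - 2 * a * b + κ⁻¹ * a^2 := by field_simp; ring
        constructor <;> nlinarith [sq_nonneg a]
    _ ≤ ∫ u, ((1 + κ⁻¹) * (DD U M σ κ u - hh M σ κ u)^2 + κ * (hh M σ κ u)^2) := by
        refine setIntegral_le_integral i4 (Eventually.of_forall fun u => ?_)
        simp only [Pi.add_apply, Pi.zero_apply]
        positivity
    _ = (1 + κ⁻¹) * (∫ u, (DD U M σ κ u - hh M σ κ u)^2) + κ * WW M σ κ := by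
        rw [integral_add (i1.const_mul _) (i2.const_mul _), integral_const_mul, integral_const_mul, WW]
    _ ≤ (1 + κ⁻¹) * (49 * κ^2 * B) + κ * B := by gcongr
    _ = 49 * κ^2 * B + 49 * κ * B + κ * B := by field_simp
    _ ≤ _ := by nlinarith [mul_nonneg hκ.le hB0]
end gen
end B1

namespace B1
open Filter Topology Metric

noncomputable def an (U : ℝ) (n : ℕ) : ℝ := ArithmeticFunction.vonMangoldt n * Real.exp (-(Real.log n) / 2 - |U - Real.log n|)
noncomputable def qd (U v : ℝ) : ℝ := Real.exp (v / 2 - |U - v|)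

lemma qd_pos (U v : ℝ) : 0 < qd U v := Real.exp_pos _

lemma an_nonneg (U : ℝ) (n : ℕ) : 0 ≤ an U n := mul_nonneg ArithmeticFunction.vonMangoldt_nonneg (Real.exp_pos _).le

lemma an_le (U : ℝ) (n : ℕ) : an U n ≤ ArithmeticFunction.vonMangoldt n * (n:ℝ)^(-(3/2:ℝ)) * Real.exp U := by
  rcases Nat.eq_zero_or_pos n with rfl | hn
  · simp [an]
  have hn' : (0:ℝ) < n := by exact_mod_cast hn
  unfold an
  rw [mul_assoc]
  refine mul_le_mul_of_nonneg_left ?_ ArithmeticFunction.vonMangoldt_nonneg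
  rw [Real.rpow_def_of_pos hn', ← Real.exp_add]
  refine Real.exp_le_exp.2 ?_
  have := neg_le_abs (U - Real.log n)
  linarith

lemma an_sum (U : ℝ) : Summable (an U) :=
  Summable.of_nonneg_of_le (an_nonneg U) (an_le U) (lam_sum.mul_right _)

lemma qd_cont (U : ℝ) : Continuous (qd U) := by unfold qd; fun_prop

lemma qd_le (U v : ℝ) : qd U v ≤ Real.exp U * Real.exp (-(1/2) * v) := by
  unfold qd
  rw [← Real.exp_add]
  refine Real.exp_le_exp.2 ?_
  have := neg_le_abs (U - v)
  linarith

lemma qd_int (U : ℝ) : IntegrableOn (qd U) (Set.Ioi 0) := by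
  have h : IntegrableOn (fun v => Real.exp U * Real.exp (-(1/2) * v)) (Set.Ioi 0) :=
    Integrable.const_mul (exp_neg_integrableOn_Ioi 0 (by norm_num)) _
  refine Integrable.mono' h (qd_cont U).aestronglyMeasurable (Eventually.of_forall fun v => ?_)
  rw [Real.norm_of_nonneg (qd_pos U v).le]
  exact qd_le U v

noncomputable def MP (U : ℝ) : Measure ℝ := Measure.sum (fun n : ℕ => ENNReal.ofReal (an U n) • Measure.dirac (Real.log n))
noncomputable def MQ (U : ℝ) : Measure ℝ := (volume.restrict (Set.Ioi (0:ℝ))).withDensity (fun v => ENNReal.ofReal (qd U v))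

instance MP_fin (U : ℝ) : IsFiniteMeasure (MP U) := by
  refine ⟨?_⟩
  unfold MP
  rw [Measure.sum_apply _ MeasurableSet.univ]
  simp only [Measure.smul_apply, measure_univ, smul_eq_mul, mul_one]
  exact (an_sum U).tsum_ofReal_lt_top

instance MQ_fin (U : ℝ) : IsFiniteMeasure (MQ U) :=
  isFiniteMeasure_withDensity_ofReal (qd_int U).2

noncomputable def MM (U : ℝ) : Measure ℝ := MP U + MQ U

instance MM_fin (U : ℝ) : IsFiniteMeasure (MM U) := by unfold MM; infer_instance

noncomputable def sg (v : ℝ) : ℝ := if v ∈ Set.range (fun n : ℕ => Real.log n) then 1 else -1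

lemma cnt : (Set.range (fun n : ℕ => Real.log n)).Countable := Set.countable_range _

lemma sg_meas : Measurable sg := by
  unfold sg
  exact Measurable.ite cnt.measurableSet measurable_const measurable_const

lemma sg_abs (v : ℝ) : |sg v| ≤ 1 := by unfold sg; split_ifs <;> simp

lemma sg_log (n : ℕ) : sg (Real.log n) = 1 := by unfold sg; rw [if_pos ⟨n, rfl⟩]

lemma MM_integral {E : Type*} [NormedAddCommGroup E] [NormedSpace ℝ E] [FiniteDimensional ℝ E] (U : ℝ) {f : ℝ → E}
    (hf : StronglyMeasurable f) {B : ℝ} (hB : ∀ v, ‖f v‖ ≤ B) :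
    ∫ v, sg v • f v ∂(MM U) = (∑' n, an U n • f (Real.log n)) - ∫ v in Set.Ioi 0, qd U v • f v := by
  have hb : ∀ v, ‖sg v • f v‖ ≤ B := fun v => by
    rw [norm_smul, Real.norm_eq_abs]
    have := sg_abs v
    have h1 := norm_nonneg (f v)
    nlinarith [hB v]
  have hm : StronglyMeasurable (fun v => sg v • f v) := sg_meas.stronglyMeasurable.smul hf
  have hi : ∀ (μ : Measure ℝ) [IsFiniteMeasure μ], Integrable (fun v => sg v • f v) μ := fun μ _ =>
    Integrable.mono' (integrable_const B) hm.aestronglyMeasurable (Eventually.of_forall hb)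
  unfold MM
  rw [integral_add_measure (hi _) (hi _), sub_eq_add_neg]
  congr 1
  · unfold MP
    rw [integral_sum_dirac (fun i => ENNReal.ofReal_ne_top)]
    congr 1; ext n
    rw [sg_log, one_smul, ENNReal.toReal_ofReal (an_nonneg U n)]
  · unfold MQ
    rw [integral_withDensity_eq_integral_toReal_smul (qd_cont U).measurable.ennreal_ofReal (Eventually.of_forall fun v => ENNReal.ofReal_lt_top), ← integral_neg]
    refine integral_congr_ae ?_
    have h0 : ∀ᵐ v ∂(volume.restrict (Set.Ioi (0:ℝ))), v ∉ Set.range (fun n : ℕ => Real.log n) :=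
      ae_restrict_of_ae (cnt.ae_notMem volume)
    filter_upwards [h0] with v hv
    rw [ENNReal.toReal_ofReal (qd_pos U v).le, sg, if_neg hv, neg_one_smul, smul_neg]

lemma MM_univ : ∃ C : ℝ, 0 < C ∧ ∀ U, (MM U).real Set.univ ≤ C * Real.exp U := by
  refine ⟨(∑' n : ℕ, ArithmeticFunction.vonMangoldt n * (n:ℝ)^(-(3/2:ℝ))) + 2, ?_, fun U => ?_⟩
  · have : 0 ≤ ∑' n : ℕ, ArithmeticFunction.vonMangoldt n * (n:ℝ)^(-(3/2:ℝ)) :=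
      tsum_nonneg fun n => mul_nonneg ArithmeticFunction.vonMangoldt_nonneg (by positivity)
    linarith
  have e1 : (MP U).real Set.univ = ∑' n, an U n := by
    have := integral_sum_dirac (f := fun _ : ℝ => (1:ℝ)) (x := fun n : ℕ => Real.log n) (c := fun n => ENNReal.ofReal (an U n)) (fun i => ENNReal.ofReal_ne_top)
    have h2 : ∫ v, (1:ℝ) ∂(MP U) = (MP U).real Set.univ := by simp
    rw [← h2]
    unfold MP
    rw [this]
    congr 1; ext n
    rw [ENNReal.toReal_ofReal (an_nonneg U n)]; simp
  have e2 : (MQ U).real Set.univ = ∫ v in Set.Ioi 0, qd U v := by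
    have h2 : ∫ v, (1:ℝ) ∂(MQ U) = (MQ U).real Set.univ := by simp
    rw [← h2]
    unfold MQ
    rw [integral_withDensity_eq_integral_toReal_smul (qd_cont U).measurable.ennreal_ofReal (Eventually.of_forall fun v => ENNReal.ofReal_lt_top)]
    congr 1; ext v
    rw [ENNReal.toReal_ofReal (qd_pos U v).le]; simp
  have e3 : (MM U).real Set.univ = (MP U).real Set.univ + (MQ U).real Set.univ := by
    unfold MM; rw [measureReal_add_apply]
  rw [e3, e1, e2, add_mul]
  refine add_le_add ?_ ?_
  · rw [← tsum_mul_right]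
    exact (an_sum U).tsum_le_tsum (an_le U) (lam_sum.mul_right _)
  · have h : IntegrableOn (fun v => Real.exp U * Real.exp (-(1/2) * v)) (Set.Ioi 0) :=
      Integrable.const_mul (exp_neg_integrableOn_Ioi 0 (by norm_num)) _
    have h3 := integral_mono (μ := volume.restrict (Set.Ioi (0:ℝ))) (qd_int U) h (fun v => qd_le U v)
    refine h3.trans ?_
    rw [integral_const_mul, integral_exp_mul_Ioi (by norm_num)]
    simp; rw [mul_comm]

lemma ST_MM (U t : ℝ) : ST (MM U) sg t = SS U t := by
  unfold ST SS
  have hc : Continuous (fun v : ℝ => Complex.exp (-(t * v : ℝ) * Complex.I)) := by fun_prop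
  have hb : ∀ v : ℝ, ‖Complex.exp (-(t * v : ℝ) * Complex.I)‖ ≤ 1 := fun v => by
    rw [show -((t * v : ℝ):ℂ) * Complex.I = ((-(t*v) : ℝ):ℂ) * Complex.I by push_cast; ring, Complex.norm_exp_ofReal_mul_I]
  have := MM_integral U hc.stronglyMeasurable hb
  have e : ∀ v : ℝ, Complex.exp (-(t * v : ℝ) * Complex.I) * (sg v : ℂ) = sg v • Complex.exp (-(t * v : ℝ) * Complex.I) := fun v => by
    rw [Complex.real_smul, mul_comm]
  simp_rw [e]
  rw [this]
  congr 1
  · congr 1; ext n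
    rw [Complex.real_smul]
    unfold an
    push_cast
    rw [mul_assoc, mul_assoc, ← Complex.exp_add, ← Complex.exp_add]
    congr 2
    ring
  · refine integral_congr_ae (Eventually.of_forall fun v => ?_)
    beta_reduce
    rw [Complex.real_smul]
    unfold qd
    push_cast
    rw [← Complex.exp_add, ← Complex.exp_add, abs_sub_comm U v]
    congr 1
    ring

lemma psi_eq (x : ℝ) (N : ℕ) (hN : ⌊x⌋₊ + 1 ≤ N) (hx : 0 ≤ x) :
    chebyshevPsi x = ∑ n ∈ Finset.range N, ArithmeticFunction.vonMangoldt n * (if (n:ℝ) ≤ x then 1 else 0) := by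
  unfold chebyshevPsi
  rw [← Finset.sum_subset (Finset.range_subset_range.2 hN)]
  · refine Finset.sum_congr rfl fun n hn => ?_
    rw [Finset.mem_range, Nat.lt_succ_iff] at hn
    rw [if_pos ((Nat.le_floor_iff hx).1 hn), mul_one]
  · intro n _ hn
    rw [Finset.mem_range, Nat.lt_succ_iff, Nat.le_floor_iff hx] at hn
    rw [if_neg hn, mul_zero]

lemma psi_diff {a b : ℝ} (ha : 0 < a) (hab : a ≤ b) :
    chebyshevPsi b - chebyshevPsi a = ∑' n : ℕ, ArithmeticFunction.vonMangoldt n * (if a < (n:ℝ) ∧ (n:ℝ) ≤ b then 1 else 0) := by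
  rw [tsum_eq_sum (s := Finset.range (⌊b⌋₊ + 1)), psi_eq b _ le_rfl (ha.le.trans hab),
    psi_eq a (⌊b⌋₊ + 1) (by have := Nat.floor_le_floor hab; omega) ha.le, ← Finset.sum_sub_distrib]
  · refine Finset.sum_congr rfl fun n _ => ?_
    rw [← mul_sub]
    congr 1
    by_cases h1 : (n:ℝ) ≤ a
    · rw [if_pos h1, if_pos (h1.trans hab), if_neg (fun h => absurd h.1 (not_lt.2 h1))]; norm_num
    · by_cases h2 : (n:ℝ) ≤ b
      · rw [if_neg h1, if_pos h2, if_pos ⟨not_le.1 h1, h2⟩]; norm_num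
      · rw [if_neg h1, if_neg h2, if_neg (fun h => h2 h.2)]; norm_num
  · intro n hn
    rw [Finset.mem_range, Nat.lt_succ_iff, Nat.le_floor_iff (ha.le.trans hab)] at hn
    rw [if_neg (fun h => hn h.2), mul_zero]

lemma DD_psi (U : ℝ) {κ u : ℝ} (hu : 0 ≤ u) (hκ : 0 ≤ κ) (hκ1 : κ ≤ 1) :
    DD U (MM U) sg κ u = Real.exp (-|U - u| - u/2) *
      (chebyshevPsi (Real.exp (u + κ)) - chebyshevPsi (Real.exp u) - (Real.exp (u + κ) - Real.exp u)) := by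
  unfold DD
  have hm : Measurable (fun v => hker κ u v * rho U u v) :=
    (hker_meas measurable_const measurable_const measurable_id).mul (rho_meas U measurable_const measurable_id)
  have hb : ∀ v, ‖hker κ u v * rho U u v‖ ≤ 9/2 := fun v => by
    unfold hker
    split_ifs with h
    · rw [one_mul, Real.norm_of_nonneg (show 0 ≤ rho U u v from (Real.exp_pos _).le)]
      exact rho_bound h.1.le h.2 hκ1
    · norm_num
  have := MM_integral U hm.stronglyMeasurable hb
  simp_rw [smul_eq_mul] at this
  simp_rw [mul_comm _ (sg _)]
  rw [this, psi_diff (Real.exp_pos u) (Real.exp_le_exp.2 (by linarith)), mul_sub, ← tsum_mul_left]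
  congr 1
  · congr 1; ext n
    rcases Nat.eq_zero_or_pos n with rfl | hn
    · simp [an]
    have hn' : (0:ℝ) < n := by exact_mod_cast hn
    unfold hker
    simp_rw [← Real.lt_log_iff_exp_lt hn', ← Real.log_le_iff_le_exp hn']
    split_ifs with h
    · unfold an rho
      rw [one_mul, mul_one, mul_assoc, ← Real.exp_add, mul_comm]
      congr 2
      rw [abs_sub_comm U, abs_sub_comm U]
      ring
    · simp
  · have e : ∀ v, qd U v * (hker κ u v * rho U u v) = Set.indicator (Set.Ioc u (u+κ)) (fun v => Real.exp (-|U - u| - u/2) * Real.exp v) v := by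
      intro v
      unfold hker
      by_cases h : u < v ∧ v ≤ u + κ
      · rw [if_pos h, Set.indicator_of_mem (by exact h)]
        unfold qd rho
        rw [one_mul, ← Real.exp_add, ← Real.exp_add]
        congr 1
        rw [abs_sub_comm U, abs_sub_comm U]
        ring
      · rw [if_neg h, Set.indicator_of_notMem (by exact h)]; simp
    simp_rw [e]
    rw [integral_indicator measurableSet_Ioc, Measure.restrict_restrict measurableSet_Ioc,
      Set.inter_eq_left.2 (show Set.Ioc u (u+κ) ⊆ Set.Ioi 0 from fun x hx => lt_of_le_of_lt hu hx.1), integral_const_mul,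
      ← intervalIntegral.integral_of_le (by linarith), integral_exp]

lemma hh_neg (U : ℝ) {κ u : ℝ} (hu : u ≤ 0) (hκ : 0 ≤ κ) (hκ1 : κ ≤ 1/2) :
    |hh (MM U) sg κ u| ≤ 2 * κ ∧ (u ≤ -κ → hh (MM U) sg κ u = 0) := by
  unfold hh
  have hm : Measurable (fun v => hker κ u v) :=
    (hker_meas measurable_const measurable_const measurable_id)
  have := MM_integral U hm.stronglyMeasurable (B := 1) (fun v => hker_abs κ u v)
  simp_rw [smul_eq_mul] at this
  simp_rw [mul_comm _ (sg _)]
  have hz : ∑' n, an U n * hker κ u (Real.log n) = 0 := by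
    refine (tsum_congr (g := fun _ => (0:ℝ)) fun n => ?_).trans tsum_zero
    rcases lt_or_ge n 2 with h | h
    · interval_cases n <;> simp [an]
    · have h2 : Real.log 2 ≤ Real.log n := Real.log_le_log (by norm_num) (by exact_mod_cast h)
      have := Real.log_two_gt_d9
      unfold hker
      rw [if_neg, mul_zero]
      intro h3
      linarith [h3.2]
  rw [this, hz, zero_sub, abs_neg]
  have e : ∀ v ∈ Set.Ioi (0:ℝ), qd U v * hker κ u v = Set.indicator (Set.Ioc u (u+κ)) (qd U) v := by
    intro v _
    unfold hker
    by_cases h : u < v ∧ v ≤ u + κ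
    · rw [if_pos h, Set.indicator_of_mem (by exact h), mul_one]
    · rw [if_neg h, Set.indicator_of_notMem (by exact h), mul_zero]
  rw [setIntegral_congr_fun measurableSet_Ioi e, integral_indicator measurableSet_Ioc, Measure.restrict_restrict measurableSet_Ioc]
  constructor
  · rw [← Real.norm_eq_abs]
    refine (norm_setIntegral_le_of_norm_le_const (C := 2) (μ := volume) (s := Set.Ioc u (u + κ) ∩ Set.Ioi 0) ?_ ?_).trans ?_
    · exact (measure_mono Set.inter_subset_left).trans_lt measure_Ioc_lt_top
    · intro v hv
      rw [Real.norm_of_nonneg (qd_pos U v).le]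
      have h1 : v / 2 - |U - v| ≤ 1/4 := by linarith [abs_nonneg (U - v), hv.1.2]
      refine (Real.exp_le_exp.2 h1).trans ?_
      have := Real.exp_bound_div_one_sub_of_interval (x := 1/4) (by norm_num) (by norm_num)
      linarith
    · refine mul_le_mul_of_nonneg_left ?_ (by norm_num)
      refine (measureReal_mono Set.inter_subset_left measure_Ioc_lt_top.ne).trans ?_
      simp [hκ]
  · intro h
    rw [show Set.Ioc u (u + κ) ∩ Set.Ioi 0 = ∅ from ?_]
    · simp
    · ext v; simp only [Set.mem_inter_iff, Set.mem_Ioc, Set.mem_Ioi, Set.mem_empty_iff_false, iff_false]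
      intro h3; linarith [h3.1.2, h3.2]

lemma hh_neg_int (U : ℝ) {κ : ℝ} (hκ : 0 ≤ κ) (hκ1 : κ ≤ 1/2) :
    |∫ u in Set.Iic 0, (hh (MM U) sg κ u)^2| ≤ 4 * κ^3 := by
  have e : ∫ u in Set.Iic 0, (hh (MM U) sg κ u)^2 = ∫ u in Set.Ioc (-κ) 0, (hh (MM U) sg κ u)^2 := by
    refine setIntegral_eq_of_subset_of_forall_sdiff_eq_zero measurableSet_Iic (fun x hx => hx.2) ?_
    intro x hx
    have h1 : x ≤ 0 := hx.1
    have h2 : x ≤ -κ := by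
      by_contra h
      exact hx.2 ⟨not_le.1 h, h1⟩
    rw [(hh_neg U h1 hκ hκ1).2 h2]; norm_num
  rw [e, ← Real.norm_eq_abs]
  refine (norm_setIntegral_le_of_norm_le_const (C := (2*κ)^2) measure_Ioc_lt_top ?_).trans ?_
  · intro u hu
    rw [Real.norm_of_nonneg (sq_nonneg _)]
    exact sq_le_sq' (by linarith [neg_le_of_abs_le (hh_neg U hu.2 hκ hκ1).1]) (le_of_abs_le (hh_neg U hu.2 hκ hκ1).1)
  · have : volume.real (Set.Ioc (-κ) 0) = κ := by simp [hκ]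
    rw [this]; apply le_of_eq; ring

end B1

namespace B1
open Filter Topology Metric

noncomputable def LL (κ : ℝ) : ℝ := Real.log (1 / κ) + 1 - Real.eulerMascheroniConstant - Real.log (2 * π)
noncomputable def GG (δ u : ℝ) : ℝ := Real.exp u * (chebyshevPsi (Real.exp u + δ * Real.exp u) - chebyshevPsi (Real.exp u) - δ * Real.exp u)^2
noncomputable def Vl (δ x : ℝ) : ℝ := ∫ u in Set.Ioc 0 x, GG δ u
noncomputable def PP (U κ : ℝ) : ℝ := ∫ u in Set.Ioi 0, (DD U (MM U) sg κ u)^2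

lemma GG_nonneg (δ u : ℝ) : 0 ≤ GG δ u := mul_nonneg (Real.exp_pos _).le (sq_nonneg _)

lemma psi_mono : Monotone chebyshevPsi := by
  intro a b h
  unfold chebyshevPsi
  refine Finset.sum_le_sum_of_subset_of_nonneg (Finset.range_subset_range.2 ?_) fun n _ _ => ArithmeticFunction.vonMangoldt_nonneg
  have := Nat.floor_le_floor h
  omega

lemma GG_meas (δ : ℝ) : Measurable (GG δ) := by
  unfold GG
  have h := psi_mono.measurable
  have h1 : Measurable (fun u : ℝ => chebyshevPsi (Real.exp u + δ * Real.exp u)) := h.comp (by fun_prop)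
  have h2 : Measurable (fun u : ℝ => chebyshevPsi (Real.exp u)) := h.comp (by fun_prop)
  have h3 : Measurable (fun u : ℝ => δ * Real.exp u) := by fun_prop
  exact Real.measurable_exp.mul (((h1.sub h2).sub h3).pow_const 2)

lemma Vl_eq (δ : ℝ) {x : ℝ} (hx : 0 ≤ x) : Vl δ x = zetaVarDelta (Real.exp x) δ := by
  unfold Vl zetaVarDelta
  rw [intervalIntegral.integral_of_le (Real.one_le_exp hx)]
  have him : Real.exp '' (Set.Ioc 0 x) = Set.Ioc 1 (Real.exp x) := by
    ext y
    constructor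
    · rintro ⟨u, hu, rfl⟩
      exact ⟨by simpa using hu.1, Real.exp_le_exp.2 hu.2⟩
    · intro hy
      have : 0 < y := by linarith [hy.1]
      exact ⟨Real.log y, ⟨Real.log_pos hy.1, (Real.log_le_iff_le_exp this).2 hy.2⟩, Real.exp_log this⟩
  rw [← him, integral_image_eq_integral_abs_deriv_smul measurableSet_Ioc (fun u _ => (Real.hasDerivAt_exp u).hasDerivWithinAt) Real.exp_injective.injOn]
  refine integral_congr_ae (Eventually.of_forall fun u => ?_)
  simp only [GG, abs_of_pos (Real.exp_pos u), smul_eq_mul]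

lemma DD_GG (U : ℝ) {κ u : ℝ} (hu : 0 ≤ u) (hκ : 0 ≤ κ) (hκ1 : κ ≤ 1) :
    (DD U (MM U) sg κ u)^2 = Real.exp (2 * U - 4 * max u U) * GG (Real.exp κ - 1) u := by
  rw [DD_psi U hu hκ hκ1, mul_pow, GG, ← mul_assoc, ← Real.exp_add, ← Real.exp_nat_mul]
  have e1 : Real.exp u + (Real.exp κ - 1) * Real.exp u = Real.exp (u + κ) := by rw [Real.exp_add]; ring
  have e2 : (Real.exp κ - 1) * Real.exp u = Real.exp (u + κ) - Real.exp u := by rw [Real.exp_add]; ring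
  rw [e1, e2]
  congr 2
  push_cast
  rcases le_total u U with h | h
  · rw [max_eq_right h, abs_of_nonneg (by linarith)]; ring
  · rw [max_eq_left h, abs_of_nonpos (by linarith)]; ring

/-- kernel for Fubini -/
noncomputable def kk (U u x : ℝ) : ℝ := Set.indicator (Set.Ioi (max u U)) (fun x => 4 * Real.exp (2 * U - 4 * x)) x

lemma kk_int (U u : ℝ) : Integrable (kk U u) ∧ ∫ x, kk U u x = Real.exp (2 * U - 4 * max u U) := by
  have e : ∀ x, 4 * Real.exp (2 * U - 4 * x) = (4 * Real.exp (2 * U)) * Real.exp (-4 * x) := fun x => by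
    rw [mul_assoc, ← Real.exp_add]; congr 2; ring
  unfold kk
  constructor
  · refine IntegrableOn.integrable_indicator ?_ measurableSet_Ioi
    simp_rw [e]
    exact Integrable.const_mul (integrableOn_exp_mul_Ioi (by norm_num) _) _
  · rw [integral_indicator measurableSet_Ioi]
    simp_rw [e]
    rw [integral_const_mul, integral_exp_mul_Ioi (by norm_num), show 2 * U - 4 * max u U = 2 * U + (-4 * max u U) by ring, Real.exp_add]
    ring

lemma kk_nonneg (U u x : ℝ) : 0 ≤ kk U u x := Set.indicator_nonneg (fun _ _ => by positivity) _

lemma PP_V (U : ℝ) {κ : ℝ} (hU : 0 < U) (hκ : 0 ≤ κ) (hκ1 : κ ≤ 1) (hi : Integrable (fun u => (DD U (MM U) sg κ u)^2)) :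
    IntegrableOn (fun x => 4 * Real.exp (2 * U - 4 * x) * Vl (Real.exp κ - 1) x) (Set.Ioi U) ∧
    PP U κ = ∫ x in Set.Ioi U, 4 * Real.exp (2 * U - 4 * x) * Vl (Real.exp κ - 1) x := by
  set δ := Real.exp κ - 1
  have hkm : Measurable (fun p : ℝ × ℝ => kk U p.1 p.2) := by
    unfold kk
    have : (fun p : ℝ × ℝ => (Set.Ioi (max p.1 U)).indicator (fun x => 4 * Real.exp (2 * U - 4 * x)) p.2) =
      Set.indicator {p : ℝ × ℝ | max p.1 U < p.2} (fun p => 4 * Real.exp (2 * U - 4 * p.2)) := by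
      ext p; simp [Set.indicator]
    rw [this]
    refine Measurable.indicator (by fun_prop) (measurableSet_lt (by fun_prop) (by fun_prop))
  have hi' : IntegrableOn (fun u => Real.exp (2 * U - 4 * max u U) * GG δ u) (Set.Ioi 0) := by
    refine IntegrableOn.congr_fun hi.integrableOn (fun u hu => ?_) measurableSet_Ioi
    exact DD_GG U (le_of_lt hu) hκ hκ1
  have hprod : Integrable (Function.uncurry (fun u x => kk U u x * GG δ u)) ((volume.restrict (Set.Ioi (0:ℝ))).prod volume) := by
    have hm : AEStronglyMeasurable (Function.uncurry (fun u x => kk U u x * GG δ u)) ((volume.restrict (Set.Ioi (0:ℝ))).prod volume) :=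
      (hkm.mul ((GG_meas δ).comp measurable_fst)).aestronglyMeasurable
    rw [integrable_prod_iff hm]
    constructor
    · exact Eventually.of_forall fun u => (kk_int U u).1.mul_const (GG δ u)
    · refine hi'.congr (Eventually.of_forall fun u => ?_)
      simp only [Function.uncurry_apply_pair]
      rw [← (kk_int U u).2, ← integral_mul_const]
      refine integral_congr_ae (Eventually.of_forall fun x => ?_)
      beta_reduce
      rw [Real.norm_of_nonneg (mul_nonneg (kk_nonneg _ _ _) (GG_nonneg _ _))]
  have hinner : ∀ x, ∫ u in Set.Ioi 0, kk U u x * GG δ u = Set.indicator (Set.Ioi U) (fun x => 4 * Real.exp (2 * U - 4 * x) * Vl δ x) x := by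
    intro x
    by_cases hx : U < x
    · rw [Set.indicator_of_mem (by exact hx), Vl, ← integral_const_mul]
      have e : ∀ u, kk U u x * GG δ u = Set.indicator (Set.Iio x) (fun u => 4 * Real.exp (2 * U - 4 * x) * GG δ u) u := by
        intro u
        unfold kk
        by_cases hu : u < x
        · rw [Set.indicator_of_mem (show x ∈ Set.Ioi (max u U) from max_lt hu hx), Set.indicator_of_mem (by exact hu)]
        · rw [Set.indicator_of_notMem (show x ∉ Set.Ioi (max u U) from fun h => hu (lt_of_le_of_lt (le_max_left _ _) h)), Set.indicator_of_notMem (by exact hu), zero_mul]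
      simp_rw [e]
      rw [integral_indicator measurableSet_Iio, Measure.restrict_restrict measurableSet_Iio, integral_Ioc_eq_integral_Ioo]
      congr 2
      ext u; simp [and_comm]
    · rw [Set.indicator_of_notMem (by exact hx)]
      have e : ∀ u, kk U u x * GG δ u = 0 := fun u => by
        unfold kk
        rw [Set.indicator_of_notMem (show x ∉ Set.Ioi (max u U) from fun h => hx (lt_of_le_of_lt (le_max_right _ _) h)), zero_mul]
      simp_rw [e]; simp
  constructor
  · have := hprod.integral_prod_right
    rw [← integrable_indicator_iff measurableSet_Ioi]
    refine this.congr (Eventually.of_forall fun x => ?_)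
    exact hinner x
  · have hs := integral_integral_swap hprod
    unfold PP
    rw [setIntegral_congr_fun measurableSet_Ioi (fun u (hu : 0 < u) => DD_GG U hu.le hκ hκ1), ← integral_indicator (s := Set.Ioi U) measurableSet_Ioi]
    rw [← integral_congr_ae (Eventually.of_forall hinner), ← hs]
    refine integral_congr_ae (Eventually.of_forall fun u => ?_)
    beta_reduce
    rw [integral_mul_const, (kk_int U u).2]

lemma Vl_le_PP {x κ : ℝ} (hx : 0 < x) (hκ : 0 ≤ κ) (hκ1 : κ ≤ 1) (hi : Integrable (fun u => (DD x (MM x) sg κ u)^2)) :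
    Vl (Real.exp κ - 1) x ≤ Real.exp (2 * x) * PP x κ := by
  have h1 : ∫ u in Set.Ioc 0 x, (DD x (MM x) sg κ u)^2 ≤ PP x κ := by
    unfold PP
    refine setIntegral_mono_set hi.integrableOn (Eventually.of_forall fun u => sq_nonneg _) (Eventually.of_forall ?_)
    intro u hu; exact hu.1
  have h2 : ∫ u in Set.Ioc 0 x, (DD x (MM x) sg κ u)^2 = Real.exp (-2 * x) * Vl (Real.exp κ - 1) x := by
    unfold Vl
    rw [← integral_const_mul]
    refine setIntegral_congr_fun measurableSet_Ioc fun u hu => ?_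
    beta_reduce
    rw [DD_GG x hu.1.le hκ hκ1, max_eq_right hu.2]
    congr 2; ring
  rw [h2] at h1
  calc _ = Real.exp (2 * x) * (Real.exp (-2*x) * Vl (Real.exp κ - 1) x) := by
        rw [← mul_assoc, ← Real.exp_add]; simp
    _ ≤ _ := mul_le_mul_of_nonneg_left h1 (Real.exp_pos _).le

/-- uniform constant bundle -/
lemma W_PP (hRH : RiemannHypothesis) {η : ℝ} (hη : 0 < η) (hη1 : η ≤ 1/8) :
    ∃ C : ℝ, 0 < C ∧ ∀ U κ, 0 < U → 0 < κ → κ ≤ 1/2 →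
      WW (MM U) sg κ ≤ C * κ^(1-2*η) ∧ Integrable (fun u => (DD U (MM U) sg κ u)^2) ∧
      |PP U κ - WW (MM U) sg κ| ≤ C * κ^(2-2*η) := by
  obtain ⟨C, hC, hb⟩ := SS_bound hRH hη (by linarith)
  set K := 12 * C^2 * Kc (2*η)
  have hK : 0 ≤ K := mul_nonneg (by positivity) (Kc_nonneg _)
  refine ⟨99 * K + 4 + K, by positivity, fun U κ hU hκ hκ1 => ?_⟩
  have hst : ST (MM U) sg = SS U := funext (ST_MM U)
  have hsm : ∀ w, 0 < w → w ≤ 1 → WW (MM U) sg w ≤ K * w^(1-2*η) := fun w hw hw1 =>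
    W_small (MM U) sg_meas sg_abs (by rw [hst]; exact SS_cont hU.le) hC.le hη.le hη1 (fun t => by rw [ST_MM]; exact hb U t hU) hw hw1
  have hp1 : 0 ≤ κ^(1-2*η) := by positivity
  have hp2 : 0 ≤ κ^(2-2*η) := by positivity
  obtain ⟨hi, hcomp⟩ := DD_comp U (MM U) sg_meas sg_abs hκ (by linarith) (B := K * κ^(1-2*η)) (by positivity) (fun w hw hwκ =>
    (hsm w hw (by linarith)).trans (mul_le_mul_of_nonneg_left (Real.rpow_le_rpow hw.le hwκ (by linarith)) hK))
  refine ⟨(hsm κ hκ (by linarith)).trans (by nlinarith), hi, ?_⟩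
  have h1 := hcomp (Set.Ioi 0) measurableSet_Ioi
  have h2 := hh_neg_int U hκ.le hκ1
  have h3 : WW (MM U) sg κ = (∫ u in Set.Iic 0, (hh (MM U) sg κ u)^2) + ∫ u in Set.Ioi 0, (hh (MM U) sg κ u)^2 := by
    unfold WW
    rw [← integral_add_compl measurableSet_Iic (hh_sq_int (MM U) sg_meas sg_abs hκ.le), Set.compl_Iic]
  have h4 : κ * κ^(1-2*η) = κ^(2-2*η) := by
    rw [← Real.rpow_one_add' hκ.le (by linarith)]; congr 1; ring
  have h5 : κ^3 ≤ κ^(2-2*η) := by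
    rw [← Real.rpow_natCast κ 3]
    exact Real.rpow_le_rpow_of_exponent_ge hκ (by linarith) (by push_cast; linarith)
  unfold PP
  rw [abs_le] at h1 h2 ⊢
  rw [h3]
  have h6 : 99 * κ * (K * κ^(1-2*η)) = 99 * K * κ^(2-2*η) := by rw [← h4]; ring
  rw [h6] at h1
  have h7 : 0 ≤ K * κ^(2-2*η) := by positivity
  constructor
  · nlinarith [h1.1, h2.2]
  · nlinarith [h1.2, h2.1]

end B1

namespace B1
open Filter Topology Metric

noncomputable def cL : ℝ := |1 - Real.eulerMascheroniConstant - Real.log (2 * π)|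

lemma LL_abs (κ : ℝ) : |LL κ| ≤ |Real.log κ| + cL := by
  unfold LL cL
  rw [one_div, Real.log_inv, ← abs_neg (Real.log κ)]
  rw [show -Real.log κ + 1 - Real.eulerMascheroniConstant - Real.log (2 * π) = -Real.log κ + (1 - Real.eulerMascheroniConstant - Real.log (2 * π)) by ring]
  exact abs_add_le _ _

lemma LL_bound {η : ℝ} (hη : 0 < η) : ∃ C : ℝ, 0 < C ∧ ∀ κ : ℝ, 0 < κ → κ ≤ 1 → |LL κ| ≤ C * κ^(-(2*η)) := by
  refine ⟨(2*η)⁻¹ + cL, by have : 0 ≤ cL := abs_nonneg _; positivity, fun κ hκ hκ1 => ?_⟩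
  refine (LL_abs κ).trans ?_
  have h1 : 1 ≤ κ^(-(2*η)) := Real.one_le_rpow_of_pos_of_le_one_of_nonpos hκ hκ1 (by linarith)
  have h2 : |Real.log κ| ≤ (2*η)⁻¹ * κ^(-(2*η)) := by
    rw [abs_of_nonpos (Real.log_nonpos hκ.le hκ1), ← Real.log_inv]
    refine (Real.log_le_rpow_div (inv_pos.2 hκ).le (show 0 < 2*η by linarith)).trans ?_
    rw [Real.inv_rpow hκ.le, ← Real.rpow_neg hκ.le, div_eq_inv_mul]
  have h3 : 0 ≤ cL := abs_nonneg _
  nlinarith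

lemma exp_sub {κ : ℝ} (hκ : 0 < κ) (hκ1 : κ ≤ 1/2) : κ ≤ Real.exp κ - 1 ∧ Real.exp κ - 1 ≤ κ + κ^2 ∧ Real.exp κ - 1 ≤ 2 * κ ∧ Real.exp κ - 1 ≤ 1 := by
  have h1 := Real.add_one_le_exp κ
  have h2 := (abs_le.1 (Real.abs_exp_sub_one_sub_id_le (x := κ) (by rw [abs_of_pos hκ]; linarith))).2
  refine ⟨by linarith, by linarith, by nlinarith, by nlinarith⟩

lemma kL_diff {η : ℝ} (hη : 0 < η) (hη1 : η ≤ 1/8) : ∃ C : ℝ, 0 < C ∧ ∀ κ : ℝ, 0 < κ → κ ≤ 1/2 →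
    |(Real.exp κ - 1) * LL (Real.exp κ - 1) - κ * LL κ| ≤ C * κ^(2-2*η) := by
  obtain ⟨C, hC, h⟩ := LL_bound hη
  refine ⟨C + 1, by linarith, fun κ hκ hκ1 => ?_⟩
  obtain ⟨a1, a2, a3, a4⟩ := exp_sub hκ hκ1
  set δ := Real.exp κ - 1
  have hδ : 0 < δ := by linarith
  have e : δ * LL δ - κ * LL κ = (δ - κ) * LL δ - κ * Real.log (δ / κ) := by
    unfold LL
    rw [Real.log_div hδ.ne' hκ.ne', one_div, one_div, Real.log_inv, Real.log_inv]; ring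
  have b1 : |LL δ| ≤ C * κ^(-(2*η)) := (h δ hδ a4).trans
    (mul_le_mul_of_nonneg_left (Real.rpow_le_rpow_of_nonpos hκ a1 (by linarith)) hC.le)
  have b2 : 0 ≤ Real.log (δ / κ) := Real.log_nonneg ((one_le_div hκ).2 a1)
  have b3 : Real.log (δ / κ) ≤ κ := by
    refine (Real.log_le_sub_one_of_pos (by positivity)).trans ?_
    rw [sub_le_iff_le_add, div_le_iff₀ hκ]; nlinarith
  have e2 : κ^2 * κ^(-(2*η)) = κ^(2-2*η) := by
    rw [← Real.rpow_natCast κ 2, ← Real.rpow_add hκ]; congr 1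
  have e3 : κ^2 ≤ κ^(2-2*η) := by
    rw [← Real.rpow_natCast κ 2]
    exact Real.rpow_le_rpow_of_exponent_ge hκ (by linarith) (by push_cast; linarith)
  rw [e]
  refine (abs_sub _ _).trans ?_
  rw [abs_mul, abs_mul, abs_of_nonneg (sub_nonneg.2 a1), abs_of_pos hκ, abs_of_nonneg b2]
  have c1 : (δ - κ) * |LL δ| ≤ κ^2 * (C * κ^(-(2*η))) :=
    mul_le_mul (by linarith) b1 (abs_nonneg _) (by positivity)
  have c2 : κ * Real.log (δ/κ) ≤ κ * κ := mul_le_mul_of_nonneg_left b3 hκ.le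
  have c3 : κ^2 * (C * κ^(-(2*η))) = C * κ^(2-2*η) := by rw [← e2]; ring
  nlinarith

/-- hypothesis on V, packaged -/
def HV (B₁ B₂ c D X₀ : ℝ) : Prop := ∀ X : ℝ, X₀ ≤ X → ∀ δ : ℝ, X ^ (-B₂) ≤ δ → δ ≤ X ^ (-B₁) →
      |zetaVarDelta X δ - 1 / 2 * δ * X ^ 2 *
          (Real.log (1 / δ) + 1 - Real.eulerMascheroniConstant - Real.log (2 * π))|
        ≤ D * δ ^ (1 + c) * X ^ 2

lemma V_point (hRH : RiemannHypothesis) {B₁ B₂ c D X₀ : ℝ} (hB₁ : 0 < B₁) (hB₁₂ : B₁ < B₂) (hc : 0 < c) (hV : HV B₁ B₂ c D X₀)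
    {η : ℝ} (hη : 0 < η) (hη1 : η ≤ 1/8) :
    ∃ C : ℝ, 0 < C ∧ ∀ U x κ : ℝ, 0 < U → X₀ ≤ Real.exp U → U ≤ x → Real.exp U ^ (-B₂) ≤ κ → κ ≤ 1/2 →
      |Vl (Real.exp κ - 1) x - 1/2 * (Real.exp κ - 1) * LL (Real.exp κ - 1) * Real.exp (2*x)| ≤
        C * Real.exp (2*x) * (κ^(1+c) + κ^(3-2*η) * Real.exp (2 * B₁ * x)) := by
  obtain ⟨C1, hC1, h1⟩ := W_PP hRH hη hη1
  obtain ⟨C2, hC2, h2⟩ := LL_bound hη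
  refine ⟨|D| * 2^(1+c) + 4 * (2 * C1 + C2) , by positivity, fun U x κ hU hX hx hκ hκ1 => ?_⟩
  have hκ0 : 0 < κ := lt_of_lt_of_le (by positivity) hκ
  obtain ⟨a1, a2, a3, a4⟩ := exp_sub hκ0 hκ1
  set δ := Real.exp κ - 1
  have hδ : 0 < δ := by linarith
  have hx0 : 0 < x := by linarith
  have hV0 : Vl δ x = zetaVarDelta (Real.exp x) δ := Vl_eq δ hx0.le
  have hE : 0 < Real.exp (2*x) := Real.exp_pos _
  have hE2 : Real.exp x ^ 2 = Real.exp (2*x) := by rw [← Real.exp_nat_mul]; norm_num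
  have p1 : 0 ≤ κ^(1+c) := by positivity
  have p2 : 0 ≤ κ^(3-2*η) * Real.exp (2 * B₁ * x) := by positivity
  have hlow : Real.exp x ^ (-B₂) ≤ δ := by
    refine le_trans ?_ (hκ.trans a1)
    exact Real.rpow_le_rpow_of_nonpos (Real.exp_pos _) (Real.exp_le_exp.2 hx) (by linarith)
  by_cases hd : δ ≤ Real.exp x ^ (-B₁)
  · have h := hV (Real.exp x) (hX.trans (Real.exp_le_exp.2 hx)) δ hlow hd
    rw [hE2] at h
    have e : Vl δ x - 1/2 * δ * LL δ * Real.exp (2*x) = zetaVarDelta (Real.exp x) δ - 1 / 2 * δ * Real.exp (2*x) *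
          (Real.log (1 / δ) + 1 - Real.eulerMascheroniConstant - Real.log (2 * π)) := by
      rw [hV0]; unfold LL; ring
    rw [e]
    refine h.trans ?_
    have b1 : δ^(1+c) ≤ 2^(1+c) * κ^(1+c) := by
      rw [← Real.mul_rpow (by norm_num) hκ0.le]
      exact Real.rpow_le_rpow hδ.le a3 (by linarith)
    have b2 : D * δ^(1+c) ≤ |D| * (2^(1+c) * κ^(1+c)) :=
      mul_le_mul (le_abs_self D) b1 (by positivity) (abs_nonneg _)
    have b3 : |D| * (2^(1+c) * κ^(1+c)) ≤ (|D| * 2^(1+c) + 4 * (2 * C1 + C2)) * (κ^(1+c) + κ^(3-2*η) * Real.exp (2 * B₁ * x)) := by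
      rw [← mul_assoc]
      refine mul_le_mul (by linarith) (by linarith) p1 (by positivity)
    calc D * δ^(1+c) * Real.exp (2*x) ≤ _ := mul_le_mul_of_nonneg_right (b2.trans b3) hE.le
      _ = _ := by ring
  · push Not at hd
    have g1 : 1 ≤ δ * Real.exp (B₁ * x) := by
      rw [← Real.exp_mul] at hd
      calc (1:ℝ) = Real.exp (x * -B₁) * Real.exp (B₁ * x) := by rw [← Real.exp_add, ← Real.exp_zero]; congr 1; ring
        _ ≤ _ := mul_le_mul_of_nonneg_right hd.le (Real.exp_pos _).le
    have g2 : 1 ≤ 4 * κ^2 * Real.exp (2 * B₁ * x) := by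
      have : Real.exp (2*B₁*x) = Real.exp (B₁*x)^2 := by rw [← Real.exp_nat_mul]; congr 1; push_cast; ring
      rw [this]
      have g3 : 1 ≤ 2 * κ * Real.exp (B₁ * x) := g1.trans (mul_le_mul_of_nonneg_right a3 (Real.exp_pos _).le)
      nlinarith
    obtain ⟨w1, w2, w3⟩ := h1 x κ hx0 hκ0 hκ1
    have v1 := Vl_le_PP hx0 hκ0.le (by linarith) w2
    have v0 : 0 ≤ Vl δ x := setIntegral_nonneg measurableSet_Ioc fun u _ => GG_nonneg δ u
    have q1 : κ^(2-2*η) ≤ κ^(1-2*η) := Real.rpow_le_rpow_of_exponent_ge hκ0 (by linarith) (by linarith)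
    have v2 : PP x κ ≤ 2 * C1 * κ^(1-2*η) := by
      have := (abs_le.1 w3).2
      nlinarith
    have v3 : Vl δ x ≤ Real.exp (2*x) * (2 * C1 * κ^(1-2*η)) := v1.trans (mul_le_mul_of_nonneg_left v2 hE.le)
    have l1 : |LL δ| ≤ C2 * κ^(-(2*η)) := (h2 δ hδ a4).trans
      (mul_le_mul_of_nonneg_left (Real.rpow_le_rpow_of_nonpos hκ0 a1 (by linarith)) hC2.le)
    have l2 : κ * κ^(-(2*η)) = κ^(1-2*η) := by
      rw [← Real.rpow_one_add' hκ0.le (by linarith)]; congr 1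
    have l3 : |1/2 * δ * LL δ * Real.exp (2*x)| ≤ Real.exp (2*x) * (C2 * κ^(1-2*η)) := by
      rw [abs_mul, abs_mul, abs_of_pos hE, abs_of_pos (by positivity : 0 < 1/2*δ), mul_comm, ← l2]
      refine mul_le_mul_of_nonneg_left ?_ hE.le
      calc 1/2*δ*|LL δ| ≤ κ * (C2 * κ^(-(2*η))) := mul_le_mul (by linarith) l1 (abs_nonneg _) hκ0.le
        _ = _ := by ring
    have l4 : |Vl δ x - 1/2 * δ * LL δ * Real.exp (2*x)| ≤ Real.exp (2*x) * ((2 * C1 + C2) * κ^(1-2*η)) := by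
      refine (abs_sub _ _).trans ?_
      rw [abs_of_nonneg v0]
      nlinarith
    refine l4.trans ?_
    have l5 : κ^(1-2*η) ≤ 4 * (κ^(3-2*η) * Real.exp (2 * B₁ * x)) := by
      have : κ^(3-2*η) = κ^(1-2*η) * κ^2 := by
        rw [← Real.rpow_natCast κ 2, ← Real.rpow_add hκ0]; congr 1; push_cast; ring
      rw [this]
      have p3 : 0 ≤ κ^(1-2*η) := by positivity
      nlinarith
    have l6 : (2 * C1 + C2) * κ^(1-2*η) ≤ (|D| * 2^(1+c) + 4 * (2 * C1 + C2)) * (κ^(1+c) + κ^(3-2*η) * Real.exp (2 * B₁ * x)) := by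
      have m1 : 0 ≤ |D| * 2^(1+c) := by positivity
      calc (2 * C1 + C2) * κ^(1-2*η) ≤ (2 * C1 + C2) * (4 * (κ^(3-2*η) * Real.exp (2 * B₁ * x))) :=
            mul_le_mul_of_nonneg_left l5 (by positivity)
        _ = (4 * (2*C1 + C2)) * (κ^(3-2*η) * Real.exp (2 * B₁ * x)) := by ring
        _ ≤ _ := mul_le_mul (by linarith) (by linarith) p2 (by positivity)
    calc _ ≤ _ := mul_le_mul_of_nonneg_left l6 hE.le
      _ = _ := by ring

lemma W_mid (hRH : RiemannHypothesis) {B₁ B₂ c D X₀ : ℝ} (hB₁ : 0 < B₁) (hB₁₂ : B₁ < B₂) (hB₂ : B₂ < 1) (hc : 0 < c) (hV : HV B₁ B₂ c D X₀)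
    {η : ℝ} (hη : 0 < η) (hη1 : η ≤ 1/8) :
    ∃ C : ℝ, 0 < C ∧ ∀ U κ : ℝ, 0 < U → X₀ ≤ Real.exp U → Real.exp U ^ (-B₂) ≤ κ → κ ≤ 1/2 →
      |WW (MM U) sg κ - κ * LL κ| ≤ C * (κ^(1+c) + κ^(3-2*η) * Real.exp (2 * B₁ * U) + κ^(2-2*η)) := by
  obtain ⟨C1, hC1, h1⟩ := W_PP hRH hη hη1
  obtain ⟨C2, hC2, h2⟩ := V_point hRH hB₁ hB₁₂ hc hV hη hη1
  obtain ⟨C3, hC3, h3⟩ := kL_diff hη hη1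
  have hB : 0 < 1 - B₁ := by linarith
  refine ⟨2 * C2 + 2 * C2 / (1 - B₁) + C1 + C3, by positivity, fun U κ hU hX hκ hκ1 => ?_⟩
  have hκ0 : 0 < κ := lt_of_lt_of_le (by positivity) hκ
  obtain ⟨w1, w2, w3⟩ := h1 U κ hU hκ0 hκ1
  obtain ⟨i1, e1⟩ := PP_V U hU hκ0.le (by linarith) w2
  set δ := Real.exp κ - 1
  have i2 : IntegrableOn (fun x : ℝ => Real.exp (-2 * x)) (Set.Ioi U) := integrableOn_exp_mul_Ioi (by norm_num) U
  have i3 : IntegrableOn (fun x : ℝ => Real.exp ((2*B₁-2) * x)) (Set.Ioi U) := integrableOn_exp_mul_Ioi (by linarith) U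
  have v2 : ∫ x in Set.Ioi U, Real.exp (-2 * x) = Real.exp (-2*U) / 2 := by
    rw [integral_exp_mul_Ioi (by norm_num)]; ring
  have v3 : ∫ x in Set.Ioi U, Real.exp ((2*B₁-2) * x) = Real.exp ((2*B₁-2)*U) / (2 * (1 - B₁)) := by
    rw [integral_exp_mul_Ioi (by linarith), neg_div, ← div_neg]; congr 1; ring
  have ee : ∀ x, 4 * Real.exp (2*U - 4*x) * (1/2 * δ * LL δ * Real.exp (2*x)) = (2 * δ * LL δ * Real.exp (2*U)) * Real.exp (-2*x) := by
    intro x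
    have : Real.exp (2*U - 4*x) * Real.exp (2*x) = Real.exp (2*U) * Real.exp (-2*x) := by
      rw [← Real.exp_add, ← Real.exp_add]; congr 1; ring
    linear_combination 2 * δ * LL δ * this
  have i4 : IntegrableOn (fun x => 4 * Real.exp (2*U - 4*x) * (1/2 * δ * LL δ * Real.exp (2*x))) (Set.Ioi U) := by
    simp_rw [ee]
    exact Integrable.const_mul i2 _
  have v4 : ∫ x in Set.Ioi U, 4 * Real.exp (2*U - 4*x) * (1/2 * δ * LL δ * Real.exp (2*x)) = δ * LL δ := by
    simp_rw [ee]
    rw [integral_const_mul, v2, show 2 * δ * LL δ * Real.exp (2*U) * (Real.exp (-2*U)/2) = δ * LL δ * (Real.exp (2*U) * Real.exp (-2*U)) by ring, ← Real.exp_add]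
    simp
  have main : |PP U κ - δ * LL δ| ≤ 2 * C2 * κ^(1+c) + 2 * C2 / (1 - B₁) * (κ^(3-2*η) * Real.exp (2 * B₁ * U)) := by
    rw [e1, ← v4, ← integral_sub i1 i4, ← Real.norm_eq_abs]
    have ib : IntegrableOn (fun x => (4 * C2 * κ^(1+c) * Real.exp (2*U)) * Real.exp (-2*x) + (4 * C2 * κ^(3-2*η) * Real.exp (2*U)) * Real.exp ((2*B₁-2)*x)) (Set.Ioi U) :=
      (Integrable.const_mul i2 _).add (Integrable.const_mul i3 _)
    refine (norm_integral_le_of_norm_le ib ?_).trans (le_of_eq ?_)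
    · refine (ae_restrict_iff' measurableSet_Ioi).2 (Eventually.of_forall fun x hx => ?_)
      have h := h2 U x κ hU hX (le_of_lt hx) hκ hκ1
      rw [← mul_sub, norm_mul, Real.norm_eq_abs, Real.norm_eq_abs, abs_of_pos (by positivity)]
      refine (mul_le_mul_of_nonneg_left h (by positivity)).trans (le_of_eq ?_)
      have t1 : Real.exp (2*U - 4*x) * Real.exp (2*x) = Real.exp (2*U) * Real.exp (-2*x) := by
        rw [← Real.exp_add, ← Real.exp_add]; congr 1; ring
      have t2 : Real.exp ((2*B₁-2)*x) = Real.exp (2*B₁*x) * Real.exp (-2*x) := by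
        rw [← Real.exp_add]; congr 1; ring
      rw [t2]
      linear_combination (4 * C2 * (κ^(1+c) + κ^(3-2*η) * Real.exp (2 * B₁ * x))) * t1
    · have j1 : IntegrableOn (fun x => (4 * C2 * κ^(1+c) * Real.exp (2*U)) * Real.exp (-2*x)) (Set.Ioi U) := Integrable.const_mul i2 _
      have j2 : IntegrableOn (fun x => (4 * C2 * κ^(3-2*η) * Real.exp (2*U)) * Real.exp ((2*B₁-2)*x)) (Set.Ioi U) := Integrable.const_mul i3 _
      rw [integral_add j1 j2, integral_const_mul, integral_const_mul, v2, v3]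
      have t3 : Real.exp (2*U) * Real.exp (-(2*U)) = 1 := by rw [← Real.exp_add]; simp
      have t4 : Real.exp (2*U) * Real.exp ((2*B₁-2)*U) = Real.exp (2*B₁*U) := by rw [← Real.exp_add]; congr 1; ring
      rw [← t4]
      have hB' := hB.ne'
      field_simp
      linear_combination (4 * κ^(1+c)) * (1 - B₁) * t3
  have h5 := h3 κ hκ0 hκ1
  have p1 : 0 ≤ κ^(1+c) := by positivity
  have p2 : 0 ≤ κ^(3-2*η) * Real.exp (2 * B₁ * U) := by positivity
  have p3 : 0 ≤ κ^(2-2*η) := by positivity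
  have hq : 0 ≤ 2 * C2 / (1 - B₁) := by positivity
  calc |WW (MM U) sg κ - κ * LL κ| = |(PP U κ - δ * LL δ) - (PP U κ - WW (MM U) sg κ) + (δ * LL δ - κ * LL κ)| := by congr 1; ring
    _ ≤ |PP U κ - δ * LL δ| + |PP U κ - WW (MM U) sg κ| + |δ * LL δ - κ * LL κ| :=
        (abs_add_le _ _).trans (add_le_add (abs_sub _ _) le_rfl)
    _ ≤ _ := by
      set q := 2 * C2 / (1 - B₁)
      set y1 := κ^(1+c)
      set y2 := κ^(3-2*η) * Real.exp (2 * B₁ * U)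
      set y3 := κ^(2-2*η)
      have r1 := mul_nonneg hq p1
      nlinarith [mul_nonneg hC1.le p1, mul_nonneg hC1.le p2, mul_nonneg hC3.le p1, mul_nonneg hC3.le p2, mul_nonneg hC2.le p2, mul_nonneg hC2.le p3, mul_nonneg hq p1, mul_nonneg hq p3]

/-- the error function -/
noncomputable def RB (η c' B₁ B₂ U κ : ℝ) : ℝ :=
  κ^(1 + c' - 2*η) + κ^(3-2*η) * Real.exp (2 * B₁ * U) +
    Set.indicator (Set.Iio (Real.exp (-B₂ * U))) (fun κ => κ^(1-2*η)) κ +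
    Set.indicator (Set.Ioi (1/2:ℝ)) (fun κ => Real.exp (2 * U) * κ^2) κ

lemma W_all (hRH : RiemannHypothesis) {B₁ B₂ c D X₀ : ℝ} (hB₁ : 0 < B₁) (hB₁₂ : B₁ < B₂) (hB₂ : B₂ < 1) (hc : 0 < c) (hV : HV B₁ B₂ c D X₀)
    {η : ℝ} (hη : 0 < η) (hη1 : η ≤ 1/8) :
    ∃ C : ℝ, 0 < C ∧ ∀ U κ : ℝ, 0 < U → X₀ ≤ Real.exp U → 0 < κ →
      |WW (MM U) sg κ - κ * LL κ| ≤ C * RB η (min c 1) B₁ B₂ U κ := by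
  obtain ⟨C1, hC1, h1⟩ := W_PP hRH hη hη1
  obtain ⟨C2, hC2, h2⟩ := LL_bound hη
  obtain ⟨C3, hC3, h3⟩ := W_mid hRH hB₁ hB₁₂ hB₂ hc hV hη hη1
  obtain ⟨C4, hC4, h4⟩ := MM_univ
  have hcL : 0 ≤ cL := abs_nonneg _
  refine ⟨(C1 + C2) + 2 * C3 + (2 * C4^2 + 5 + 2 * cL), by positivity, fun U κ hU hX hκ => ?_⟩
  set c' := min c 1
  have hc1 : c' ≤ c := min_le_left _ _
  have hc2 : c' ≤ 1 := min_le_right _ _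
  have t1 : 0 ≤ κ^(1 + c' - 2*η) := by positivity
  have t2 : 0 ≤ κ^(3-2*η) * Real.exp (2 * B₁ * U) := by positivity
  have t3 : 0 ≤ Set.indicator (Set.Iio (Real.exp (-B₂ * U))) (fun κ => κ^(1-2*η)) κ := by
    by_cases h : κ < Real.exp (-B₂ * U)
    · rw [Set.indicator_of_mem (by exact h)]; positivity
    · rw [Set.indicator_of_notMem (by exact h)]
  have t4 : 0 ≤ Set.indicator (Set.Ioi (1/2:ℝ)) (fun κ => Real.exp (2 * U) * κ^2) κ :=
    Set.indicator_nonneg (fun _ _ => by positivity) _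
  rcases lt_or_ge (1/2) κ with h | h
  · have e4 : Set.indicator (Set.Ioi (1/2:ℝ)) (fun κ => Real.exp (2 * U) * κ^2) κ = Real.exp (2 * U) * κ^2 := Set.indicator_of_mem (by exact h) _
    have b1 := W_le (MM U) sg_meas sg_abs hκ.le
    have b2 : (MM U).real Set.univ ^ 2 ≤ C4^2 * Real.exp (2*U) := by
      have : C4^2 * Real.exp (2*U) = (C4 * Real.exp U)^2 := by rw [mul_pow, ← Real.exp_nat_mul]; norm_num
      rw [this]
      exact pow_le_pow_left₀ measureReal_nonneg (h4 U) 2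
    have b0 := W_nonneg (σ := sg) (MM U) κ
    have k1 : κ ≤ 2 * κ^2 := by nlinarith
    have b3 : WW (MM U) sg κ ≤ 2 * C4^2 * (Real.exp (2*U) * κ^2) := by
      refine b1.trans ((mul_le_mul k1 b2 (sq_nonneg _) (by positivity)).trans (le_of_eq (by ring)))
    have l1 : |Real.log κ| ≤ κ + 1 := by
      rw [abs_le]
      have a1 := Real.log_le_sub_one_of_pos hκ
      have a2 := Real.one_sub_inv_le_log_of_pos hκ
      have a3 : κ⁻¹ ≤ 2 := by rw [inv_le_comm₀ hκ (by norm_num)]; linarith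
      constructor <;> linarith
    have l2 : |κ * LL κ| ≤ (5 + 2 * cL) * (Real.exp (2*U) * κ^2) := by
      rw [abs_mul, abs_of_pos hκ]
      have e1 : 1 ≤ Real.exp (2*U) := Real.one_le_exp (by linarith)
      have s1 : κ * |LL κ| ≤ κ * (κ + 1 + cL) := mul_le_mul_of_nonneg_left ((LL_abs κ).trans (by linarith)) hκ.le
      have s2 : κ * (κ + 1 + cL) ≤ (5 + 2 * cL) * κ^2 := by nlinarith [mul_le_mul_of_nonneg_left k1 hcL]
      have s3 : κ^2 ≤ Real.exp (2*U) * κ^2 := le_mul_of_one_le_left (sq_nonneg _) e1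
      exact s1.trans (s2.trans (mul_le_mul_of_nonneg_left s3 (by positivity)))
    have l3 : |WW (MM U) sg κ - κ * LL κ| ≤ (2 * C4^2 + 5 + 2 * cL) * (Real.exp (2*U) * κ^2) := by
      refine (abs_sub _ _).trans ?_
      rw [abs_of_nonneg b0]; linarith
    refine l3.trans ?_
    refine mul_le_mul (by linarith) ?_ (by positivity) (by positivity)
    unfold RB; rw [e4]; rw [e4] at t4; linarith
  rcases lt_or_ge κ (Real.exp (-B₂ * U)) with hk | hk
  · have e3 : Set.indicator (Set.Iio (Real.exp (-B₂ * U))) (fun κ => κ^(1-2*η)) κ = κ^(1-2*η) := Set.indicator_of_mem (by exact hk) _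
    have b0 := W_nonneg (σ := sg) (MM U) κ
    have l2 : κ * κ^(-(2*η)) = κ^(1-2*η) := by
      rw [← Real.rpow_one_add' hκ.le (by linarith)]; congr 1
    have l3 : |κ * LL κ| ≤ C2 * κ^(1-2*η) := by
      rw [abs_mul, abs_of_pos hκ]
      calc κ * |LL κ| ≤ κ * (C2 * κ^(-(2*η))) := mul_le_mul_of_nonneg_left (h2 κ hκ (by linarith)) hκ.le
        _ = _ := by rw [← l2]; ring
    have l4 : |WW (MM U) sg κ - κ * LL κ| ≤ (C1 + C2) * κ^(1-2*η) := by
      refine (abs_sub _ _).trans ?_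
      rw [abs_of_nonneg b0]; linarith [(h1 U κ hU hκ h).1]
    refine l4.trans ?_
    refine mul_le_mul (by nlinarith) ?_ (by positivity) (by positivity)
    unfold RB; rw [e3]; rw [e3] at t3; linarith
  · have hk' : Real.exp U ^ (-B₂) ≤ κ := by rw [← Real.exp_mul, mul_comm]; exact hk
    refine (h3 U κ hU hX hk' h).trans ?_
    have q1 : κ^(1+c) ≤ κ^(1+c'-2*η) := Real.rpow_le_rpow_of_exponent_ge hκ (by linarith) (by linarith)
    have q2 : κ^(2-2*η) ≤ κ^(1+c'-2*η) := Real.rpow_le_rpow_of_exponent_ge hκ (by linarith) (by linarith)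
    have q3 : κ^(1+c) + κ^(3-2*η) * Real.exp (2 * B₁ * U) + κ^(2-2*η) ≤ 2 * RB η c' B₁ B₂ U κ := by
      unfold RB; linarith
    have q4 : 0 ≤ RB η c' B₁ B₂ U κ := by unfold RB; positivity
    calc _ ≤ C3 * (2 * RB η c' B₁ B₂ U κ) := mul_le_mul_of_nonneg_left q3 hC3.le
      _ = (2 * C3) * RB η c' B₁ B₂ U κ := by ring
      _ ≤ _ := mul_le_mul_of_nonneg_right (by nlinarith) q4

end B1

namespace B1
open Filter Topology Metric

lemma log_abs_le {κ : ℝ} (hκ : 0 < κ) : |Real.log κ| ≤ κ + κ⁻¹ := by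
  have a1 := Real.log_le_sub_one_of_pos hκ
  have a2 := Real.one_sub_inv_le_log_of_pos hκ
  have := inv_pos.2 hκ
  rw [abs_le]; constructor <;> linarith

lemma pexp_int (n : ℝ) (hn : -1 < n) {H : ℝ} (hH : 0 < H) : IntegrableOn (fun κ : ℝ => κ^n * Real.exp (-H * κ)) (Set.Ioi 0) := by
  have := integrableOn_rpow_mul_exp_neg_mul_rpow (p := 1) (s := n) (b := H) hn one_pos hH
  simpa using this

lemma pexp_val {a : ℝ} (ha : -1 < a) {H : ℝ} (hH : 0 < H) : ∫ κ in Set.Ioi (0:ℝ), κ^a * Real.exp (-H * κ) = H^(-a-1) * Real.Gamma (a+1) := by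
  have := Real.integral_rpow_mul_exp_neg_mul_Ioi (a := a + 1) (r := H) (by linarith) hH
  rw [add_sub_cancel_right] at this
  simp_rw [neg_mul]
  rw [this, one_div, Real.inv_rpow hH.le, ← Real.rpow_neg hH.le]
  congr 2; ring

noncomputable def AA (z : ℂ) : ℂ := ∫ κ in Set.Ioi (0:ℝ), Complex.exp (-z * κ) * ((κ * Real.log κ : ℝ) : ℂ)

lemma klog_meas : Measurable (fun κ : ℝ => ((κ * Real.log κ : ℝ) : ℂ)) :=
  Complex.measurable_ofReal.comp (measurable_id.mul Real.measurable_log)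

lemma poly_int {H : ℝ} (hH : 0 < H) : IntegrableOn (fun κ : ℝ => (κ^3 + κ^2 + κ + 1) * Real.exp (-H * κ)) (Set.Ioi 0) := by
  have h3 := pexp_int 3 (by norm_num) hH
  have h2 := pexp_int 2 (by norm_num) hH
  have h1 := pexp_int 1 (by norm_num) hH
  have h0 := pexp_int 0 (by norm_num) hH
  refine (((h3.add h2).add h1).add h0).congr (Eventually.of_forall fun κ => ?_)
  simp only [Pi.add_apply, Real.rpow_one, Real.rpow_zero]
  rw [show (3:ℝ) = (3:ℕ) by norm_num, show (2:ℝ) = (2:ℕ) by norm_num, Real.rpow_natCast, Real.rpow_natCast]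
  ring

lemma AA_int {z : ℂ} (hz : 0 < z.re) : IntegrableOn (fun κ : ℝ => Complex.exp (-z * κ) * ((κ * Real.log κ : ℝ) : ℂ)) (Set.Ioi 0) := by
  refine Integrable.mono' (poly_int hz) ?_ ((ae_restrict_iff' measurableSet_Ioi).2 (Eventually.of_forall fun κ (hκ : 0 < κ) => ?_))
  · exact ((by fun_prop : Measurable (fun κ : ℝ => Complex.exp (-z * κ))).mul klog_meas).aestronglyMeasurable
  · rw [norm_mul, zexp_norm, Complex.norm_real, Real.norm_eq_abs, abs_mul, abs_of_pos hκ, mul_comm]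
    refine mul_le_mul_of_nonneg_right ?_ (Real.exp_pos _).le
    have := mul_le_mul_of_nonneg_left (log_abs_le hκ) hκ.le
    rw [mul_add, mul_inv_cancel₀ hκ.ne'] at this
    nlinarith [pow_pos hκ 3]

lemma AA_diff {z : ℂ} (hz : 0 < z.re) : DifferentiableAt ℂ AA z := by
  have hb : 0 < z.re / 2 := by linarith
  have h := hasDerivAt_integral_of_dominated_loc_of_deriv_le (𝕜 := ℂ) (μ := volume.restrict (Set.Ioi (0:ℝ)))
    (F := fun (w : ℂ) (κ : ℝ) => Complex.exp (-w * κ) * ((κ * Real.log κ : ℝ) : ℂ))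
    (F' := fun (w : ℂ) (κ : ℝ) => (Complex.exp (-w * κ) * (-κ)) * ((κ * Real.log κ : ℝ) : ℂ))
    (x₀ := z) (s := ball z (z.re/2)) (bound := fun κ => (κ^3 + κ^2 + κ + 1) * Real.exp (-(z.re/2) * κ))
    (ball_mem_nhds z hb)
    (Eventually.of_forall fun w => ((by fun_prop : Measurable (fun κ : ℝ => Complex.exp (-w * κ))).mul klog_meas).aestronglyMeasurable)
    (AA_int hz)
    (((by fun_prop : Measurable (fun κ : ℝ => Complex.exp (-z * κ) * (-κ))).mul klog_meas).aestronglyMeasurable)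
    ?_ (poly_int hb) ?_
  · exact h.2.differentiableAt
  · refine (ae_restrict_iff' measurableSet_Ioi).2 (Eventually.of_forall fun κ (hκ : 0 < κ) w hw => ?_)
    have hre : z.re / 2 ≤ w.re := by
      have h1 := (Complex.abs_re_le_norm (w - z)).trans_lt (mem_ball_iff_norm.1 hw)
      rw [Complex.sub_re, abs_lt] at h1
      linarith
    rw [norm_mul, norm_mul, zexp_norm, Complex.norm_real, norm_neg, Complex.norm_real, Real.norm_eq_abs, Real.norm_eq_abs, abs_mul, abs_of_pos hκ]
    have h1 : Real.exp (-w.re * κ) ≤ Real.exp (-(z.re/2) * κ) := Real.exp_le_exp.2 (by nlinarith)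
    have h2 := mul_le_mul_of_nonneg_left (log_abs_le hκ) hκ.le
    rw [mul_add, mul_inv_cancel₀ hκ.ne'] at h2
    have h3 : κ * (κ * |Real.log κ|) ≤ κ^3 + κ^2 + κ + 1 := by nlinarith [pow_pos hκ 3, mul_le_mul_of_nonneg_left h2 hκ.le]
    calc Real.exp (-w.re * κ) * κ * (κ * |Real.log κ|) = (κ * (κ * |Real.log κ|)) * Real.exp (-w.re * κ) := by ring
      _ ≤ _ := mul_le_mul h3 h1 (Real.exp_pos _).le (by positivity)
  · refine (Eventually.of_forall fun κ w hw => ?_)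
    have : HasDerivAt (fun w : ℂ => Complex.exp (-w * κ)) (Complex.exp (-w * κ) * (-κ)) w := by
      have h1 : HasDerivAt (fun w : ℂ => -w * (κ:ℂ)) (-(κ:ℂ)) w := by
        simpa using ((hasDerivAt_id w).neg.mul_const (κ:ℂ))
      exact h1.cexp
    exact this.mul_const _

lemma AA_one : AA 1 = 1 - Real.eulerMascheroniConstant := by
  have h1 := Complex.hasDerivAt_GammaIntegral (s := 2) (by norm_num)
  have h2 := Complex.hasDerivAt_Gamma_nat 1
  have h3 : Complex.GammaIntegral =ᶠ[𝓝 2] Complex.Gamma := by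
    have : ∀ᶠ s : ℂ in 𝓝 2, 0 < s.re := (Complex.continuous_re.isOpen_preimage _ isOpen_Ioi).mem_nhds (by norm_num)
    filter_upwards [this] with s hs
    exact (Complex.Gamma_eq_integral hs).symm
  have h4 : HasDerivAt Complex.Gamma _ 2 := h1.congr_of_eventuallyEq h3.symm
  have h2' : HasDerivAt Complex.Gamma (1 - Real.eulerMascheroniConstant) 2 := by
    convert! h2 using 1
    · simp [harmonic]; ring
    · norm_num
  have := h4.unique h2'
  rw [← this]
  unfold AA
  refine setIntegral_congr_fun measurableSet_Ioi fun κ hκ => ?_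
  beta_reduce
  rw [show (2:ℂ) - 1 = 1 by norm_num, Complex.cpow_one]
  push_cast
  rw [neg_one_mul]
  ring

lemma AA_real {r : ℝ} (hr : 0 < r) : AA r = (1 - Real.eulerMascheroniConstant - Real.log r) / (r:ℂ)^2 := by
  have h1 := integral_comp_mul_left_Ioi (fun κ : ℝ => Complex.exp (-1 * κ) * ((κ * Real.log κ : ℝ) : ℂ)) 0 hr
  have h2 : ∫ κ in Set.Ioi (0:ℝ), Complex.exp (-1 * κ) * ((κ * Real.log κ : ℝ) : ℂ) = 1 - Real.eulerMascheroniConstant := AA_one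
  rw [mul_zero, h2] at h1
  have hr' : (r:ℂ) ≠ 0 := by exact_mod_cast hr.ne'
  have i1 : IntegrableOn (fun κ : ℝ => Complex.exp (-(r:ℂ) * κ) * ((κ * Real.log κ : ℝ) : ℂ)) (Set.Ioi 0) := AA_int (by simpa using hr)
  have i2 : IntegrableOn (fun κ : ℝ => Complex.exp (-(r:ℂ) * κ) * (max (κ - 0) 0 : ℝ)) (Set.Ioi 0) := ramp_int (by simpa using hr) le_rfl
  have v2 := ramp (z := r) (by simpa using hr) (y := 0) le_rfl
  have e : ∫ (x : ℝ) in Set.Ioi 0, Complex.exp (-1 * ((r * x : ℝ):ℂ)) * ((r * x * Real.log (r * x) : ℝ):ℂ) =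
      ∫ x in Set.Ioi (0:ℝ), ((r:ℂ) * (Complex.exp (-(r:ℂ) * x) * ((x * Real.log x : ℝ) : ℂ)) + (r * Real.log r : ℂ) * (Complex.exp (-(r:ℂ) * x) * (max (x - 0) 0 : ℝ))) := by
    refine setIntegral_congr_fun measurableSet_Ioi fun x (hx : 0 < x) => ?_
    beta_reduce
    rw [Real.log_mul hr.ne' hx.ne', sub_zero, max_eq_left hx.le]
    push_cast
    rw [show -1 * ((r:ℂ) * x) = -(r:ℂ) * x by ring]
    ring
  rw [e, integral_add (i1.const_mul _) (i2.const_mul _), integral_const_mul, integral_const_mul] at h1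
  change (r:ℂ) * AA r + _ = _ at h1
  set P := ∫ κ in Set.Ioi (0:ℝ), Complex.exp (-(r:ℂ) * κ) * (max (κ - 0) 0 : ℝ)
  simp only [Complex.ofReal_zero, mul_zero, Complex.exp_zero] at v2
  rw [Complex.real_smul] at h1
  push_cast at h1
  rw [eq_div_iff (pow_ne_zero 2 hr')]
  have h3 : (r:ℂ) * ((r:ℂ)⁻¹ * (1 - (Real.eulerMascheroniConstant:ℂ))) = 1 - Real.eulerMascheroniConstant := by
    rw [← mul_assoc, mul_inv_cancel₀ hr', one_mul]
  linear_combination (r:ℂ) * h1 + h3 - (Real.log r : ℂ) * v2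

lemma AA_eq {z : ℂ} (hz : 0 < z.re) : AA z = (1 - Real.eulerMascheroniConstant - Complex.log z) / z^2 := by
  set S : Set ℂ := {z | 0 < z.re}
  have hS : IsOpen S := Complex.continuous_re.isOpen_preimage _ isOpen_Ioi
  have hc : Convex ℝ S := convex_halfSpace_re_gt 0
  have hne : ∀ w ∈ S, w ≠ 0 := by
    intro w hw h0
    have : (0:ℝ) < w.re := hw
    rw [h0] at this; simp at this
  have a1 : AnalyticOnNhd ℂ AA S := DifferentiableOn.analyticOnNhd (fun w hw => (AA_diff hw).differentiableWithinAt) hS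
  have a2 : AnalyticOnNhd ℂ (fun z => (1 - Real.eulerMascheroniConstant - Complex.log z) / z^2) S := by
    refine DifferentiableOn.analyticOnNhd (fun w hw => ?_) hS
    have h1 : w ∈ Complex.slitPlane := Or.inl hw
    have h2 := pow_ne_zero 2 (hne w hw)
    exact (((differentiableAt_const _).sub (Complex.differentiableAt_log h1)).div (by fun_prop) h2).differentiableWithinAt
  have h := a1.eqOn_of_preconnected_of_frequently_eq a2 hc.isPreconnected (z₀ := 1) (show (0:ℝ) < (1:ℂ).re by norm_num) ?_
  · exact h hz
  · have t : Tendsto (fun x : ℝ => (x:ℂ)) (𝓝[≠] 1) (𝓝[≠] 1) := by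
      refine tendsto_nhdsWithin_iff.2 ⟨?_, ?_⟩
      · have : Tendsto (fun x : ℝ => (x:ℂ)) (𝓝 1) (𝓝 ((1:ℝ):ℂ)) := Complex.continuous_ofReal.tendsto 1
        rw [Complex.ofReal_one] at this
        exact this.mono_left nhdsWithin_le_nhds
      · filter_upwards [self_mem_nhdsWithin] with x hx
        simpa using hx
    refine t.frequently ?_
    refine Eventually.frequently ?_
    have : ∀ᶠ x : ℝ in 𝓝[≠] 1, 0 < x := nhdsWithin_le_nhds (lt_mem_nhds one_pos)
    filter_upwards [this] with x hx
    rw [AA_real hx, Complex.ofReal_log hx.le]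

lemma main_lap {z : ℂ} (hz : 0 < z.re) :
    IntegrableOn (fun κ : ℝ => Complex.exp (-z * κ) * ((κ * LL κ : ℝ):ℂ)) (Set.Ioi 0) ∧
    z^2 * ∫ κ in Set.Ioi (0:ℝ), Complex.exp (-z * κ) * ((κ * LL κ : ℝ):ℂ) = Complex.log z - Real.log (2 * π) := by
  have hz0 : z ≠ 0 := by rintro rfl; simp at hz
  have i1 := AA_int hz
  have i2 : IntegrableOn (fun κ : ℝ => Complex.exp (-z * κ) * (max (κ - 0) 0 : ℝ)) (Set.Ioi 0) := ramp_int hz le_rfl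
  have v2 := ramp hz (y := 0) le_rfl
  have v1 := AA_eq hz
  unfold AA at v1
  set a : ℂ := 1 - Real.eulerMascheroniConstant - Real.log (2 * π)
  have e : Set.EqOn (fun κ : ℝ => (-1:ℂ) * (Complex.exp (-z * κ) * ((κ * Real.log κ : ℝ) : ℂ)) + a * (Complex.exp (-z * κ) * (max (κ - 0) 0 : ℝ)))
      (fun κ : ℝ => Complex.exp (-z * κ) * ((κ * LL κ : ℝ):ℂ)) (Set.Ioi 0) := by
    intro κ (hκ : 0 < κ)
    beta_reduce
    unfold LL
    rw [one_div, Real.log_inv, sub_zero, max_eq_left hκ.le]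
    push_cast
    ring
  have i3 : IntegrableOn (fun κ : ℝ => (-1:ℂ) * (Complex.exp (-z * κ) * ((κ * Real.log κ : ℝ) : ℂ)) + a * (Complex.exp (-z * κ) * (max (κ - 0) 0 : ℝ))) (Set.Ioi 0) :=
    (Integrable.const_mul i1 _).add (Integrable.const_mul i2 _)
  refine ⟨i3.congr_fun e measurableSet_Ioi, ?_⟩
  rw [← setIntegral_congr_fun measurableSet_Ioi e, integral_add (Integrable.const_mul i1 _) (Integrable.const_mul i2 _), integral_const_mul, integral_const_mul, v1]
  simp only [Complex.ofReal_zero, mul_zero, Complex.exp_zero] at v2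
  have h3 : z^2 * ((1 - Real.eulerMascheroniConstant - Complex.log z) / z^2) = 1 - Real.eulerMascheroniConstant - Complex.log z :=
    mul_div_cancel₀ _ (pow_ne_zero 2 hz0)
  linear_combination a * v2 - h3

end B1

namespace B1
open Filter Topology Metric

noncomputable def Err (η c' B₁ B₂ H U : ℝ) : ℝ :=
  H^(-2 - c' + 2*η) + H^(-4 + 2*η) * Real.exp (2 * B₁ * U) + Real.exp (-B₂ * U)^(2 - 2*η) + Real.exp (2*U) * Real.exp (-(H/4))

lemma RB_lap {η c' : ℝ} (hη : 0 < η) (hη1 : η ≤ 1/8) (hc0 : 0 < c') (B₁ B₂ : ℝ) :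
    ∃ C : ℝ, 0 < C ∧ ∀ U H : ℝ, 1 ≤ H → ∀ f : ℝ → ℂ, (∀ κ, 0 < κ → ‖f κ‖ ≤ RB η c' B₁ B₂ U κ * Real.exp (-H * κ)) →
      ‖∫ κ in Set.Ioi (0:ℝ), f κ‖ ≤ C * Err η c' B₁ B₂ H U := by
  set g1 := Real.Gamma (1 + c' - 2*η + 1)
  set g2 := Real.Gamma (3 - 2*η + 1)
  set g3 := ∫ κ in Set.Ioi (0:ℝ), κ^(2:ℝ) * Real.exp (-(1/2) * κ)
  have hg1 : 0 < g1 := Real.Gamma_pos_of_pos (by linarith)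
  have hg2 : 0 < g2 := Real.Gamma_pos_of_pos (by linarith)
  have hg3 : 0 ≤ g3 := setIntegral_nonneg measurableSet_Ioi fun κ (hκ : 0 < κ) => by positivity
  refine ⟨g1 + g2 + 1 + g3, by positivity, fun U H hH f hf => ?_⟩
  have hH0 : 0 < H := by linarith
  set b := Real.exp (-B₂ * U)
  have hb : 0 < b := Real.exp_pos _
  set E := Real.exp (2 * B₁ * U)
  set Y := Real.exp (2*U) * Real.exp (-(H/4))
  have j1 := pexp_int (1 + c' - 2*η) (by linarith) hH0
  have j2 : IntegrableOn (fun κ : ℝ => E * (κ^(3 - 2*η) * Real.exp (-H * κ))) (Set.Ioi 0) := Integrable.const_mul (pexp_int (3 - 2*η) (by linarith) hH0) E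
  have j3 : IntegrableOn (Set.indicator (Set.Iio b) (fun κ : ℝ => b^(1-2*η))) (Set.Ioi 0) := by
    rw [integrableOn_indicator_iff measurableSet_Iio, Set.inter_comm, Set.Ioi_inter_Iio]
    exact integrableOn_const measure_Ioo_lt_top.ne
  have j4 : IntegrableOn (fun κ : ℝ => Y * (κ^(2:ℝ) * Real.exp (-(1/2) * κ))) (Set.Ioi 0) :=
    Integrable.const_mul (pexp_int 2 (by norm_num) (by norm_num)) Y
  have j12 := Integrable.add j1 j2
  have j123 := Integrable.add j12 j3
  have jj := Integrable.add j123 j4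
  refine (norm_integral_le_of_norm_le jj ?_).trans ?_
  · refine (ae_restrict_iff' measurableSet_Ioi).2 (Eventually.of_forall fun κ (hκ : 0 < κ) => ?_)
    refine (hf κ hκ).trans ?_
    have he : Real.exp (-H * κ) ≤ 1 := Real.exp_le_one_iff.2 (by nlinarith)
    have he0 := Real.exp_pos (-H * κ)
    unfold RB
    simp only [Pi.add_apply]
    have q3 : Set.indicator (Set.Iio b) (fun κ => κ^(1-2*η)) κ * Real.exp (-H * κ) ≤ Set.indicator (Set.Iio b) (fun κ : ℝ => b^(1-2*η)) κ := by
      by_cases h : κ < b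
      · rw [Set.indicator_of_mem (by exact h), Set.indicator_of_mem (by exact h)]
        have : κ^(1-2*η) ≤ b^(1-2*η) := Real.rpow_le_rpow hκ.le h.le (by linarith)
        have h0 : 0 ≤ κ^(1-2*η) := by positivity
        nlinarith
      · rw [Set.indicator_of_notMem (by exact h), Set.indicator_of_notMem (by exact h)]; simp
    have q4 : Set.indicator (Set.Ioi (1/2:ℝ)) (fun κ => Real.exp (2 * U) * κ^2) κ * Real.exp (-H * κ) ≤ Y * (κ^(2:ℝ) * Real.exp (-(1/2) * κ)) := by
      by_cases h : 1/2 < κ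
      · rw [Set.indicator_of_mem (by exact h)]
        have : Real.exp (-H * κ) ≤ Real.exp (-(H/4)) * Real.exp (-(1/2) * κ) := by
          rw [← Real.exp_add]; exact Real.exp_le_exp.2 (by nlinarith)
        rw [show κ^(2:ℝ) = κ^2 by exact_mod_cast Real.rpow_natCast κ 2]
        calc _ ≤ Real.exp (2 * U) * κ^2 * (Real.exp (-(H/4)) * Real.exp (-(1/2) * κ)) := mul_le_mul_of_nonneg_left this (by positivity)
          _ = _ := by ring
      · rw [Set.indicator_of_notMem (by exact h), zero_mul]; positivity
    linarith
  · have v : ∫ κ in Set.Ioi (0:ℝ), Set.indicator (Set.Iio b) (fun κ : ℝ => b^(1-2*η)) κ = b^(2-2*η) := by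
      rw [integral_indicator measurableSet_Iio, Measure.restrict_restrict measurableSet_Iio, Set.inter_comm, Set.Ioi_inter_Iio, setIntegral_const]
      simp only [Real.volume_real_Ioo_of_le hb.le, sub_zero, smul_eq_mul]
      rw [← Real.rpow_one_add' hb.le (by linarith)]; congr 1; ring
    rw [integral_add' j123 j4, integral_add' j12 j3, integral_add' j1 j2, integral_const_mul, integral_const_mul, pexp_val (by linarith) hH0, pexp_val (by linarith) hH0, v]
    unfold Err
    have z1 : -(1 + c' - 2*η) - 1 = -2 - c' + 2*η := by ring
    have z2 : -(3 - 2*η) - 1 = -4 + 2*η := by ring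
    rw [z1, z2]
    have p1 : 0 ≤ H^(-2 - c' + 2*η) := by positivity
    have p2 : 0 ≤ H^(-4 + 2*η) * E := by positivity
    have p3 : 0 ≤ b^(2-2*η) := by positivity
    have p4 : 0 ≤ Y := by positivity
    change H^(-2 - c' + 2*η) * g1 + E * (H^(-4 + 2*η) * g2) + b^(2-2*η) + Y * g3 ≤ (g1 + g2 + 1 + g3) * (H^(-2 - c' + 2*η) + H^(-4 + 2*η) * E + b^(2-2*η) + Y)
    have e2 : E * (H^(-4 + 2*η) * g2) = g2 * (H^(-4 + 2*η) * E) := by ring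
    rw [e2]
    generalize H^(-2 - c' + 2*η) = y1 at *
    generalize H^(-4 + 2*η) * E = y2 at *
    generalize b^(2-2*η) = y3 at *
    generalize Y = y4 at *
    generalize g1 = k1 at *
    generalize g2 = k2 at *
    generalize g3 = k3 at *
    have := mul_nonneg hg1.le p2
    have := mul_nonneg hg1.le p3
    have := mul_nonneg hg1.le p4
    have := mul_nonneg hg2.le p1
    have := mul_nonneg hg2.le p3
    have := mul_nonneg hg2.le p4
    have := mul_nonneg hg3 p1
    have := mul_nonneg hg3 p2
    have := mul_nonneg hg3 p3
    linarith

lemma JJ_est (hRH : RiemannHypothesis) {B₁ B₂ c D X₀ : ℝ} (hB₁ : 0 < B₁) (hB₁₂ : B₁ < B₂) (hB₂ : B₂ < 1) (hc : 0 < c) (hV : HV B₁ B₂ c D X₀)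
    {η : ℝ} (hη : 0 < η) (hη1 : η ≤ 1/8) :
    ∃ C : ℝ, 0 < C ∧ ∀ U H τ : ℝ, 0 < U → X₀ ≤ Real.exp U → 1 ≤ H →
      |JJ (SS U) H τ - (Real.log ‖(⟨H, τ⟩ : ℂ)‖ - Real.log (2 * π))| ≤ C * (H^2 + τ^2) * Err η (min c 1) B₁ B₂ H U := by
  obtain ⟨C1, hC1, h1⟩ := W_all hRH hB₁ hB₁₂ hB₂ hc hV hη hη1
  obtain ⟨C2, hC2, h2⟩ := RB_lap (η := η) (c' := min c 1) hη hη1 (lt_min hc one_pos) B₁ B₂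
  refine ⟨C1 * C2, by positivity, fun U H τ hU hX hH => ?_⟩
  set z : ℂ := ⟨H, τ⟩
  have hz : 0 < z.re := by change 0 < H; linarith
  have hst : ST (MM U) sg = SS U := funext (ST_MM U)
  have hJ := J_W (MM U) sg_meas sg_abs hz
  rw [hst] at hJ
  change JJ (SS U) H τ = _ at hJ
  obtain ⟨i2, v2⟩ := main_lap hz
  have i1 := W_lap_int (MM U) sg_meas sg_abs hz
  have e : JJ (SS U) H τ - (Real.log ‖z‖ - Real.log (2 * π)) =
      (z^2 * ∫ κ in Set.Ioi (0:ℝ), Complex.exp (-z * κ) * ((WW (MM U) sg κ - κ * LL κ : ℝ):ℂ)).re := by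
    have e1 : ∫ κ in Set.Ioi (0:ℝ), Complex.exp (-z * κ) * ((WW (MM U) sg κ - κ * LL κ : ℝ):ℂ) =
        (∫ κ in Set.Ioi (0:ℝ), Complex.exp (-z * κ) * (WW (MM U) sg κ:ℂ)) - ∫ κ in Set.Ioi (0:ℝ), Complex.exp (-z * κ) * ((κ * LL κ : ℝ):ℂ) := by
      rw [← integral_sub i1 i2]
      refine integral_congr_ae (Eventually.of_forall fun κ => ?_)
      beta_reduce
      push_cast; ring
    rw [e1, mul_sub, v2, Complex.sub_re, ← hJ, Complex.sub_re, Complex.log_re, Complex.ofReal_re]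
  rw [e]
  refine (Complex.abs_re_le_norm _).trans ?_
  rw [norm_mul, norm_pow]
  have hn : ‖z‖^2 = H^2 + τ^2 := by
    rw [← Complex.normSq_eq_norm_sq, Complex.normSq_apply]; change H*H + τ*τ = _; ring
  rw [hn]
  have hb := h2 U H hH (fun κ => (C1:ℂ)⁻¹ * (Complex.exp (-z * κ) * ((WW (MM U) sg κ - κ * LL κ : ℝ):ℂ))) ?_
  · rw [integral_const_mul, norm_mul, norm_inv, Complex.norm_real, Real.norm_of_nonneg hC1.le, inv_mul_le_iff₀ hC1] at hb
    calc _ ≤ (H^2 + τ^2) * (C1 * (C2 * Err η (min c 1) B₁ B₂ H U)) := mul_le_mul_of_nonneg_left hb (by positivity)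
      _ = _ := by ring
  · intro κ hκ
    rw [norm_mul, norm_inv, Complex.norm_real, Real.norm_of_nonneg hC1.le, inv_mul_le_iff₀ hC1, norm_mul, zexp_norm, Complex.norm_real, Real.norm_eq_abs]
    calc _ ≤ Real.exp (-z.re * κ) * (C1 * RB η (min c 1) B₁ B₂ U κ) := mul_le_mul_of_nonneg_left (h1 U κ hU hX hκ) (Real.exp_pos _).le
      _ = _ := by change Real.exp (-H * κ) * _ = _; ring

lemma log_cont {H : ℝ} (hH : 0 < H) : Continuous (fun τ : ℝ => Real.log ‖(⟨H, τ⟩ : ℂ)‖) := by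
  have h1 : Continuous (fun τ : ℝ => (⟨H, τ⟩ : ℂ)) := by
    have : (fun τ : ℝ => (⟨H, τ⟩ : ℂ)) = fun τ : ℝ => (H:ℂ) + τ * Complex.I := by
      ext τ; exact Complex.mk_eq_add_mul_I H τ
    rw [this]; fun_prop
  refine h1.norm.log fun τ h => ?_
  rw [norm_eq_zero] at h
  have := congrArg Complex.re h
  simp at this
  linarith

lemma log_main {T H : ℝ} (hH : 1 ≤ H) (hHT : H ≤ T) :
    |(∫ τ in (-T)..T, (Real.log ‖(⟨H, τ⟩ : ℂ)‖ - Real.log (2 * π))) - 2 * T * (Real.log (T / (2*π)) - 1)| ≤ 2 * H * (1 + Real.log (2 * T)) := by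
  have hT : 1 ≤ T := hH.trans hHT
  have hH0 : 0 < H := by linarith
  have hT0 : 0 < T := by linarith
  have c1 := log_cont hH0
  rw [intervalIntegral.integral_sub (c1.intervalIntegrable _ _) (by simp), intervalIntegral.integral_const, Real.log_div hT0.ne' (by positivity)]
  set I := ∫ τ in (-T)..T, Real.log ‖(⟨H, τ⟩ : ℂ)‖
  have hre : ∀ τ : ℝ, H ≤ ‖(⟨H, τ⟩ : ℂ)‖ := fun τ => by
    have := Complex.re_le_norm (⟨H, τ⟩ : ℂ); exact this
  have lo : 2 * T * Real.log T - 2 * T ≤ I := by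
    have : ∫ τ in (-T)..T, Real.log τ = 2 * T * Real.log T - 2 * T := by
      rw [integral_log, Real.log_neg_eq_log]; ring
    rw [← this]
    refine intervalIntegral.integral_mono_on (by linarith) intervalIntegral.intervalIntegrable_log' (c1.intervalIntegrable _ _) fun τ _ => ?_
    rcases eq_or_ne τ 0 with rfl | h0
    · rw [Real.log_zero]; exact Real.log_nonneg (hH.trans (hre 0))
    · rw [← Real.log_abs τ]
      exact Real.log_le_log (abs_pos.2 h0) (Complex.abs_im_le_norm (⟨H, τ⟩ : ℂ))
  have hnorm : ∀ τ : ℝ, ‖(⟨H, τ⟩ : ℂ)‖ ≤ H + |τ| := fun τ => by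
    have := Complex.norm_le_abs_re_add_abs_im (⟨H, τ⟩ : ℂ)
    simpa [abs_of_pos hH0] using this
  have up : I ≤ 2 * ((H + T) * Real.log (H + T) - H * Real.log H - T) := by
    have s : I = (∫ τ in (-T)..0, Real.log ‖(⟨H, τ⟩ : ℂ)‖) + ∫ τ in (0:ℝ)..T, Real.log ‖(⟨H, τ⟩ : ℂ)‖ :=
      (intervalIntegral.integral_add_adjacent_intervals (c1.intervalIntegrable _ _) (c1.intervalIntegrable _ _)).symm
    have u2 : ∫ τ in (0:ℝ)..T, Real.log ‖(⟨H, τ⟩ : ℂ)‖ ≤ ∫ τ in (0:ℝ)..T, Real.log (H + τ) := by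
      refine intervalIntegral.integral_mono_on hT0.le (c1.intervalIntegrable _ _) ?_ fun τ hτ => ?_
      · refine ContinuousOn.intervalIntegrable ?_
        refine ContinuousOn.log (by fun_prop) fun τ hτ => ?_
        rw [Set.uIcc_of_le hT0.le] at hτ; linarith [hτ.1]
      · refine Real.log_le_log (lt_of_lt_of_le hH0 (hre τ)) ?_
        have := hnorm τ; rwa [abs_of_nonneg hτ.1] at this
    have u1 : ∫ τ in (-T)..0, Real.log ‖(⟨H, τ⟩ : ℂ)‖ ≤ ∫ τ in (-T)..0, Real.log (H - τ) := by
      refine intervalIntegral.integral_mono_on (by linarith) (c1.intervalIntegrable _ _) ?_ fun τ hτ => ?_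
      · refine ContinuousOn.intervalIntegrable ?_
        refine ContinuousOn.log (by fun_prop) fun τ hτ => ?_
        rw [Set.uIcc_of_le (by linarith)] at hτ; linarith [hτ.2]
      · refine Real.log_le_log (lt_of_lt_of_le hH0 (hre τ)) ?_
        have := hnorm τ; rwa [abs_of_nonpos hτ.2, ← sub_eq_add_neg] at this
    rw [intervalIntegral.integral_comp_add_left (fun x => Real.log x), integral_log] at u2
    rw [intervalIntegral.integral_comp_sub_left (fun x => Real.log x), integral_log] at u1
    simp only [sub_neg_eq_add, sub_zero, add_zero] at u1 u2
    rw [s]; linarith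
  have hl1 : (H + T) * Real.log (H + T) - H * Real.log H - T * Real.log T ≤ H * (1 + Real.log (2*T)) := by
    have a1 : Real.log (H + T) ≤ Real.log (2*T) := Real.log_le_log (by linarith) (by linarith)
    have a2 : Real.log (H + T) ≤ Real.log T + H / T := by
      have : Real.log ((H+T)/T) ≤ (H+T)/T - 1 := Real.log_le_sub_one_of_pos (by positivity)
      rw [Real.log_div (by positivity) hT0.ne'] at this
      have e : (H+T)/T - 1 = H/T := by field_simp; ring
      linarith
    have a3 : T * Real.log (H + T) ≤ T * Real.log T + H := by
      calc T * Real.log (H+T) ≤ T * (Real.log T + H/T) := mul_le_mul_of_nonneg_left a2 hT0.le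
        _ = _ := by field_simp
    have a4 : 0 ≤ H * Real.log H := mul_nonneg hH0.le (Real.log_nonneg hH)
    have a5 : H * Real.log (H+T) ≤ H * Real.log (2*T) := mul_le_mul_of_nonneg_left a1 hH0.le
    nlinarith
  rw [smul_eq_mul, abs_le]
  have p : 0 ≤ H * (1 + Real.log (2*T)) := mul_nonneg hH0.le (by have := Real.log_nonneg (show 1 ≤ 2*T by linarith); linarith)
  constructor <;> nlinarith

end B1

namespace B1
open Filter Topology Metric

lemma g_bound {f : ℝ → ℂ} {C η : ℝ} (hC : 0 ≤ C)
    (hb : ∀ t, ‖f t‖ ≤ C * (1+|t|)^η) (t : ℝ) : ‖f t‖^2 ≤ C^2 * (1+|t|)^(2*η) := by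
  have h0 : 0 ≤ 1 + |t| := by positivity
  calc ‖f t‖^2 ≤ (C * (1+|t|)^η)^2 := by
        exact pow_le_pow_left₀ (norm_nonneg _) (hb t) 2
    _ = _ := by
        rw [mul_pow, ← Real.rpow_natCast ((1+|t|)^η) 2, ← Real.rpow_mul h0]
        congr 2; push_cast; ring

lemma shift_est {f : ℝ → ℂ} (hf : Continuous f) {C η : ℝ} (hC : 0 ≤ C) (hη : 0 < η) (hη1 : η ≤ 1/8)
    (hb : ∀ t, ‖f t‖ ≤ C * (1+|t|)^η) {H T : ℝ} (hH : 1 ≤ H) (hHT : H ≤ T) (s : ℝ) :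
    |(∫ τ in (-T)..T, ‖f (τ + H*s)‖^2) - ∫ τ in (-T)..T, ‖f τ‖^2| ≤
      8 * C^2 * H * T^(6*η) * (1+|s|)^(1-2*η) := by
  have hT : 1 ≤ T := hH.trans hHT
  have hT0 : 0 < T := by linarith
  set g : ℝ → ℝ := fun t => ‖f t‖^2 with hg
  have hgc : Continuous g := by fun_prop
  have hg0 : ∀ t, 0 ≤ g t := fun t => by positivity
  set h := H*s with hh
  set M := C^2 * (1+T+|h|)^(2*η) with hM
  have hM0 : 0 ≤ M := by positivity
  have hgM : ∀ t, |t| ≤ T + |h| → ‖g t‖ ≤ M := by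
    intro t ht
    rw [Real.norm_of_nonneg (hg0 t)]
    refine (g_bound hC hb t).trans ?_
    refine mul_le_mul_of_nonneg_left ?_ (by positivity)
    exact Real.rpow_le_rpow (by positivity) (by linarith) (by linarith)
  have e1 : (∫ τ in (-T)..T, ‖f (τ + h)‖^2) = ∫ τ in (-T+h)..(T+h), g τ := by
    rw [← intervalIntegral.integral_comp_add_right]
  have ii : ∀ a b, IntervalIntegrable g volume a b := fun a b => hgc.intervalIntegrable a b
  have e2 : (∫ τ in (-T+h)..(T+h), g τ) - (∫ τ in (-T)..T, g τ) =
      (∫ τ in T..(T+h), g τ) - ∫ τ in (-T)..(-T+h), g τ := by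
    have a1 := intervalIntegral.integral_add_adjacent_intervals (ii (-T) (-T+h)) (ii (-T+h) (T+h))
    have a2 := intervalIntegral.integral_add_adjacent_intervals (ii (-T) T) (ii T (T+h))
    linarith
  have uI : ∀ a b t : ℝ, t ∈ Set.uIoc a b → |a| ≤ T + |h| → |b| ≤ T + |h| → |t| ≤ T + |h| := by
    intro a b t ht ha hb
    rw [abs_le] at *
    rcases Set.mem_uIoc.1 ht with h1 | h1 <;> constructor <;> linarith [h1.1, h1.2]
  have t1 : |T| ≤ T + |h| := by rw [abs_of_pos hT0]; linarith [abs_nonneg h]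
  have t2 : |-T| ≤ T + |h| := by rw [abs_neg]; exact t1
  have t3 : |T+h| ≤ T + |h| := by
    have := abs_add_le T h; rwa [abs_of_pos hT0] at this
  have t4 : |-T+h| ≤ T + |h| := by
    have := abs_add_le (-T) h; rwa [abs_neg, abs_of_pos hT0] at this
  have nb : ∀ a b : ℝ, |a| ≤ T + |h| → |b| ≤ T + |h| → |∫ τ in a..b, g τ| ≤ M * |b - a| := by
    intro a b ha hb
    rw [← Real.norm_eq_abs]
    exact intervalIntegral.norm_integral_le_of_norm_le_const fun t ht => hgM t (uI a b t ht ha hb)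
  have b1 : |(∫ τ in (-T+h)..(T+h), g τ) - (∫ τ in (-T)..T, g τ)| ≤ 4 * M * |h| := by
    rw [e2]
    have c1 := nb T (T+h) t1 t3
    have c2 := nb (-T) (-T+h) t2 t4
    rw [show T + h - T = h by ring] at c1
    rw [show -T + h - -T = h by ring] at c2
    have := abs_sub (∫ τ in T..(T+h), g τ) (∫ τ in (-T)..(-T+h), g τ)
    have : 0 ≤ M * |h| := by positivity
    linarith
  have b2 : |(∫ τ in (-T+h)..(T+h), g τ) - (∫ τ in (-T)..T, g τ)| ≤ 4 * M * T := by
    have c1 := nb (-T+h) (T+h) t4 t3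
    have c2 := nb (-T) (T) t2 t1
    rw [show T + h - (-T+h) = 2*T by ring, abs_of_pos (by linarith : 0 < 2*T)] at c1
    rw [show T - -T = 2*T by ring, abs_of_pos (by linarith : 0 < 2*T)] at c2
    have := abs_sub (∫ τ in (-T+h)..(T+h), g τ) (∫ τ in (-T)..T, g τ)
    linarith
  have mm : min |h| T ≤ |h|^(1-4*η) * T^(4*η) := by
    rcases le_total |h| T with h1 | h1
    · rw [min_eq_left h1]
      rcases (abs_nonneg h).eq_or_lt with h2 | h2
      · rw [← h2]; positivity
      calc |h| = |h|^(1-4*η) * |h|^(4*η) := by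
            rw [← Real.rpow_add h2]; simp
        _ ≤ _ := by
            refine mul_le_mul_of_nonneg_left ?_ (by positivity)
            exact Real.rpow_le_rpow (abs_nonneg _) h1 (by linarith)
    · rw [min_eq_right h1]
      calc T = T^(1-4*η) * T^(4*η) := by
            rw [← Real.rpow_add hT0]; simp
        _ ≤ _ := by
            refine mul_le_mul_of_nonneg_right ?_ (by positivity)
            exact Real.rpow_le_rpow hT0.le h1 (by linarith)
  have hs0 : 0 < 1 + |s| := by positivity
  have hha : |h| = H * |s| := by rw [hh, abs_mul, abs_of_pos (by linarith)]
  have d1 : |h|^(1-4*η) ≤ H * (1+|s|)^(1-4*η) := by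
    rw [hha, Real.mul_rpow (by linarith) (abs_nonneg _)]
    refine mul_le_mul ?_ ?_ (by positivity) (by linarith)
    · calc H^(1-4*η) ≤ H^(1:ℝ) := Real.rpow_le_rpow_of_exponent_le hH (by linarith)
        _ = H := Real.rpow_one H
    · exact Real.rpow_le_rpow (abs_nonneg _) (by linarith) (by linarith)
  have d2 : (1+T+|h|)^(2*η) ≤ 2 * T^(2*η) * (1+|s|)^(2*η) := by
    calc (1+T+|h|)^(2*η) ≤ (2*T*(1+|s|))^(2*η) := by
          refine Real.rpow_le_rpow (by positivity) ?_ (by linarith)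
          rw [hha]
          have : H * |s| ≤ T * |s| := mul_le_mul_of_nonneg_right hHT (abs_nonneg _)
          have : 0 ≤ T * |s| := by positivity
          nlinarith
      _ = 2^(2*η) * T^(2*η) * (1+|s|)^(2*η) := by
          rw [Real.mul_rpow (by positivity) hs0.le, Real.mul_rpow (by norm_num) hT0.le]
      _ ≤ _ := by
          have : (2:ℝ)^(2*η) ≤ 2^(1:ℝ) := Real.rpow_le_rpow_of_exponent_le (by norm_num) (by linarith)
          rw [Real.rpow_one] at this
          gcongr
  have main : |(∫ τ in (-T+h)..(T+h), g τ) - (∫ τ in (-T)..T, g τ)| ≤ 4 * M * min |h| T := by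
    rcases le_total |h| T with h1 | h1
    · rw [min_eq_left h1]; exact b1
    · rw [min_eq_right h1]; exact b2
  change |(∫ τ in (-T)..T, ‖f (τ + h)‖^2) - ∫ τ in (-T)..T, g τ| ≤ _
  rw [e1]
  refine main.trans ?_
  calc 4 * M * min |h| T ≤ 4 * (C^2 * (2 * T^(2*η) * (1+|s|)^(2*η))) * ((H * (1+|s|)^(1-4*η)) * T^(4*η)) := by
        refine mul_le_mul ?_ (mm.trans ?_) (by positivity) (by positivity)
        · rw [hM]; gcongr
        · gcongr
    _ = 8 * C^2 * H * (T^(2*η) * T^(4*η)) * ((1+|s|)^(2*η) * (1+|s|)^(1-4*η)) := by ring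
    _ = _ := by
        rw [← Real.rpow_add hT0, ← Real.rpow_add hs0]
        ring_nf

lemma unsm {f : ℝ → ℂ} (hf : Continuous f) {C η : ℝ} (hC : 0 ≤ C) (hη : 0 < η) (hη1 : η ≤ 1/8)
    (hb : ∀ t, ‖f t‖ ≤ C * (1+|t|)^η) {H T : ℝ} (hH : 1 ≤ H) (hHT : H ≤ T) :
    IntervalIntegrable (JJ f H) volume (-T) T ∧
    |(∫ τ in (-T)..T, JJ f H τ) - ∫ τ in (-T)..T, ‖f τ‖^2| ≤
      8 * C^2 * Kc (1-2*η) * (H * T^(6*η)) := by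
  have hT : 1 ≤ T := hH.trans hHT
  have hT0 : 0 < T := by linarith
  have hle : -T ≤ T := by linarith
  have hprod : Integrable (Function.uncurry fun τ s : ℝ => ‖f (τ + H*s)‖^2 * (1+s^2)⁻¹)
      ((volume.restrict (Set.Ioc (-T) T)).prod volume) := by
    have p1 : Integrable (fun τ : ℝ => C^2 * H^(2*η) * (1+|τ|)^(2*η)) (volume.restrict (Set.Ioc (-T) T)) := by
      have : Continuous (fun τ : ℝ => C^2 * H^(2*η) * (1+|τ|)^(2*η)) := by
        refine continuous_const.mul ?_
        exact Continuous.rpow_const (by fun_prop) fun τ => Or.inr (by linarith)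
      exact (this.integrableOn_Icc).mono_set Set.Ioc_subset_Icc_self
    have p2 := pw_int (a := 2*η) (by linarith)
    refine (p1.mul_prod p2).mono' ?_ ?_
    · refine Continuous.aestronglyMeasurable ?_
      unfold Function.uncurry
      refine Continuous.mul (by fun_prop) ?_
      exact Continuous.inv₀ (by fun_prop) fun x => by positivity
    · refine Eventually.of_forall fun ⟨τ, s⟩ => ?_
      simp only [Function.uncurry]
      rw [Real.norm_of_nonneg (by positivity)]
      have : (1 + |τ+H*s|)^(2*η) ≤ H^(2*η) * (1+|τ|)^(2*η) * (1+|s|)^(2*η) := by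
        rw [← Real.mul_rpow (by linarith) (by positivity), ← Real.mul_rpow (by positivity) (by positivity)]
        refine Real.rpow_le_rpow (by positivity) ?_ (by linarith)
        have a1 := abs_add_le τ (H*s)
        rw [abs_mul, abs_of_pos (by linarith : 0 < H)] at a1
        have h1 := abs_nonneg τ
        have h2 := abs_nonneg s
        have h3 : 0 ≤ H * (|τ| * |s|) := by positivity
        have h4 : |τ| ≤ H * |τ| := by nlinarith
        nlinarith
      calc ‖f (τ + H*s)‖^2 * (1+s^2)⁻¹ ≤ (C^2 * (H^(2*η) * (1+|τ|)^(2*η) * (1+|s|)^(2*η))) * (1+s^2)⁻¹ := by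
            refine mul_le_mul_of_nonneg_right ((g_bound hC hb _).trans ?_) (by positivity)
            exact mul_le_mul_of_nonneg_left this (by positivity)
        _ = _ := by ring
  have hJ : Integrable (JJ f H) (volume.restrict (Set.Ioc (-T) T)) := by
    have := hprod.integral_prod_left
    exact this.const_mul (π⁻¹)
  refine ⟨(intervalIntegrable_iff_integrableOn_Ioc_of_le hle).2 hJ, ?_⟩
  set G : ℝ → ℝ := fun s => ∫ τ in (-T)..T, ‖f (τ + H*s)‖^2 with hG
  set I := ∫ τ in (-T)..T, ‖f τ‖^2 with hI
  have sw : (∫ τ in (-T)..T, JJ f H τ) = π⁻¹ * ∫ s : ℝ, G s * (1+s^2)⁻¹ := by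
    unfold JJ
    rw [intervalIntegral.integral_const_mul, intervalIntegral.integral_of_le hle,
      integral_integral_swap hprod]
    congr 1
    refine integral_congr_ae (Eventually.of_forall fun s => ?_)
    simp only [hG]
    rw [intervalIntegral.integral_of_le hle, integral_mul_const]
  have hGi : Integrable (fun s => G s * (1+s^2)⁻¹) := by
    refine hprod.integral_prod_right.congr (Eventually.of_forall fun s => ?_)
    simp only [hG, Function.uncurry]
    rw [intervalIntegral.integral_of_le hle, integral_mul_const]
  have hI1 : I = π⁻¹ * ∫ s : ℝ, I * (1+s^2)⁻¹ := by
    rw [integral_const_mul, integral_univ_inv_one_add_sq]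
    field_simp
  have hIi : Integrable (fun s : ℝ => I * (1+s^2)⁻¹) := integrable_inv_one_add_sq.const_mul I
  rw [sw, hI1, ← mul_sub, ← integral_sub hGi hIi, abs_mul, abs_of_pos (by positivity : 0 < π⁻¹)]
  have pp := pw_int (a := 1-2*η) (by linarith)
  have bd : ‖∫ s : ℝ, (G s * (1+s^2)⁻¹ - I * (1+s^2)⁻¹)‖ ≤
      ∫ s : ℝ, (8 * C^2 * H * T^(6*η)) * ((1+|s|)^(1-2*η) * (1+s^2)⁻¹) := by
    refine norm_integral_le_of_norm_le (pp.const_mul _) (Eventually.of_forall fun s => ?_)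
    rw [← sub_mul, norm_mul, Real.norm_of_nonneg (by positivity : 0 ≤ (1+s^2)⁻¹), ← mul_assoc]
    refine mul_le_mul_of_nonneg_right ?_ (by positivity)
    exact shift_est hf hC hη hη1 hb hH hHT s
  rw [integral_const_mul] at bd
  change _ ≤ _ * Kc (1-2*η) at bd
  have hpi : π⁻¹ ≤ 1 := inv_le_one_of_one_le₀ (by linarith [Real.pi_gt_three])
  rw [← Real.norm_eq_abs]
  calc π⁻¹ * ‖∫ s : ℝ, (G s * (1+s^2)⁻¹ - I * (1+s^2)⁻¹)‖ ≤ 1 * ‖∫ s : ℝ, (G s * (1+s^2)⁻¹ - I * (1+s^2)⁻¹)‖ :=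
        mul_le_mul_of_nonneg_right hpi (norm_nonneg _)
    _ ≤ 8 * C^2 * H * T^(6*η) * Kc (1-2*η) := by rw [one_mul]; exact bd
    _ = _ := by ring

lemma F_main (hRH : RiemannHypothesis) {B₁ B₂ c D X₀ : ℝ} (hB₁ : 0 < B₁) (hB₁₂ : B₁ < B₂)
    (hB₂ : B₂ < 1) (hc : 0 < c) (hV : HV B₁ B₂ c D X₀) {η : ℝ} (hη : 0 < η) (hη1 : η ≤ 1/8) :
    ∃ C : ℝ, 0 < C ∧ ∀ T U H : ℝ, 1 ≤ H → H ≤ T → T ≤ Real.exp U → 0 < U → X₀ ≤ Real.exp U →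
      ‖zetaPairCorr (Real.exp U) T - ((T / π * (Real.log (T / (2 * π)) - 1) : ℝ) : ℂ)‖ ≤
        C * (T^(1/2+2*η) + H * T^(6*η) + H * (1 + Real.log (2*T)) + T^3 * Err η (min c 1) B₁ B₂ H U) := by
  obtain ⟨C1, hC1, h1⟩ := F_vs_S hRH hη hη1
  obtain ⟨C2, hC2, h2⟩ := SS_bound hRH hη (by linarith)
  obtain ⟨C3, hC3, h3⟩ := JJ_est hRH hB₁ hB₁₂ hB₂ hc hV hη hη1
  have hK := Kc_nonneg (1-2*η)
  set K := 8 * C2^2 * Kc (1-2*η) with hKd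
  have hK0 : 0 ≤ K := by positivity
  refine ⟨C1 + K + 2 + 4*C3, by positivity, ?_⟩
  intro T U H hH hHT hTU hU hXU
  have hT : 1 ≤ T := hH.trans hHT
  have hT0 : 0 < T := by linarith
  have hle : -T ≤ T := by linarith
  obtain ⟨u1, u2⟩ := unsm (SS_cont hU.le) hC2.le hη hη1 (fun t => h2 U t hU) hH hHT
  have f1 := h1 T U hT hTU hU
  have l1 := log_main hH hHT
  set E := Err η (min c 1) B₁ B₂ H U with hE
  have hE0 : 0 ≤ E := by
    have : 0 < H := by linarith
    rw [hE]; unfold Err; positivity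
  set I := ∫ τ in (-T)..T, ‖SS U τ‖^2
  set J := ∫ τ in (-T)..T, JJ (SS U) H τ
  set L := ∫ τ in (-T)..T, (Real.log ‖(⟨H,τ⟩:ℂ)‖ - Real.log (2*π))
  have lc : IntervalIntegrable (fun τ => Real.log ‖(⟨H,τ⟩:ℂ)‖ - Real.log (2*π)) volume (-T) T :=
    ((log_cont (by linarith : 0 < H)).sub continuous_const).intervalIntegrable _ _
  have jl : |J - L| ≤ 4 * C3 * (T^3 * E) := by
    have e : J - L = ∫ τ in (-T)..T, (JJ (SS U) H τ - (Real.log ‖(⟨H,τ⟩:ℂ)‖ - Real.log (2*π))) := by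
      rw [intervalIntegral.integral_sub u1 lc]
    rw [e, ← Real.norm_eq_abs]
    have := intervalIntegral.norm_integral_le_of_norm_le_const (a := -T) (b := T)
      (f := fun τ => JJ (SS U) H τ - (Real.log ‖(⟨H,τ⟩:ℂ)‖ - Real.log (2*π))) (C := C3 * (T^2+T^2) * E) ?_
    · refine this.trans (le_of_eq ?_)
      rw [abs_of_pos (by linarith)]; ring
    · intro τ hτ
      rw [Set.uIoc_of_le hle] at hτ
      refine (h3 U H τ hU hXU hH).trans ?_
      have a1 : H^2 ≤ T^2 := by nlinarith
      have a2 : τ^2 ≤ T^2 := by nlinarith [hτ.1, hτ.2]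
      gcongr
  have il : |(2*π)⁻¹ * I - T/π * (Real.log (T/(2*π)) - 1)| ≤ K * (H * T^(6*η)) + 2 * (H * (1 + Real.log (2*T))) + 4 * C3 * (T^3*E) := by
    have e : (2*π)⁻¹ * I - T/π * (Real.log (T/(2*π)) - 1) = (2*π)⁻¹ * (I - 2*T*(Real.log (T/(2*π)) - 1)) := by
      field_simp
    rw [e, abs_mul, abs_of_pos (by positivity : 0 < (2*π)⁻¹)]
    have hpi : (2*π)⁻¹ ≤ 1 := inv_le_one_of_one_le₀ (by linarith [Real.pi_gt_three])
    have := mul_le_mul_of_nonneg_right hpi (abs_nonneg (I - 2*T*(Real.log (T/(2*π)) - 1)))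
    refine this.trans ?_
    rw [one_mul]
    set m := 2*T*(Real.log (T/(2*π)) - 1)
    have t1 : |I - m| ≤ |J - I| + |J - L| + |L - m| := by
      have q1 := abs_sub_le I J m
      have q2 := abs_sub_le J L m
      rw [abs_sub_comm I J] at q1
      linarith
    linarith
  have tri : ‖zetaPairCorr (Real.exp U) T - ((T / π * (Real.log (T / (2 * π)) - 1) : ℝ) : ℂ)‖ ≤
      C1 * T^(1/2+2*η) + |(2*π)⁻¹ * I - T/π * (Real.log (T/(2*π)) - 1)| := by
    have q := norm_sub_le_norm_sub_add_norm_sub (zetaPairCorr (Real.exp U) T) (((2*π)⁻¹ * I : ℝ) : ℂ) ((T / π * (Real.log (T / (2 * π)) - 1) : ℝ) : ℂ)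
    refine q.trans (add_le_add f1 (le_of_eq ?_))
    rw [← Complex.ofReal_sub, Complex.norm_real, Real.norm_eq_abs]
  refine (tri.trans (add_le_add_right il _)).trans ?_
  have a1 : 0 ≤ T^(1/2+2*η) := by positivity
  have a2 : 0 ≤ H * T^(6*η) := by have : 0 < H := by linarith
                                  positivity
  have a3 : 0 ≤ H * (1 + Real.log (2*T)) := by
    have : 0 ≤ Real.log (2*T) := Real.log_nonneg (by linarith)
    have : 0 < H := by linarith
    positivity
  have a4 : 0 ≤ T^3 * E := by positivity
  generalize T^(1/2+2*η) = x1 at *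
  generalize H * T^(6*η) = x2 at *
  generalize H * (1 + Real.log (2*T)) = x3 at *
  generalize T^3 * E = x4 at *
  have : (C1 + K + 2 + 4*C3) * (x1+x2+x3+x4) - (C1*x1 + (K*x2+2*x3+4*C3*x4)) =
    (K+2+4*C3)*x1 + (C1+2+4*C3)*x2 + (C1+K+4*C3)*x3 + (C1+K+2)*x4 := by ring
  have : 0 ≤ (K+2+4*C3)*x1 + (C1+2+4*C3)*x2 + (C1+K+4*C3)*x3 + (C1+K+2)*x4 := by positivity
  linarith

end B1

namespace B1
open Filter Topology Metric

lemma exp_kill (N : ℝ) : ∀ᶠ T : ℝ in atTop, T^N * Real.exp (-(T^(3/4:ℝ)/4)) ≤ 1 := by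
  have h1 := tendsto_rpow_mul_exp_neg_mul_atTop_nhds_zero (N*(4/3)) (1/4) (by norm_num)
  have h2 := h1.comp (tendsto_rpow_atTop (by norm_num : (0:ℝ) < 3/4))
  filter_upwards [h2.eventually (eventually_le_nhds (by norm_num : (0:ℝ) < 1)), eventually_gt_atTop 0] with T hT hT0
  simp only [Function.comp] at hT
  rw [← Real.rpow_mul hT0.le] at hT
  have e1 : 3/4*(N*(4/3)) = N := by ring
  have e2 : -(1/4) * T^(3/4:ℝ) = -(T^(3/4:ℝ)/4) := by ring
  rwa [e1, e2] at hT

lemma err_bd {η ε c' B₁ B₂ A₂ T U H Y Z Q : ℝ} (hη : 0 < η) (hη1 : η ≤ 1/8) (hηε : 6*η ≤ ε)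
    (hηA : 2*η*A₂ ≤ ε) (hc : 0 < c') (hc1 : c' ≤ 1) (hT : 2 ≤ T) (hA : 0 < A₂)
    (hUA : Real.exp U ≤ T^A₂) (hU : 0 < U)
    (hB₂ : B₂ < 1)
    (hY : Y = Real.exp (B₁*U)) (hYT : Y ≤ T) (hZ : Z = Real.exp (B₂*U))
    (hQ : Q = T * (T/Y)^(-(1:ℝ)/4)) (hH1 : T^(3/(3+c')) ≤ H) (hH2 : Q ≤ H) (hHT : H ≤ T)
    (hk : T^(3+2*A₂) * Real.exp (-(T^(3/4:ℝ)/4)) ≤ 1) (h34 : T^(3/4:ℝ) ≤ H) :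
    T^3 * Err η c' B₁ B₂ H U ≤ T^ε * (3 * H + T * (T/Z)^2) := by
  have hT0 : 0 < T := by linarith
  have hT1 : 1 ≤ T := by linarith
  have hH : 1 ≤ H := le_trans (Real.one_le_rpow hT1 (by norm_num)) h34
  have hH0 : 0 < H := by linarith
  have hY0 : 0 < Y := by rw [hY]; positivity
  have hZ0 : 0 < Z := by rw [hZ]; positivity
  have hε : 0 < ε := by linarith
  have hTε : 1 ≤ T^ε := Real.one_le_rpow hT1 hε.le
  have hH2η : H^(2*η) ≤ T^ε :=
    (Real.rpow_le_rpow hH0.le hHT (by linarith)).trans (Real.rpow_le_rpow_of_exponent_le hT1 (by linarith))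
  -- term 1
  have e1 : T^3 * H^(-2 - c' + 2*η) ≤ T^ε * H := by
    have q : H^(-2 - c' + 2*η) = (H^(3+c'))⁻¹ * H * H^(2*η) := by
      rw [← Real.rpow_neg hH0.le]
      nth_rewrite 3 [← Real.rpow_one H]
      rw [← Real.rpow_add hH0, ← Real.rpow_add hH0]
      ring_nf
    have q2 : T^3 ≤ H^(3+c') := by
      have := Real.rpow_le_rpow (by positivity) hH1 (by linarith : 0 ≤ 3+c')
      rw [← Real.rpow_mul hT0.le, div_mul_cancel₀ _ (by linarith : 3+c' ≠ 0)] at this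
      exact_mod_cast this
    have q3 : T^3 * (H^(3+c'))⁻¹ ≤ 1 := by
      rw [← div_eq_mul_inv]; exact (div_le_one (by positivity)).2 q2
    rw [q]
    calc T^3 * ((H^(3+c'))⁻¹ * H * H^(2*η)) = (T^3 * (H^(3+c'))⁻¹) * (H * H^(2*η)) := by ring
      _ ≤ 1 * (H * T^ε) := by gcongr
      _ = _ := by ring
  have hQ0 : 0 < Q := by rw [hQ]; positivity
  have hQ4 : Q^4 = T^3 * Y := by
    rw [hQ, mul_pow, ← Real.rpow_natCast ((T/Y)^(-(1:ℝ)/4)) 4, ← Real.rpow_mul (by positivity)]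
    norm_num
    rw [Real.rpow_neg_one]
    field_simp
  have hYQ : Y ≤ Q := by
    have : Y^4 ≤ Q^4 := by
      rw [hQ4]
      have : Y^3 ≤ T^3 := by gcongr
      nlinarith
    exact le_of_pow_le_pow_left₀ (by norm_num) hQ0.le this
  have e2 : T^3 * (H^(-4 + 2*η) * Real.exp (2*B₁*U)) ≤ T^ε * H := by
    have q : H^(-4 + 2*η) = (H^4)⁻¹ * H^(2*η) := by
      rw [Real.rpow_add hH0, Real.rpow_neg hH0.le]; norm_cast
    have q1 : Real.exp (2*B₁*U) = Y^2 := by rw [hY, ← Real.exp_nat_mul]; push_cast; ring_nf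
    have q2 : T^3 * Y ≤ H^4 := by rw [← hQ4]; gcongr
    have q3 : T^3 * Y * (H^4)⁻¹ ≤ 1 := by
      rw [← div_eq_mul_inv]; exact (div_le_one (by positivity)).2 q2
    rw [q, q1]
    calc T^3 * ((H^4)⁻¹ * H^(2*η) * Y^2) = (T^3 * Y * (H^4)⁻¹) * (Y * H^(2*η)) := by ring
      _ ≤ 1 * (H * T^ε) := by
          have := hYQ.trans hH2
          gcongr
      _ = _ := by ring
  have e3 : T^3 * Real.exp (-B₂*U)^(2 - 2*η) ≤ T^ε * (T * (T/Z)^2) := by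
    have q : Real.exp (-B₂*U)^(2 - 2*η) = (Z^2)⁻¹ * Real.exp (2*η*(B₂*U)) := by
      rw [hZ, ← Real.exp_mul, ← Real.exp_nat_mul, ← Real.exp_neg, ← Real.exp_add]
      push_cast; ring_nf
    have q1 : Real.exp (2*η*(B₂*U)) ≤ T^ε := by
      calc Real.exp (2*η*(B₂*U)) ≤ Real.exp (U*(2*η)) := by
            apply Real.exp_le_exp.2
            have : B₂ * U ≤ U := by nlinarith
            nlinarith
        _ = (Real.exp U)^(2*η) := by rw [← Real.exp_mul]
        _ ≤ (T^A₂)^(2*η) := Real.rpow_le_rpow (by positivity) hUA (by linarith)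
        _ = T^(A₂*(2*η)) := by rw [← Real.rpow_mul hT0.le]
        _ ≤ _ := Real.rpow_le_rpow_of_exponent_le hT1 (by linarith)
    rw [q]
    calc T^3 * ((Z^2)⁻¹ * Real.exp (2*η*(B₂*U))) ≤ T^3 * ((Z^2)⁻¹ * T^ε) := by gcongr
      _ = _ := by field_simp
  have e4 : T^3 * (Real.exp (2*U) * Real.exp (-(H/4))) ≤ T^ε * H := by
    have q : Real.exp (2*U) ≤ T^(2*A₂) := by
      rw [show 2*U = U*2 by ring, Real.exp_mul, show 2*A₂ = A₂*2 by ring, Real.rpow_mul hT0.le]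
      exact Real.rpow_le_rpow (by positivity) hUA (by norm_num)
    calc T^3 * (Real.exp (2*U) * Real.exp (-(H/4))) ≤ T^3 * (T^(2*A₂) * Real.exp (-(T^(3/4:ℝ)/4))) := by
          gcongr
      _ = T^(3+2*A₂) * Real.exp (-(T^(3/4:ℝ)/4)) := by
          rw [Real.rpow_add hT0]; norm_cast; ring
      _ ≤ 1 := hk
      _ ≤ _ := by nlinarith
  unfold Err
  linarith

set_option maxHeartbeats 1000000 in
theorem final (hRH : RiemannHypothesis)
    (B₁ B₂ c : ℝ) (hB₁ : 0 < B₁) (hB₁₂ : B₁ < B₂) (hB₂ : B₂ < 1) (hc : 0 < c)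
    (D X₀ : ℝ) (hV : HV B₁ B₂ c D X₀) :
    ∀ A₁ A₂ : ℝ, 1 / B₂ < A₁ → A₁ ≤ A₂ → A₂ < 1 / B₁ →
      ∀ ε : ℝ, 0 < ε → ∃ C : ℝ, 0 < C ∧ ∃ T₀ : ℝ, 2 ≤ T₀ ∧
        ∀ T : ℝ, T₀ ≤ T → ∀ X : ℝ, T ^ A₁ ≤ X → X ≤ T ^ A₂ →
          ‖zetaPairCorr X T - ((T / π * (Real.log (T / (2 * π)) - 1) : ℝ) : ℂ)‖
            ≤ C * (T ^ (3 / (3 + c) + ε) +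
                T ^ (1 + ε) * (T / X ^ B₂) ^ 2 +
                T ^ (1 + ε) * (T / X ^ B₁) ^ (-(1 : ℝ) / 4)) := by
  intro A₁ A₂ hA₁ hA₁₂ hA₂ ε hε
  have hB₂0 : 0 < B₂ := hB₁.trans hB₁₂
  have hA1 : 1 < A₁ := lt_trans (by rw [lt_div_iff₀ hB₂0]; linarith) hA₁
  have hA0 : 0 < A₂ := by linarith
  set η := min (1/8) (min (ε/6) (ε/(2*A₂))) with hηd
  have hη : 0 < η := by positivity
  have hη1 : η ≤ 1/8 := min_le_left _ _
  have hηε : 6*η ≤ ε := by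
    have : η ≤ ε/6 := (min_le_right _ _).trans (min_le_left _ _)
    linarith
  have hηA : 2*η*A₂ ≤ ε := by
    have : η ≤ ε/(2*A₂) := (min_le_right _ _).trans (min_le_right _ _)
    rw [le_div_iff₀ (by positivity)] at this
    linarith
  obtain ⟨C, hC, hF⟩ := F_main hRH hB₁ hB₁₂ hB₂ hc hV hη hη1
  obtain ⟨T₁, hT₁⟩ := eventually_atTop.1 (exp_kill (3+2*A₂))
  set K := 1 + 2^ε/ε with hK
  have hK0 : 0 < K := by positivity
  refine ⟨C * (5 + K), by positivity, max 2 (max T₁ X₀), le_max_left _ _, ?_⟩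
  intro T hTT X hX1 hX2
  have hT : 2 ≤ T := (le_max_left _ _).trans hTT
  have hk := hT₁ T (((le_max_left _ _).trans (le_max_right _ _)).trans hTT)
  have hX₀ : X₀ ≤ T := ((le_max_right _ _).trans (le_max_right _ _)).trans hTT
  have hT0 : 0 < T := by linarith
  have hT1 : 1 ≤ T := by linarith
  have hTX : T ≤ X := by
    refine le_trans ?_ hX1
    calc T = T^(1:ℝ) := (Real.rpow_one T).symm
      _ ≤ _ := Real.rpow_le_rpow_of_exponent_le hT1 hA1.le
  have hX0 : 0 < X := by linarith
  set U := Real.log X with hU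
  have hU0 : 0 < U := Real.log_pos (by linarith)
  have hXU : Real.exp U = X := Real.exp_log hX0
  set Y := X^B₁ with hYd
  set Z := X^B₂ with hZd
  have hY : Y = Real.exp (B₁*U) := by rw [hYd, Real.rpow_def_of_pos hX0, mul_comm]
  have hZ : Z = Real.exp (B₂*U) := by rw [hZd, Real.rpow_def_of_pos hX0, mul_comm]
  have hY0 : 0 < Y := by rw [hY]; positivity
  have hZ0 : 0 < Z := by rw [hZ]; positivity
  have hY1 : 1 ≤ Y := Real.one_le_rpow (by linarith) hB₁.le
  have hYT : Y ≤ T := by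
    calc Y ≤ (T^A₂)^B₁ := Real.rpow_le_rpow hX0.le hX2 hB₁.le
      _ = T^(A₂*B₁) := by rw [← Real.rpow_mul hT0.le]
      _ ≤ T^(1:ℝ) := Real.rpow_le_rpow_of_exponent_le hT1 (by
          rw [lt_div_iff₀ hB₁] at hA₂; exact hA₂.le)
      _ = T := Real.rpow_one T
  set c' := min c 1 with hc'
  have hc0 : 0 < c' := by positivity
  have hc1 : c' ≤ 1 := min_le_right _ _
  set P := T^(3/(3+c')) with hP
  set Q := T * (T/Y)^(-(1:ℝ)/4) with hQ
  set H := max P Q with hH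
  have hPT : P ≤ T := by
    calc P ≤ T^(1:ℝ) := Real.rpow_le_rpow_of_exponent_le hT1 (by
          rw [div_le_one (by linarith)]; linarith)
      _ = T := Real.rpow_one T
  have hTY : 1 ≤ T/Y := (one_le_div hY0).2 hYT
  have hQT : Q ≤ T := by
    have : (T/Y)^(-(1:ℝ)/4) ≤ 1 := Real.rpow_le_one_of_one_le_of_nonpos hTY (by norm_num)
    calc Q ≤ T * 1 := mul_le_mul_of_nonneg_left this hT0.le
      _ = T := mul_one T
  have hQ34 : T^(3/4:ℝ) ≤ Q := by
    have a : T^(-(1:ℝ)/4) ≤ (T/Y)^(-(1:ℝ)/4) :=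
      Real.rpow_le_rpow_of_nonpos (by positivity) (div_le_self hT0.le hY1) (by norm_num)
    calc T^(3/4:ℝ) = T^(1:ℝ) * T^(-(1:ℝ)/4) := by rw [← Real.rpow_add hT0]; norm_num
      _ = T * T^(-(1:ℝ)/4) := by rw [Real.rpow_one]
      _ ≤ _ := mul_le_mul_of_nonneg_left a hT0.le
  have h34 : T^(3/4:ℝ) ≤ H := hQ34.trans (le_max_right _ _)
  have hHT : H ≤ T := max_le hPT hQT
  have hH1 : 1 ≤ H := le_trans (Real.one_le_rpow hT1 (by norm_num)) h34
  have hH0 : 0 < H := by linarith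
  have hE := err_bd (B₁ := B₁) (B₂ := B₂) hη hη1 hηε hηA hc0 hc1 hT hA0 (hXU.le.trans hX2) hU0 hB₂ hY hYT hZ hQ
    (le_max_left _ _) (le_max_right _ _) hHT hk h34
  have hFF := hF T U H hH1 hHT (by rw [hXU]; exact hTX) hU0 (by rw [hXU]; linarith)
  rw [hXU] at hFF
  refine hFF.trans ?_
  have hTε : 1 ≤ T^ε := Real.one_le_rpow hT1 hε.le
  have f1 : T^(1/2+2*η) ≤ T^ε * H := by
    have : T^(1/2+2*η) ≤ T^(3/4:ℝ) := Real.rpow_le_rpow_of_exponent_le hT1 (by linarith)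
    have : H ≤ T^ε * H := le_mul_of_one_le_left hH0.le hTε
    linarith
  have f2 : H * T^(6*η) ≤ T^ε * H := by
    rw [mul_comm]
    exact mul_le_mul_of_nonneg_right (Real.rpow_le_rpow_of_exponent_le hT1 hηε) hH0.le
  have f3 : H * (1 + Real.log (2*T)) ≤ K * (T^ε * H) := by
    have a := Real.log_le_rpow_div (by positivity : 0 ≤ 2*T) hε
    rw [Real.mul_rpow (by norm_num) hT0.le] at a
    have b : 1 + Real.log (2*T) ≤ K * T^ε := by
      have : 2^ε * T^ε / ε = 2^ε/ε * T^ε := by ring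
      rw [hK, add_mul]; linarith
    calc H * (1 + Real.log (2*T)) ≤ H * (K * T^ε) := mul_le_mul_of_nonneg_left b hH0.le
      _ = _ := by ring
  have hHR : H ≤ T^(3/(3+c)) + Q := by
    have p1 : 0 ≤ T^(3/(3+c)) := by positivity
    have p2 : 0 ≤ Q := le_trans (by positivity) hQ34
    refine max_le ?_ (by linarith)
    rcases le_total c 1 with h | h
    · rw [hP, hc', min_eq_left h]; linarith
    · rw [hP, hc', min_eq_right h]; norm_num
      linarith
  have hTH : T^ε * H ≤ T^(3/(3+c)+ε) + T^(1+ε) * (T/Y)^(-(1:ℝ)/4) := by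
    calc T^ε * H ≤ T^ε * (T^(3/(3+c)) + Q) := mul_le_mul_of_nonneg_left hHR (by positivity)
      _ = _ := by
        rw [Real.rpow_add hT0, Real.rpow_add hT0, Real.rpow_one, hQ]; ring
  have hTZ : T^ε * (T * (T/Z)^2) = T^(1+ε) * (T/Z)^2 := by
    rw [Real.rpow_add hT0, Real.rpow_one]; ring
  have hTZ0 : 0 ≤ T^(1+ε) * (T/Z)^2 := by positivity
  have hTH0 : 0 ≤ T^ε * H := by positivity
  rw [mul_add, hTZ] at hE
  rw [mul_assoc]
  refine mul_le_mul_of_nonneg_left ?_ hC.le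
  generalize T^(1/2+2*η) = x1 at *
  generalize H * T^(6*η) = x2 at *
  generalize H * (1 + Real.log (2*T)) = x3 at *
  generalize T^3 * Err η c' B₁ B₂ H U = x4 at *
  generalize T^(1+ε) * (T/Z)^2 = y1 at *
  generalize T^(3/(3+c)+ε) = y2 at *
  generalize T^(1+ε) * (T/Y)^(-(1:ℝ)/4) = y3 at *
  have a1 : x1+x2+x3+x4 ≤ (5+K) * (T^ε*H) + y1 := by linarith
  have a2 : (5+K) * (T^ε*H) ≤ (5+K) * (y2+y3) := mul_le_mul_of_nonneg_left hTH (by positivity)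
  have a3 : y1 ≤ (5+K)*y1 := le_mul_of_one_le_left hTZ0 (by linarith)
  linarith

end B1

/-- **Theorem B1 for the Riemann zeta function.** An asymptotic for `V(X,δ)` with power
saving in the range `X^{-B₂} ≤ δ ≤ X^{-B₁}` implies a pair correlation asymptotic. -/
theorem theoremB1_zeta (hRH : RiemannHypothesis)
    (B₁ B₂ c : ℝ) (hB₁ : 0 < B₁) (hB₁₂ : B₁ < B₂) (hB₂ : B₂ < 1) (hc : 0 < c)
    (D X₀ : ℝ)
    (hV : ∀ X : ℝ, X₀ ≤ X → ∀ δ : ℝ, X ^ (-B₂) ≤ δ → δ ≤ X ^ (-B₁) →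
      |zetaVarDelta X δ - 1 / 2 * δ * X ^ 2 *
          (Real.log (1 / δ) + 1 - Real.eulerMascheroniConstant - Real.log (2 * π))|
        ≤ D * δ ^ (1 + c) * X ^ 2) :
    ∀ A₁ A₂ : ℝ, 1 / B₂ < A₁ → A₁ ≤ A₂ → A₂ < 1 / B₁ →
      ∀ ε : ℝ, 0 < ε → ∃ C : ℝ, 0 < C ∧ ∃ T₀ : ℝ, 2 ≤ T₀ ∧
        ∀ T : ℝ, T₀ ≤ T → ∀ X : ℝ, T ^ A₁ ≤ X → X ≤ T ^ A₂ →
          ‖zetaPairCorr X T - ((T / π * (Real.log (T / (2 * π)) - 1) : ℝ) : ℂ)‖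
            ≤ C * (T ^ (3 / (3 + c) + ε) +
                T ^ (1 + ε) * (T / X ^ B₂) ^ 2 +
                T ^ (1 + ε) * (T / X ^ B₁) ^ (-(1 : ℝ) / 4)) := by
  exact B1.final hRH B₁ B₂ c hB₁ hB₁₂ hB₂ hc D X₀ hV
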